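/- arXiv:1711.10480 — 2 statements merged into one kernel-verified Lean document; each statement's English description precedes it below -/
import Mathlib

section
/- Let ν and a be real with a > 0. Set κ = 1 + a, h = a^{−a}, A₀ = (κ/a)^{ν+1}/√(2π), Z(x) = κ (h x²/4)^{1/κ}, and c₁ = −(1/(24a))·(11 + 24ν + 12ν² − a(25 + 24ν) + 11a²). Then as x → +∞ through positive real values, (x/2)^{−ν−1} L_ν(x; a) = A₀ Z^{−ν−3/2} e^{Z} (1 + c₁/Z + O(Z^{−2})); that is, the quantity Z(x)² · [ (x/2)^{−ν−1} L_ν(x;a) · Z(x)^{ν+3/2} e^{−Z(x)} / A₀ − 1 − c₁/Z(x) ] remains bounded as x → +∞. -/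
open Filter Topology

/-- The generalised Struve function
`L_ν(z;a) = (z/2)^{ν+1} Σ_{n≥0} (z/2)^{2n} / (Γ(n+3/2) Γ(an+ν+3/2))`,
with principal branch power and the entire reciprocal Gamma function
(`Complex.Gamma` vanishes at the poles, so division realises `1/Γ`). -/
noncomputable def struveL (ν a : ℝ) (z : ℂ) : ℂ :=
  (z / 2) ^ ((ν : ℂ) + 1) *
    ∑' n : ℕ, (z / 2) ^ (2 * n) /
      (Complex.Gamma ((n : ℂ) + 3 / 2) *
        Complex.Gamma ((a : ℂ) * (n : ℂ) + (ν : ℂ) + 3 / 2))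

/-- The variable `Z = κ (h x²/4)^{1/κ}` with `κ = 1 + a`, `h = a^{−a}`. -/
noncomputable def struveZ (a x : ℝ) : ℝ :=
  (1 + a) * (a ^ (-a) * x ^ 2 / 4) ^ (1 / (1 + a))


open MeasureTheory Set in
lemma gi_integrable (s b : ℝ) (hs : -1 < s) (hb : 0 < b) :
    IntegrableOn (fun t : ℝ => t ^ s * Real.exp (-(b * t))) (Ioi 0) := by
  have := integrableOn_rpow_mul_exp_neg_mul_rpow (p := 1) hs one_pos hb
  refine this.congr_fun (fun t _ => ?_) measurableSet_Ioi
  simp [Real.rpow_one]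

open MeasureTheory Set in
lemma gi_norm (s : ℝ) (z : ℂ) {t : ℝ} (ht : 0 < t) :
    ‖((t ^ s : ℝ) : ℂ) * Complex.exp (-(z * t))‖ = t ^ s * Real.exp (-(z.re * t)) := by
  rw [norm_mul, Complex.norm_exp, Complex.norm_real, Real.norm_of_nonneg (by positivity)]
  simp

open MeasureTheory Set in
lemma gi_meas (s : ℝ) (z : ℂ) : AEStronglyMeasurable
    (fun t : ℝ => ((t ^ s : ℝ) : ℂ) * Complex.exp (-(z * t))) (volume.restrict (Ioi 0)) := by
  refine Measurable.aestronglyMeasurable ?_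
  fun_prop

open MeasureTheory Set in
lemma gi_cintegrable (s : ℝ) (z : ℂ) (hs : -1 < s) (hz : 0 < z.re) :
    IntegrableOn (fun t : ℝ => ((t ^ s : ℝ) : ℂ) * Complex.exp (-(z * t))) (Ioi 0) := by
  refine (gi_integrable s z.re hs hz).mono' (gi_meas s z) ?_
  refine (ae_restrict_iff' measurableSet_Ioi).2 (Eventually.of_forall fun t ht => ?_)
  exact (gi_norm s z ht).le

open MeasureTheory Set in
lemma laplace_gamma (p : ℝ) (hp : 0 < p) (z : ℂ) (hz : 0 < z.re) :
    ∫ t in Ioi (0 : ℝ), ((t ^ (p - 1) : ℝ) : ℂ) * Complex.exp (-(z * t)) =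
      (Real.Gamma p : ℂ) * z ^ (-(p : ℂ)) := by
  set U : Set ℂ := {z | 0 < z.re} with hU
  have hUo : IsOpen U := isOpen_lt continuous_const Complex.continuous_re
  have hd : DifferentiableOn ℂ (fun z : ℂ => ∫ t in Ioi (0 : ℝ),
      ((t ^ (p - 1) : ℝ) : ℂ) * Complex.exp (-(z * t))) U := by
    intro w hw
    have hw' : 0 < w.re := hw
    have key := hasDerivAt_integral_of_dominated_loc_of_deriv_le (𝕜 := ℂ)
      (μ := volume.restrict (Ioi (0 : ℝ)))
      (F := fun (z : ℂ) (t : ℝ) => ((t ^ (p - 1) : ℝ) : ℂ) * Complex.exp (-(z * t)))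
      (F' := fun (z : ℂ) (t : ℝ) => ((t ^ (p - 1) : ℝ) : ℂ) * (Complex.exp (-(z * t)) * (-(1 * t))))
      (x₀ := w) (s := {z : ℂ | w.re / 2 < z.re})
      (bound := fun t => t ^ p * Real.exp (-(w.re / 2 * t)))
      ((isOpen_lt continuous_const Complex.continuous_re).mem_nhds (by
        show w.re / 2 < w.re; linarith))
      (Eventually.of_forall fun z => gi_meas _ _)
      (gi_cintegrable _ _ (by linarith) hw')
      (Measurable.aestronglyMeasurable (by fun_prop))
      ?_ (gi_integrable _ _ (by linarith) (by linarith)) ?_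
    · exact key.2.differentiableAt.differentiableWithinAt
    · refine (ae_restrict_iff' measurableSet_Ioi).2 (Eventually.of_forall fun t ht x hx => ?_)
      have ht' : 0 < t := ht
      rw [← mul_assoc, norm_mul, gi_norm _ _ ht']
      have : ‖(-(1 * (t : ℂ)))‖ = t := by simp [abs_of_pos ht']
      rw [this]
      have h1 : t ^ p = t ^ (p - 1) * t := by
        rw [← Real.rpow_add_one ht'.ne']; simp
      rw [h1]
      have h2 : Real.exp (-(x.re * t)) ≤ Real.exp (-(w.re / 2 * t)) := by
        apply Real.exp_le_exp.2
        have : w.re / 2 < x.re := hx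
        nlinarith
      have h3 : 0 < t ^ (p - 1) := by positivity
      calc _ = t ^ (p-1) * t * Real.exp (-(x.re * t)) := by ring
        _ ≤ _ := by gcongr
    · refine Eventually.of_forall fun t x hx => ?_
      have h1 : HasDerivAt (fun z : ℂ => -(z * t)) (-(1 * (t : ℂ))) x :=
        ((hasDerivAt_id x).mul_const _).neg
      exact (h1.cexp).const_mul _
  have hd2 : DifferentiableOn ℂ (fun z : ℂ => (Real.Gamma p : ℂ) * z ^ (-(p : ℂ))) U := by
    intro w hw
    have hw' : 0 < w.re := hw
    exact ((differentiableAt_id.cpow_const (Or.inl hw')).const_mul _).differentiableWithinAt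
  have hconv : Convex ℝ U := by
    have := convex_halfSpace_re_gt 0
    exact this
  have := (hd.analyticOnNhd hUo).eqOn_of_preconnected_of_frequently_eq (hd2.analyticOnNhd hUo)
    hconv.isPreconnected (z₀ := 1) (by simp [hU]) ?_
  · exact this hz
  · have hreal : ∀ r : ℝ, 0 < r → (∫ t in Ioi (0 : ℝ),
      ((t ^ (p - 1) : ℝ) : ℂ) * Complex.exp (-((r : ℂ) * t))) =
      (Real.Gamma p : ℂ) * (r : ℂ) ^ (-(p : ℂ)) := by
      intro r hr
      have h := Complex.integral_cpow_mul_exp_neg_mul_Ioi (a := p) (r := r) (by simpa) hr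
      rw [Complex.Gamma_ofReal] at h
      have e : (1 / (r : ℂ)) ^ (p : ℂ) = (r : ℂ) ^ (-(p : ℂ)) := by
        rw [Complex.cpow_neg, one_div, Complex.inv_cpow]
        rw [Complex.arg_ofReal_of_nonneg hr.le]; exact Real.pi_pos.ne
      rw [e] at h
      rw [mul_comm, ← h]
      refine setIntegral_congr_fun measurableSet_Ioi (fun t ht => ?_)
      have ht' : (0 : ℝ) < t := ht
      rw [Complex.ofReal_cpow ht'.le]; simp
    have ht : Tendsto (fun n : ℕ => (1 : ℂ) + 1 / ((n : ℂ) + 1)) atTop (𝓝[≠] 1) := by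
      rw [tendsto_nhdsWithin_iff]
      constructor
      · have := (tendsto_one_div_add_atTop_nhds_zero_nat (𝕜 := ℂ)).const_add 1
        simpa using this
      · refine Eventually.of_forall fun n => ?_
        have : (n : ℂ) + 1 ≠ 0 := Nat.cast_add_one_ne_zero n
        simp [this]
    refine ht.frequently (Frequently.of_forall fun n => ?_)
    have := hreal (1 + 1 / ((n : ℝ) + 1)) (by positivity)
    push_cast at this
    exact this

lemma re_one_add (y : ℝ) : (1 + Complex.I * (y : ℂ)).re = 1 := by simp

lemma one_add_slit (y : ℝ) : 1 + Complex.I * (y : ℂ) ∈ Complex.slitPlane := by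
  left; rw [re_one_add]; exact one_pos

lemma norm_one_add (y : ℝ) : ‖1 + Complex.I * (y : ℂ)‖ = (1 + y ^ 2) ^ ((1 : ℝ) / 2) := by
  rw [← Real.sqrt_eq_rpow, Complex.norm_def, Complex.normSq_apply]; simp [pow_two]

lemma norm_one_add_cpow (y p : ℝ) :
    ‖(1 + Complex.I * (y : ℂ)) ^ (p : ℂ)‖ = (1 + y ^ 2) ^ (p / 2) := by
  rw [Complex.norm_cpow_real, norm_one_add, ← Real.rpow_mul (by positivity)]
  congr 1; ring

lemma cont_one_add_cpow (p : ℂ) :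
    Continuous fun y : ℝ => (1 + Complex.I * (y : ℂ)) ^ p := by
  refine Continuous.cpow (by fun_prop) (by fun_prop) (fun y => one_add_slit y)

open MeasureTheory in
lemma one_add_sq_integrable (p : ℝ) (hp : 1 < p) :
    Integrable (fun y : ℝ => (1 + y ^ 2) ^ (-p / 2)) := by
  have := integrable_rpow_neg_one_add_norm_sq (E := ℝ) (μ := volume) (r := p) (by simpa using hp)
  simpa using this

open MeasureTheory in
lemma one_add_cpow_integrable (p : ℝ) (hp : 1 < p) :
    Integrable (fun y : ℝ => (1 + Complex.I * (y : ℂ)) ^ (-(p : ℂ))) := by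
  refine (one_add_sq_integrable p hp).mono' (cont_one_add_cpow _).aestronglyMeasurable ?_
  refine Eventually.of_forall fun y => ?_
  have := norm_one_add_cpow y (-p)
  push_cast at this
  rw [this]

open MeasureTheory Set FourierTransform in
/-- Hankel-type inversion formula. -/
lemma gamma_inversion (p : ℝ) (hp : 1 < p) (r : ℝ) (hr : 0 < r) :
    ∫ y : ℝ, Complex.exp (Complex.I * r * y) * (1 + Complex.I * (y : ℂ)) ^ (-(p : ℂ)) =
      2 * Real.pi * ((r ^ (p - 1) * Real.exp (-r) / Real.Gamma p : ℝ) : ℂ) := by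
  have hG : Real.Gamma p ≠ 0 := (Real.Gamma_pos_of_pos (by linarith)).ne'
  let f : ℝ → ℂ := indicator (Ioi 0) fun t : ℝ => ((t ^ (p - 1) : ℝ) : ℂ) * Complex.exp (-(1 * t))
  have hf : Integrable f :=
    (integrable_indicator_iff measurableSet_Ioi).2 (gi_cintegrable _ 1 (by linarith) (by simp))
  have hF : ∀ ξ : ℝ, 𝓕 f ξ = (Real.Gamma p : ℂ) * (1 + Complex.I * ((2 * Real.pi * ξ : ℝ) : ℂ)) ^ (-(p : ℂ)) := by
    intro ξ
    rw [← laplace_gamma p (by linarith) _ (by rw [re_one_add]; exact one_pos),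
      Real.fourier_real_eq_integral_exp_smul, ← integral_indicator measurableSet_Ioi]
    congr 1
    ext t
    by_cases ht : t ∈ Ioi (0 : ℝ)
    · simp only [f, indicator_of_mem ht, smul_eq_mul]
      rw [mul_left_comm, ← Complex.exp_add]
      congr 2
      push_cast; ring
    · simp only [f, indicator_of_notMem ht, smul_zero]
  have hFi : Integrable (𝓕 f) := by
    have h1 := (one_add_cpow_integrable p hp).comp_mul_left' (R := 2 * Real.pi) (by positivity)
    refine (h1.const_mul (Real.Gamma p : ℂ)).congr (Eventually.of_forall fun ξ => ?_)
    exact (hF ξ).symm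
  have hc : ContinuousAt f r := by
    have : (fun t : ℝ => ((t ^ (p - 1) : ℝ) : ℂ) * Complex.exp (-(1 * t))) =ᶠ[𝓝 r] f := by
      filter_upwards [Ioi_mem_nhds hr] with t ht
      simp only [f, indicator_of_mem (show t ∈ Ioi (0:ℝ) from ht)]
    refine ContinuousAt.congr ?_ this
    have h1 : ContinuousAt (fun t : ℝ => t ^ (p - 1)) r :=
      Real.continuousAt_rpow_const _ _ (Or.inl hr.ne')
    refine (Complex.continuous_ofReal.continuousAt.comp h1).mul ?_
    fun_prop
  have inv := hf.fourierInv_fourier_eq hFi hc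
  rw [Real.fourierInv_eq'] at inv
  simp only [hF, smul_eq_mul] at inv
  have h2 : ∫ y : ℝ, Complex.exp (Complex.I * r * y) * (1 + Complex.I * (y : ℂ)) ^ (-(p : ℂ)) =
      (2 * Real.pi) * ∫ ξ : ℝ, Complex.exp (Complex.I * r * ((2 * Real.pi * ξ : ℝ) : ℂ)) * (1 + Complex.I * ((2 * Real.pi * ξ : ℝ) : ℂ)) ^ (-(p : ℂ)) := by
    have := Measure.integral_comp_mul_left (fun y : ℝ => Complex.exp (Complex.I * r * y) * (1 + Complex.I * (y : ℂ)) ^ (-(p : ℂ))) (2 * Real.pi)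
    rw [this, abs_of_pos (by positivity), Complex.real_smul]
    push_cast
    field_simp
  rw [h2]
  have h3 : ∫ ξ : ℝ, Complex.exp (Complex.I * r * ((2 * Real.pi * ξ : ℝ) : ℂ)) * (1 + Complex.I * ((2 * Real.pi * ξ : ℝ) : ℂ)) ^ (-(p : ℂ)) = f r / (Real.Gamma p : ℂ) := by
    rw [← inv, eq_div_iff (by exact_mod_cast hG), ← integral_mul_const]
    congr 1
    ext ξ
    rw [mul_assoc, mul_comm (_ ^ _)]
    congr 2
    simp
    ring
  rw [h3]
  simp only [f, indicator_of_mem (show r ∈ Ioi (0:ℝ) from hr)]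
  push_cast
  simp


lemma dslope_step {f : ℂ → ℂ} {ρ B : ℝ} (hρ : 0 < ρ)
    (hf : DifferentiableOn ℂ f (Metric.ball 0 ρ))
    (hB : ∀ z ∈ Metric.ball (0 : ℂ) ρ, ‖f z‖ ≤ B) :
    DifferentiableOn ℂ (dslope f 0) (Metric.ball 0 ρ) ∧
    (∀ z ∈ Metric.ball (0 : ℂ) ρ, ‖dslope f 0 z‖ ≤ 2 * B / ρ) ∧
    ∀ z, f z = f 0 + z * dslope f 0 z := by
  refine ⟨(Complex.differentiableOn_dslope (Metric.ball_mem_nhds 0 hρ)).2 hf, ?_, ?_⟩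
  · intro z hz
    refine Complex.norm_dslope_le_div_of_mapsTo_ball hf ?_ hz
    intro w hw
    rw [mem_closedBall_iff_norm]
    have h1 := hB w hw
    have h2 := hB 0 (Metric.mem_ball_self hρ)
    have h3 := norm_sub_le (f w) (f 0)
    linarith
  · intro z
    have := sub_smul_dslope f 0 z
    simp only [sub_zero, smul_eq_mul] at this
    rw [this]; ring

lemma even_taylor {f : ℂ → ℂ} {ρ B : ℝ} (hρ : 0 < ρ)
    (hf : DifferentiableOn ℂ f (Metric.ball 0 ρ))
    (hB : ∀ z ∈ Metric.ball (0 : ℂ) ρ, ‖f z‖ ≤ B) {z : ℂ} (hz : z ∈ Metric.ball (0 : ℂ) ρ) :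
    ‖f z + f (-z) - 2 * f 0 - deriv (deriv f) 0 * z ^ 2‖ ≤ 2 * (2 / ρ) ^ 4 * B * ‖z‖ ^ 4 := by
  obtain ⟨d1, b1, e1⟩ := dslope_step hρ hf hB
  obtain ⟨d2, b2, e2⟩ := dslope_step hρ d1 b1
  obtain ⟨d3, b3, e3⟩ := dslope_step hρ d2 b2
  obtain ⟨d4, b4, e4⟩ := dslope_step hρ d3 b3
  set g1 := dslope f 0
  set g2 := dslope g1 0
  set g3 := dslope g2 0
  set g4 := dslope g3 0
  have hball : Metric.ball (0 : ℂ) ρ ∈ 𝓝 (0 : ℂ) := Metric.ball_mem_nhds 0 hρ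
  have hdd : deriv (deriv f) 0 = 2 * g2 0 := by
    have h1 : deriv f =ᶠ[𝓝 0] fun z => g1 z + z * deriv g1 z := by
      filter_upwards [hball] with w hw
      have hg : HasDerivAt g1 (deriv g1 w) w :=
        (d1.differentiableAt (Metric.isOpen_ball.mem_nhds hw)).hasDerivAt
      have : HasDerivAt (fun z => f 0 + z * g1 z) (1 * g1 w + w * deriv g1 w) w :=
        ((hasDerivAt_id w).mul hg).const_add _
      rw [← funext e1] at this
      rw [this.deriv, one_mul]
    rw [h1.deriv_eq]
    have hg : HasDerivAt g1 (deriv g1 0) 0 := (d1.differentiableAt hball).hasDerivAt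
    have hg' : HasDerivAt (deriv g1) (deriv (deriv g1) 0) 0 :=
      ((d1.deriv Metric.isOpen_ball).differentiableAt hball).hasDerivAt
    have := hg.add ((hasDerivAt_id (0 : ℂ)).mul hg')
    have h2 := this.deriv
    simp only [id] at h2
    have h3 : g2 0 = deriv g1 0 := dslope_same _ _
    rw [h3]
    refine Eq.trans ?_ (h2.trans ?_)
    · rfl
    · ring
  have hz' : -z ∈ Metric.ball (0 : ℂ) ρ := by simpa using hz
  have key : f z + f (-z) - 2 * f 0 - deriv (deriv f) 0 * z ^ 2 = z ^ 4 * (g4 z + g4 (-z)) := by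
    rw [hdd, e1 z, e1 (-z), e2 z, e2 (-z), e3 z, e3 (-z), e4 z, e4 (-z)]; ring
  rw [key, norm_mul, norm_pow]
  have h4 := b4 z hz
  have h5 := b4 _ hz'
  have h6 := norm_add_le (g4 z) (g4 (-z))
  have h7 : ‖g4 z + g4 (-z)‖ ≤ 2 * (2 / ρ) ^ 4 * B := by
    have : 2 * (2 / ρ) ^ 4 * B = 2 * (2 * (2 * (2 * (2 * B / ρ) / ρ) / ρ) / ρ) := by
      field_simp
    rw [this]; linarith
  rw [mul_comm]
  gcongr

lemma hasDerivAt_one_add_cpow (s : ℂ) {η : ℂ} (h : 1 + η ∈ Complex.slitPlane) :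
    HasDerivAt (fun η : ℂ => (1 + η) ^ s) (s * (1 + η) ^ (s - 1)) η := by
  have h0 : HasDerivAt (fun η : ℂ => 1 + η) 1 η := (hasDerivAt_id η).const_add 1
  have := h0.cpow_const (c := s) h
  simpa using this

lemma ev_slit : ∀ᶠ η : ℂ in 𝓝 0, 1 + η ∈ Complex.slitPlane := by
  have : ContinuousAt (fun η : ℂ => 1 + η) 0 := by fun_prop
  exact this.eventually (Complex.isOpen_slitPlane.mem_nhds (by simp))

lemma analyticAt_one_add_cpow (s : ℂ) : AnalyticAt ℂ (fun η : ℂ => (1 + η) ^ s) 0 := by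
  rw [Complex.analyticAt_iff_eventually_differentiableAt]
  filter_upwards [ev_slit] with η hη
  exact (hasDerivAt_one_add_cpow s hη).differentiableAt

lemma iteratedDeriv_one_add_cpow (n : ℕ) (s : ℂ) :
    iteratedDeriv (n + 1) (fun η : ℂ => (1 + η) ^ s) 0 =
      s * iteratedDeriv n (fun η : ℂ => (1 + η) ^ (s - 1)) 0 := by
  rw [iteratedDeriv_succ']
  have : deriv (fun η : ℂ => (1 + η) ^ s) =ᶠ[𝓝 0] fun η => s * (1 + η) ^ (s - 1) := by
    filter_upwards [ev_slit] with η hη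
    exact (hasDerivAt_one_add_cpow s hη).deriv
  rw [this.iteratedDeriv_eq n, iteratedDeriv_const_mul_field]

/-- Taylor expansion of the phase. -/
lemma phase_expansion (a : ℝ) (ha : 0 < a) :
    ∃ g : ℂ → ℂ, AnalyticAt ℂ g 0 ∧ ∀ᶠ η in 𝓝 (0 : ℂ),
      η + ((1 + η) ^ (-(a : ℂ)) - 1) / a =
        (1 + a) / 2 * η ^ 2 + η ^ 2 * (-((1 + a) * (a + 2) / 6) * η +
          (1 + a) * (a + 2) * (a + 3) / 24 * η ^ 2 + η ^ 3 * g η) := by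
  obtain ⟨F, hF, hE⟩ := (analyticAt_one_add_cpow (-(a : ℂ))).exists_eventuallyEq_sum_add_pow_mul 5
  have ha' : (a : ℂ) ≠ 0 := by exact_mod_cast ha.ne'
  refine ⟨fun η => F η / a, hF.div analyticAt_const ha', ?_⟩
  filter_upwards [hE] with η hη
  rw [hη]
  simp only [Finset.sum_range_succ, Finset.sum_range_zero, iteratedDeriv_one_add_cpow,
    iteratedDeriv_zero]
  simp [Nat.factorial]
  field_simp
  ring

open MeasureTheory Set in
lemma gauss_moment (b : ℝ) (hb : 0 < b) (k : ℕ) :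
    ∫ y : ℝ, y ^ (2 * k) * Real.exp (-b * y ^ 2) =
      Real.Gamma (k + 1 / 2) / (b ^ k * Real.sqrt b) := by
  have h := integral_rpow_mul_exp_neg_mul_rpow (p := 2) (q := 2 * k) (b := b) (by norm_num)
    (by have : (0:ℝ) ≤ k := by positivity
        linarith) hb
  have h2 := integral_comp_abs (f := fun y : ℝ => y ^ (2 * k) * Real.exp (-b * y ^ 2))
  have e1 : (fun y : ℝ => |y| ^ (2 * k) * Real.exp (-b * |y| ^ 2)) =
      fun y : ℝ => y ^ (2 * k) * Real.exp (-b * y ^ 2) := by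
    ext y; rw [pow_mul, sq_abs, ← pow_mul]
  rw [e1] at h2
  rw [h2]
  have e2 : ∫ y in Ioi (0 : ℝ), y ^ (2 * k) * Real.exp (-b * y ^ 2) =
      ∫ y in Ioi (0 : ℝ), y ^ (2 * (k : ℝ)) * Real.exp (-b * y ^ (2 : ℝ)) := by
    refine setIntegral_congr_fun measurableSet_Ioi (fun y _ => ?_)
    have : (2 * (k : ℝ)) = ((2 * k : ℕ) : ℝ) := by push_cast; ring
    rw [this, Real.rpow_natCast]
    norm_num
  rw [e2, h]
  have e3 : -(2 * (k : ℝ) + 1) / 2 = -(k : ℝ) - 1 / 2 := by ring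
  have e4 : (2 * (k : ℝ) + 1) / 2 = (k : ℝ) + 1 / 2 := by ring
  rw [e3, e4, Real.rpow_sub hb, Real.rpow_neg hb.le, Real.rpow_natCast, ← Real.sqrt_eq_rpow]
  field_simp

open MeasureTheory Set in
lemma gauss_integrable (b : ℝ) (hb : 0 < b) (k : ℕ) :
    Integrable fun y : ℝ => y ^ (2 * k) * Real.exp (-b * y ^ 2) := by
  have := integrable_rpow_mul_exp_neg_mul_sq hb (s := 2 * k)
    (by have : (0:ℝ) ≤ k := by positivity
        linarith)
  refine this.congr (Eventually.of_forall fun y => ?_)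
  have e : (2 * (k : ℝ)) = ((2 * k : ℕ) : ℝ) := by push_cast; ring
  simp only
  rw [e, Real.rpow_natCast]

/-- second Taylor coefficient of the amplitude-corrected exponential -/
lemma amp_deriv2 (l p3 p4 σ : ℂ) (g : ℂ → ℂ) (hg : AnalyticAt ℂ g 0) :
    deriv (deriv (fun η : ℂ => Complex.exp (l * Complex.log (1 + η) -
      σ * (p3 * η + p4 * η ^ 2 + η ^ 3 * g η)))) 0 = (l - σ * p3) ^ 2 - l - 2 * σ * p4 := by
  set Q : ℂ → ℂ := fun η => l * Complex.log (1 + η) - σ * (p3 * η + p4 * η ^ 2 + η ^ 3 * g η) with hQ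
  set Q' : ℂ → ℂ := fun η => l * (1 / (1 + η)) - σ * (p3 * 1 + p4 * (2 * η ^ 1 * 1) +
    ((3 * η ^ 2 * 1) * g η + η ^ 3 * deriv g η)) with hQ'
  have hd : ∀ᶠ η in 𝓝 (0 : ℂ), HasDerivAt Q (Q' η) η := by
    filter_upwards [ev_slit, hg.eventually_analyticAt] with η h1 h2
    have h0 : HasDerivAt (fun η : ℂ => 1 + η) 1 η := (hasDerivAt_id η).const_add 1
    have i := hasDerivAt_id η
    have hg1 := h2.differentiableAt.hasDerivAt
    exact ((h0.clog h1).const_mul l).sub ((((i.const_mul p3).add ((i.pow 2).const_mul p4)).add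
      ((i.pow 3).mul hg1)).const_mul σ)
  have h1 : deriv (fun η => Complex.exp (Q η)) =ᶠ[𝓝 0] fun η => Complex.exp (Q η) * Q' η := by
    filter_upwards [hd] with η h
    exact h.cexp.deriv
  rw [h1.deriv_eq]
  have h2 : HasDerivAt Q' (-l - 2 * σ * p4) 0 := by
    have h0 : HasDerivAt (fun η : ℂ => 1 + η) 1 0 := (hasDerivAt_id (0 : ℂ)).const_add 1
    have hi : HasDerivAt (fun η : ℂ => 1 / (1 + η)) (-1) 0 := by
      have := h0.fun_inv (by simp)
      simpa [one_div] using this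
    have i := hasDerivAt_id (0 : ℂ)
    have hg1 := hg.differentiableAt.hasDerivAt
    have hg2 := hg.deriv.differentiableAt.hasDerivAt
    have := (hi.const_mul l).sub (((((i.pow 1).const_mul 2).mul_const 1).const_mul p4 |>.const_add (p3 * 1) |>.add
      (((((i.pow 2).const_mul 3).mul_const 1).mul hg1).add ((i.pow 3).mul hg2))).const_mul σ)
    refine this.congr_deriv ?_
    simp
    ring
  have h3 := (hd.self_of_nhds.cexp.mul h2).deriv
  refine Eq.trans rfl (h3.trans ?_)
  simp [hQ, hQ']
  ring


open MeasureTheory Set in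
/-- Laplace method for the central integral. -/
lemma laplace_central (a l D : ℝ) (ha : 0 < a) (hD : 0 < D) :
    ∃ δ C : ℝ, 0 < δ ∧ δ ≤ D ∧ ∀ r : ℝ, 1 ≤ r →
      ‖(∫ y in Icc (-δ) δ, Complex.exp (r * (Complex.I * y +
          ((1 + Complex.I * (y : ℂ)) ^ (-(a : ℂ)) - 1) / a)) * (1 + Complex.I * (y : ℂ)) ^ (l : ℂ)) -
        ((Real.sqrt (2 * Real.pi / (r * (1 + a))) * (1 + (-(l * (l - 1)) / (2 * (1 + a)) +
          3 * ((1 + a) * (a + 2) * (a + 3) / 24 + l * (-((1 + a) * (a + 2) / 6))) / (1 + a) ^ 2 -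
          15 * (-((1 + a) * (a + 2) / 6)) ^ 2 / (2 * (1 + a) ^ 3)) / r) : ℝ) : ℂ)‖ ≤
        C / (r ^ 2 * Real.sqrt r) := by
  obtain ⟨g, hg, hE⟩ := phase_expansion a ha
  set κ : ℝ := 1 + a with hκ
  have hκ0 : 0 < κ := by linarith
  set p3 : ℝ := -(κ * (a + 2) / 6) with hp3
  set p4 : ℝ := κ * (a + 2) * (a + 3) / 24 with hp4
  set ψ : ℂ → ℂ := fun η => p3 * η + p4 * η ^ 2 + η ^ 3 * g η with hψ
  have hψc : ContinuousAt ψ 0 := by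
    have := hg.continuousAt
    fun_prop
  have hψe : ∀ᶠ η in 𝓝 (0 : ℂ), ‖ψ η‖ < κ / 4 := by
    have : ContinuousAt (fun η => ‖ψ η‖) 0 := hψc.norm
    refine this.eventually (Iio_mem_nhds ?_)
    simp [hψ]; positivity
  have hle : ∀ᶠ η in 𝓝 (0 : ℂ), ‖(l : ℂ) * Complex.log (1 + η)‖ < 1 := by
    have : ContinuousAt (fun η : ℂ => ‖(l : ℂ) * Complex.log (1 + η)‖) 0 := by
      have : ContinuousAt (fun η : ℂ => Complex.log (1 + η)) 0 :=
        ContinuousAt.clog (by fun_prop) (by simp)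
      fun_prop
    refine this.eventually (Iio_mem_nhds ?_)
    simp
  obtain ⟨ρ, hρ, hall⟩ := Metric.eventually_nhds_iff_ball.1
    (hE.and (hψe.and (hle.and (ev_slit.and hg.eventually_analyticAt))))
  set δ : ℝ := min (ρ / 2) D with hδ
  have hδ0 : 0 < δ := lt_min (by linarith) hD
  have hδρ : δ < ρ := (min_le_left _ _).trans_lt (by linarith)
  set H : ℝ → ℂ → ℂ := fun σ η => Complex.exp (l * Complex.log (1 + η) - σ * ψ η) with hH
  set M : ℝ := Real.exp 1 with hM
  have hHd : ∀ σ, DifferentiableOn ℂ (H σ) (Metric.ball 0 ρ) := by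
    intro σ η hη
    obtain ⟨-, -, -, h4, h5⟩ := hall η hη
    have h0 : DifferentiableAt ℂ (fun η : ℂ => Complex.log (1 + η)) η :=
      DifferentiableAt.clog (by fun_prop) h4
    have := h5.differentiableAt
    refine DifferentiableAt.differentiableWithinAt ?_
    simp only [hH, hψ]
    fun_prop
  have hHb : ∀ σ, 0 ≤ σ → ∀ η ∈ Metric.ball (0 : ℂ) ρ, ‖H σ η‖ ≤ M * Real.exp (σ * κ / 4) := by
    intro σ hσ η hη
    obtain ⟨-, h2, h3, -, -⟩ := hall η hη
    rw [hM, ← Real.exp_add]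
    refine (Complex.norm_exp_le_exp_norm _).trans (Real.exp_le_exp.2 ?_)
    refine (norm_sub_le _ _).trans ?_
    rw [norm_mul (σ : ℂ), Complex.norm_real, Real.norm_of_nonneg hσ]
    nlinarith
  have hH0 : ∀ σ, H σ 0 = 1 := by intro σ; simp [hH, hψ]
  set h2 : ℝ → ℝ := fun σ => ((l - σ * p3) ^ 2 - l - 2 * σ * p4) / 2 with hh2
  have hHdd : ∀ σ : ℝ, deriv (deriv (H σ)) 0 = 2 * (h2 σ : ℂ) := by
    intro σ
    have := amp_deriv2 l p3 p4 σ g hg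
    simp only [hH, hψ, hh2]
    rw [this]; push_cast; ring
  -- bound on h2
  obtain ⟨K, hK0, hK⟩ : ∃ K : ℝ, 0 ≤ K ∧ ∀ σ : ℝ, 0 ≤ σ → 1 + |h2 σ| ≤ K * Real.exp (σ * κ / 4) := by
    set A : ℝ := 1 + l ^ 2 + p3 ^ 2 + |l| + |p4| with hA
    have hA0 : 0 ≤ A := by positivity
    refine ⟨A * (3 + 3 * (16 * 2 / κ ^ 2)), by positivity, fun σ hσ => ?_⟩
    have e1 : 1 ≤ Real.exp (σ * κ / 4) := Real.one_le_exp (by positivity)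
    have e2 : σ ^ 2 ≤ 16 * 2 / κ ^ 2 * Real.exp (σ * κ / 4) := by
      have := Real.quadratic_le_exp_of_nonneg (x := σ * κ / 4) (by positivity)
      have h : (σ * κ / 4) ^ 2 / 2 ≤ Real.exp (σ * κ / 4) := by
        have : 0 ≤ σ * κ / 4 := by positivity
        linarith
      have : σ ^ 2 = 16 * 2 / κ ^ 2 * ((σ * κ / 4) ^ 2 / 2) := by
        field_simp; norm_num
      rw [this]; gcongr
    have e3 : 1 + |h2 σ| ≤ A * (3 + 3 * σ ^ 2) := by
      have t1 : |h2 σ| ≤ ((l - σ * p3) ^ 2 + |l| + 2 * σ * |p4|) / 2 := by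
        simp only [hh2, abs_div, abs_two]
        gcongr
        refine (abs_sub _ _).trans ?_
        refine (add_le_add_left (abs_sub _ _) _).trans ?_
        rw [abs_of_nonneg (sq_nonneg _), abs_mul, abs_mul, abs_two, abs_of_nonneg hσ]
      have t2 : (l - σ * p3) ^ 2 ≤ 2 * l ^ 2 + 2 * (σ ^ 2 * p3 ^ 2) := by
        nlinarith [sq_nonneg (l + σ * p3)]
      have t3 : 2 * σ ≤ 1 + σ ^ 2 := by nlinarith [sq_nonneg (σ - 1)]
      have t4 : 2 * σ * |p4| ≤ (1 + σ ^ 2) * |p4| := by gcongr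
      have t5 := abs_nonneg l
      have t6 := abs_nonneg p4
      have t7 : 0 ≤ σ ^ 2 * l ^ 2 := by positivity
      have t8 : 0 ≤ σ ^ 2 * p3 ^ 2 := by positivity
      have t9 : 0 ≤ σ ^ 2 * |l| := by positivity
      have t10 : 0 ≤ σ ^ 2 * |p4| := by positivity
      rw [hA]
      nlinarith [sq_nonneg l, sq_nonneg p3, sq_nonneg σ]
    calc 1 + |h2 σ| ≤ A * (3 + 3 * σ ^ 2) := e3
      _ ≤ A * (3 * Real.exp (σ * κ / 4) + 3 * (16 * 2 / κ ^ 2 * Real.exp (σ * κ / 4))) := by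
        gcongr; linarith
      _ = _ := by ring
  -- constant for the pointwise bound
  set C0 : ℝ := (2 / ρ) ^ 4 * M + K * (1 / δ ^ 4 + 1 / δ ^ 2) with hC0
  have hC0p : 0 ≤ C0 := by positivity
  refine ⟨δ, C0 * (Real.Gamma (2 + 1 / 2) / ((κ / 4) ^ 2 * Real.sqrt (κ / 4))), hδ0,
    min_le_right _ _, fun r hr => ?_⟩
  have hr0 : 0 < r := by linarith
  set b : ℝ := r * κ / 2 with hb
  have hb0 : 0 < b := by positivity
  set Fc : ℝ → ℂ := fun y => Complex.exp (r * (Complex.I * y +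
          ((1 + Complex.I * (y : ℂ)) ^ (-(a : ℂ)) - 1) / a)) * (1 + Complex.I * (y : ℂ)) ^ (l : ℂ) with hFc
  have hFcc : Continuous Fc := by
    have h1 := cont_one_add_cpow (-(a : ℂ))
    have h2 := cont_one_add_cpow (l : ℂ)
    simp only [hFc]
    fun_prop
  set F : ℝ → ℂ := indicator (Icc (-δ) δ) Fc with hF
  have hFi : Integrable F :=
    (integrable_indicator_iff measurableSet_Icc).2 (hFcc.integrableOn_Icc)
  have hFint : ∫ y in Icc (-δ) δ, Fc y = ∫ y, F y := (integral_indicator measurableSet_Icc).symm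
  have hFsym : ∫ y, F y = ∫ y, (F y + F (-y)) / 2 := by
    rw [integral_div, integral_add hFi hFi.comp_neg, integral_neg_eq_self F]; ring
  have hFH : ∀ y ∈ Icc (-δ) δ, F y = (Real.exp (-b * y ^ 2) : ℂ) * H (r * y ^ 2) (Complex.I * y) := by
    intro y hy
    rw [hF, indicator_of_mem hy]
    have hmem : Complex.I * (y : ℂ) ∈ Metric.ball (0 : ℂ) ρ := by
      rw [mem_ball_zero_iff, norm_mul, Complex.norm_I, one_mul, Complex.norm_real, Real.norm_eq_abs]
      exact (abs_le.2 hy).trans_lt hδρ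
    obtain ⟨h1, -, -, -, -⟩ := hall _ hmem
    simp only [hFc, hH]
    rw [h1, Complex.cpow_def_of_ne_zero (Complex.slitPlane_ne_zero (one_add_slit y))]
    rw [Complex.ofReal_exp, ← Complex.exp_add, ← Complex.exp_add]
    congr 1
    have hI : (Complex.I * (y : ℂ)) ^ 2 = -(y : ℂ) ^ 2 := by
      rw [mul_pow, Complex.I_sq]; ring
    simp only [hψ, hb, hκ, hp3, hp4]
    push_cast
    rw [hI]
    ring
  set G : ℝ → ℝ := fun y => Real.exp (-b * y ^ 2) * (1 - y ^ 2 * h2 (r * y ^ 2)) with hG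
  have hGe : ∀ y, G y = (y ^ (2 * 0) * Real.exp (-b * y ^ 2)) -
      (l ^ 2 - l) / 2 * (y ^ (2 * 1) * Real.exp (-b * y ^ 2)) +
      r * (l * p3 + p4) * (y ^ (2 * 2) * Real.exp (-b * y ^ 2)) -
      r ^ 2 * p3 ^ 2 / 2 * (y ^ (2 * 3) * Real.exp (-b * y ^ 2)) := by
    intro y; simp only [hG, hh2]; ring
  have gi := gauss_integrable b hb0
  have hGi : Integrable G := by
    rw [funext hGe]
    exact (((gi 0).sub ((gi 1).const_mul _)).add ((gi 2).const_mul _)).sub ((gi 3).const_mul _)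
  have hGint : ∫ y, G y = Real.sqrt (2 * Real.pi / (r * κ)) * (1 + (-(l * (l - 1)) / (2 * κ) +
          3 * (p4 + l * p3) / κ ^ 2 - 15 * p3 ^ 2 / (2 * κ ^ 3)) / r) := by
    simp only [hGe]
    have i1 : Integrable (fun y : ℝ => (y ^ (2 * 0) * Real.exp (-b * y ^ 2)) -
      (l ^ 2 - l) / 2 * (y ^ (2 * 1) * Real.exp (-b * y ^ 2))) := (gi 0).sub ((gi 1).const_mul _)
    have i2 : Integrable (fun y : ℝ => (y ^ (2 * 0) * Real.exp (-b * y ^ 2)) -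
      (l ^ 2 - l) / 2 * (y ^ (2 * 1) * Real.exp (-b * y ^ 2)) +
      r * (l * p3 + p4) * (y ^ (2 * 2) * Real.exp (-b * y ^ 2))) := i1.add ((gi 2).const_mul _)
    rw [integral_sub i2 ((gi 3).const_mul _),
      integral_add i1 ((gi 2).const_mul _),
      integral_sub (gi 0) ((gi 1).const_mul _), integral_const_mul, integral_const_mul,
      integral_const_mul, gauss_moment b hb0, gauss_moment b hb0, gauss_moment b hb0, gauss_moment b hb0]
    have g0 : Real.Gamma (((0:ℕ) : ℝ) + 1 / 2) = Real.sqrt Real.pi := by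
      rw [Nat.cast_zero, zero_add, Real.Gamma_one_half_eq]
    have gs : ∀ k : ℕ, Real.Gamma (((k + 1 : ℕ) : ℝ) + 1 / 2) = (k + 1 / 2) * Real.Gamma ((k : ℝ) + 1 / 2) := by
      intro k
      rw [← Real.Gamma_add_one (by positivity)]
      congr 1; push_cast; ring
    have g1 := gs 0
    have g2 := gs 1
    have g3 := gs 2
    simp only [Nat.reduceAdd, zero_add] at g1 g2 g3
    rw [g3, g2, g1, g0]
    have hs : Real.sqrt (2 * Real.pi / (r * κ)) = Real.sqrt Real.pi / Real.sqrt b := by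
      rw [← Real.sqrt_div' _ hb0.le]; congr 1; rw [hb]; field_simp
    rw [hs]
    have : Real.sqrt b ≠ 0 := (Real.sqrt_pos.2 hb0).ne'
    rw [hb] at this ⊢
    field_simp
    push_cast
    ring
  have hpt : ∀ y, ‖(F y + F (-y)) / 2 - (G y : ℂ)‖ ≤ C0 * (y ^ (2 * 2) * Real.exp (-(b / 2) * y ^ 2)) := by
    intro y
    have hσ : 0 ≤ r * y ^ 2 := by positivity
    have hexp : Real.exp (-b * y ^ 2) * Real.exp (r * y ^ 2 * κ / 4) = Real.exp (-(b / 2) * y ^ 2) := by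
      rw [← Real.exp_add]; congr 1; rw [hb]; ring
    by_cases hy : y ∈ Icc (-δ) δ
    · have hy' : -y ∈ Icc (-δ) δ := ⟨by linarith [hy.2], by linarith [hy.1]⟩
      have hmem : Complex.I * (y : ℂ) ∈ Metric.ball (0 : ℂ) ρ := by
        rw [mem_ball_zero_iff, norm_mul, Complex.norm_I, one_mul, Complex.norm_real, Real.norm_eq_abs]
        exact (abs_le.2 hy).trans_lt hδρ
      have T := even_taylor hρ (hHd (r * y ^ 2)) (hHb _ hσ) hmem
      rw [hHdd, hH0] at T
      have e : (F y + F (-y)) / 2 - (G y : ℂ) = (Real.exp (-b * y ^ 2) : ℂ) * ((1 / 2) *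
          (H (r * y ^ 2) (Complex.I * y) + H (r * y ^ 2) (-(Complex.I * y)) - 2 * 1 -
            2 * (h2 (r * y ^ 2) : ℂ) * (Complex.I * y) ^ 2)) := by
        rw [hFH y hy, hFH _ hy', mul_pow, Complex.I_sq]
        simp only [hG]
        push_cast
        simp only [neg_sq, mul_neg]
        ring
      rw [e, norm_mul, norm_mul, Complex.norm_real, Real.norm_of_nonneg (Real.exp_pos _).le]
      have n1 : ‖(1 / 2 : ℂ)‖ = 1 / 2 := by norm_num
      have n2 : ‖Complex.I * (y : ℂ)‖ ^ 4 = y ^ 4 := by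
        rw [norm_mul, Complex.norm_I, one_mul, Complex.norm_real, Real.norm_eq_abs, ← abs_pow,
          abs_of_nonneg (by positivity)]
      rw [n1]
      rw [n2] at T
      calc _ ≤ Real.exp (-b * y ^ 2) * (1 / 2 * (2 * (2 / ρ) ^ 4 * (M * Real.exp (r * y ^ 2 * κ / 4)) * y ^ 4)) := by
            gcongr
        _ = (2 / ρ) ^ 4 * M * (y ^ (2 * 2) * (Real.exp (-b * y ^ 2) * Real.exp (r * y ^ 2 * κ / 4))) := by ring
        _ ≤ _ := by
          rw [hexp, hC0]
          have : 0 ≤ K * (1 / δ ^ 4 + 1 / δ ^ 2) := by positivity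
          refine mul_le_mul_of_nonneg_right (by linarith) (mul_nonneg ?_ (Real.exp_pos _).le)
          rw [pow_mul]; positivity
    · have hy' : -y ∉ Icc (-δ) δ := by
        intro h; exact hy ⟨by linarith [h.2], by linarith [h.1]⟩
      have hyδ : δ ^ 2 ≤ y ^ 2 := by
        rw [sq_le_sq, abs_of_pos hδ0]
        by_contra hlt
        push Not at hlt
        exact hy (abs_le.1 hlt.le)
      rw [hF, indicator_of_notMem hy, indicator_of_notMem hy']
      have : ‖((0 : ℂ) + 0) / 2 - (G y : ℂ)‖ = |G y| := by simp
      rw [this]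
      simp only [hG]
      rw [abs_mul, abs_of_pos (Real.exp_pos _)]
      have q1 : 1 ≤ y ^ 4 / δ ^ 4 := by
        rw [one_le_div (by positivity)]
        calc δ ^ 4 = (δ ^ 2) ^ 2 := by ring
          _ ≤ (y ^ 2) ^ 2 := by gcongr
          _ = y ^ 4 := by ring
      have q2 : y ^ 2 ≤ y ^ 4 / δ ^ 2 := by
        rw [le_div_iff₀ (by positivity)]
        calc y ^ 2 * δ ^ 2 ≤ y ^ 2 * y ^ 2 := by gcongr
          _ = y ^ 4 := by ring
      have k := hK _ hσ
      have k0 := abs_nonneg (h2 (r * y ^ 2))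
      set E := Real.exp (r * y ^ 2 * κ / 4)
      have q3 : |1 - y ^ 2 * h2 (r * y ^ 2)| ≤ K * (1 / δ ^ 4 + 1 / δ ^ 2) * y ^ 4 * E := by
        refine (abs_sub _ _).trans ?_
        rw [abs_one, abs_mul, abs_of_nonneg (sq_nonneg y)]
        calc 1 + y ^ 2 * |h2 (r * y ^ 2)| ≤ y ^ 4 / δ ^ 4 * (K * E) + y ^ 4 / δ ^ 2 * (K * E) := by
              apply add_le_add
              · calc (1:ℝ) = 1 * 1 := by ring
                  _ ≤ _ := by apply mul_le_mul q1 (by linarith) (by norm_num) (by positivity)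
              · apply mul_le_mul q2 (by linarith) k0 (by positivity)
          _ = _ := by ring
      calc _ ≤ Real.exp (-b * y ^ 2) * (K * (1 / δ ^ 4 + 1 / δ ^ 2) * y ^ 4 * E) := by gcongr
        _ = K * (1 / δ ^ 4 + 1 / δ ^ 2) * (y ^ (2 * 2) * (Real.exp (-b * y ^ 2) * E)) := by ring
        _ ≤ _ := by
          rw [hexp, hC0]
          have : 0 ≤ (2 / ρ) ^ 4 * M := by positivity
          refine mul_le_mul_of_nonneg_right (by linarith) (mul_nonneg ?_ (Real.exp_pos _).le)
          rw [pow_mul]; positivity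
  have i3 : Integrable (fun y => (F y + F (-y)) / 2) := (hFi.add hFi.comp_neg).div_const 2
  have i4 : Integrable (fun y => (G y : ℂ)) := hGi.ofReal
  rw [hFint, hFsym, ← hGint, ← integral_complex_ofReal, ← integral_sub i3 i4]
  refine (norm_integral_le_of_norm_le ((gauss_integrable (b / 2) (by positivity) 2).const_mul C0)
    (Eventually.of_forall hpt)).trans ?_
  rw [integral_const_mul, gauss_moment _ (by positivity)]
  have e : b / 2 = κ / 4 * r := by rw [hb]; ring
  rw [e, Real.sqrt_mul (by positivity), mul_pow]
  apply le_of_eq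
  push_cast
  have h1 : Real.sqrt (κ / 4) ≠ 0 := (Real.sqrt_pos.2 (by positivity)).ne'
  have h3 : Real.sqrt r ≠ 0 := (Real.sqrt_pos.2 hr0).ne'
  field_simp


/-- The comparison function `Σ u^n / Γ(n+c)`. -/
noncomputable def mlf (c : ℝ) (u : ℂ) : ℂ := ∑' n : ℕ, u ^ n / ((Real.Gamma (n + c) : ℝ) : ℂ)

lemma factorial_le_Gamma (c : ℝ) (hc : 2 ≤ c) (n : ℕ) : (n.factorial : ℝ) ≤ Real.Gamma (n + c) := by
  induction n with
  | zero =>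
    have := Real.Gamma_strictMonoOn_Ici.monotoneOn (a := 2) (b := c) (by simp) hc hc
    rw [Real.Gamma_two] at this
    simpa using this
  | succ n ih =>
    have e : ((n + 1 : ℕ) : ℝ) + c = (n + c) + 1 := by push_cast; ring
    rw [e, Real.Gamma_add_one (by positivity), Nat.factorial_succ]
    push_cast
    have : (0:ℝ) ≤ n.factorial := by positivity
    have h2 : (0:ℝ) ≤ n := by positivity
    nlinarith

lemma mlf_term_norm (c : ℝ) (hc : 2 ≤ c) (u : ℂ) (n : ℕ) :
    ‖u ^ n / ((Real.Gamma (n + c) : ℝ) : ℂ)‖ ≤ ‖u‖ ^ n / n.factorial := by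
  have h := factorial_le_Gamma c hc n
  have h0 : (0 : ℝ) < n.factorial := by positivity
  rw [norm_div, norm_pow, Complex.norm_real, Real.norm_of_nonneg (h0.le.trans h)]
  gcongr

lemma mlf_summable (c : ℝ) (hc : 2 ≤ c) (u : ℂ) :
    Summable fun n : ℕ => u ^ n / ((Real.Gamma (n + c) : ℝ) : ℂ) :=
  Summable.of_norm_bounded (Real.summable_pow_div_factorial ‖u‖) (mlf_term_norm c hc u)

lemma mlf_norm_le (c : ℝ) (hc : 2 ≤ c) (u : ℂ) : ‖mlf c u‖ ≤ Real.exp ‖u‖ := by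
  have h := (NormedSpace.expSeries_div_hasSum_exp (𝔸 := ℝ) ‖u‖)
  rw [← Real.exp_eq_exp_ℝ] at h
  exact tsum_of_norm_bounded h (mlf_term_norm c hc u)

open MeasureTheory Set in
lemma mlf_integral (c : ℝ) (hc : 2 ≤ c) (u : ℂ) :
    (Real.Gamma (c - 1) : ℂ) * mlf c u =
      ∫ t in (0:ℝ)..1, ((t ^ (c - 2) : ℝ) : ℂ) * Complex.exp (u * (1 - t)) := by
  have hG : ∀ n : ℕ, ∫ t in (0:ℝ)..1, ((t ^ (c - 2) : ℝ) : ℂ) * ((u * (1 - t)) ^ n / n.factorial) =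
      (Real.Gamma (c - 1) : ℂ) * (u ^ n / ((Real.Gamma (n + c) : ℝ) : ℂ)) := by
    intro n
    have h := Complex.Gamma_mul_Gamma_eq_betaIntegral (s := ((c - 1 : ℝ) : ℂ)) (t := ((n + 1 : ℝ) : ℂ))
      (by simp; linarith) (by simp; positivity)
    have hpos : Real.Gamma (n + c) ≠ 0 := (Real.Gamma_pos_of_pos (by positivity)).ne'
    have e1 : (((c - 1 : ℝ) : ℂ)) + ((n + 1 : ℝ) : ℂ) = ((n + c : ℝ) : ℂ) := by push_cast; ring
    rw [e1, Complex.Gamma_ofReal, Complex.Gamma_ofReal, Complex.Gamma_ofReal, Real.Gamma_nat_eq_factorial] at h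
    have e2 : ∫ t in (0:ℝ)..1, ((t ^ (c - 2) : ℝ) : ℂ) * ((u * (1 - t)) ^ n / n.factorial) =
        u ^ n / n.factorial * Complex.betaIntegral ((c - 1 : ℝ) : ℂ) ((n + 1 : ℝ) : ℂ) := by
      rw [Complex.betaIntegral, ← intervalIntegral.integral_const_mul]
      refine intervalIntegral.integral_congr fun t ht => ?_
      rw [uIcc_of_le zero_le_one] at ht
      have e3 : ((n + 1 : ℝ) : ℂ) - 1 = (n : ℂ) := by push_cast; ring
      have e4 : ((c - 1 : ℝ) : ℂ) - 1 = ((c - 2 : ℝ) : ℂ) := by push_cast; ring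
      simp only [e3, e4, Complex.cpow_natCast]
      rw [Complex.ofReal_cpow ht.1, mul_pow]
      ring
    rw [e2]
    have h0 : (n.factorial : ℂ) ≠ 0 := by exact_mod_cast n.factorial_ne_zero
    have h1 : ((Real.Gamma (n + c) : ℝ) : ℂ) ≠ 0 := by exact_mod_cast hpos
    rw [Complex.ofReal_natCast] at h
    field_simp
    linear_combination -u ^ n * h
  rw [mlf, ← tsum_mul_left]
  simp only [← hG]
  refine HasSum.tsum_eq ?_
  refine intervalIntegral.hasSum_integral_of_dominated_convergence
    (fun n _ => ‖u‖ ^ n / n.factorial) ?_ ?_ ?_ ?_ ?_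
  · intro n
    refine Measurable.aestronglyMeasurable ?_
    fun_prop
  · intro n
    refine Eventually.of_forall fun t ht => ?_
    rw [uIoc_of_le zero_le_one] at ht
    rw [norm_mul, norm_div, norm_pow, norm_mul, Complex.norm_real,
      Real.norm_of_nonneg (Real.rpow_nonneg ht.1.le _)]
    have h1 : t ^ (c - 2) ≤ 1 := Real.rpow_le_one ht.1.le ht.2 (by linarith)
    have h2 : ‖(1 - t : ℂ)‖ ≤ 1 := by
      have : (1 - t : ℂ) = ((1 - t : ℝ) : ℂ) := by push_cast; ring
      rw [this, Complex.norm_real, Real.norm_of_nonneg (by linarith [ht.2])]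
      linarith [ht.1]
    have h3 : ‖(n.factorial : ℂ)‖ = n.factorial := by simp
    rw [h3]
    calc t ^ (c - 2) * ((‖u‖ * ‖(1 - t : ℂ)‖) ^ n / n.factorial) ≤ 1 * ((‖u‖ * 1) ^ n / n.factorial) := by
          gcongr
      _ = _ := by ring
  · exact Eventually.of_forall fun t _ => Real.summable_pow_div_factorial ‖u‖
  · exact intervalIntegrable_const
  · refine Eventually.of_forall fun t _ => ?_
    have h := (NormedSpace.expSeries_div_hasSum_exp (𝔸 := ℂ) (u * (1 - t)))
    rw [← Complex.exp_eq_exp_ℂ] at h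
    exact h.mul_left _

open MeasureTheory Set in
/-- Asymptotics of `mlf` in the half plane `Re u ≥ 1`. -/
lemma mlf_asymp (c : ℝ) (hc : 2 ≤ c) : ∃ K : ℝ, ∀ u : ℂ, 1 ≤ u.re →
    ‖mlf c u - Complex.exp u * u ^ ((1 - c : ℝ) : ℂ)‖ ≤ K := by
  have hGp : 0 < Real.Gamma (c - 1) := Real.Gamma_pos_of_pos (by linarith)
  refine ⟨(∫ t in Ioi (1:ℝ), Real.exp 1 * (t ^ (c - 2) * Real.exp (-(1 * t)))) / Real.Gamma (c - 1),
    fun u hu => ?_⟩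
  have hL := laplace_gamma (c - 1) (by linarith) u (by linarith)
  have e0 : c - 1 - 1 = c - 2 := by ring
  rw [e0] at hL
  have hi := gi_cintegrable (c - 2) u (by linarith) (by linarith)
  have hsplit : ∫ t in Ioi (0:ℝ), ((t ^ (c - 2) : ℝ) : ℂ) * Complex.exp (-(u * t)) =
      (∫ t in (0:ℝ)..1, ((t ^ (c - 2) : ℝ) : ℂ) * Complex.exp (-(u * t))) +
      ∫ t in Ioi (1:ℝ), ((t ^ (c - 2) : ℝ) : ℂ) * Complex.exp (-(u * t)) := by
    rw [intervalIntegral.integral_of_le zero_le_one, ← setIntegral_union _ measurableSet_Ioi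
      (hi.mono_set Ioc_subset_Ioi_self) (hi.mono_set (Ioi_subset_Ioi zero_le_one)),
      Ioc_union_Ioi_eq_Ioi zero_le_one]
    exact Ioc_disjoint_Ioi le_rfl
  have hM := mlf_integral c hc u
  have e1 : ∫ t in (0:ℝ)..1, ((t ^ (c - 2) : ℝ) : ℂ) * Complex.exp (u * (1 - t)) =
      Complex.exp u * ∫ t in (0:ℝ)..1, ((t ^ (c - 2) : ℝ) : ℂ) * Complex.exp (-(u * t)) := by
    rw [← intervalIntegral.integral_const_mul]
    refine intervalIntegral.integral_congr fun t _ => ?_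
    have : u * (1 - t) = u + (-(u * t)) := by ring
    simp only [this, Complex.exp_add]
    ring
  have hne : ((Real.Gamma (c - 1) : ℝ) : ℂ) ≠ 0 := by exact_mod_cast hGp.ne'
  have key : mlf c u - Complex.exp u * u ^ ((1 - c : ℝ) : ℂ) =
      -(∫ t in Ioi (1:ℝ), Complex.exp u * (((t ^ (c - 2) : ℝ) : ℂ) * Complex.exp (-(u * t)))) /
        ((Real.Gamma (c - 1) : ℝ) : ℂ) := by
    rw [integral_const_mul]
    have e2 : (-((c - 1 : ℝ) : ℂ)) = ((1 - c : ℝ) : ℂ) := by push_cast; ring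
    rw [e2] at hL
    rw [e1] at hM
    rw [hsplit] at hL
    rw [eq_div_iff hne]
    linear_combination hM + Complex.exp u * hL
  rw [key, norm_div, norm_neg, Complex.norm_real, Real.norm_of_nonneg hGp.le]
  gcongr
  refine norm_integral_le_of_norm_le (((gi_integrable (c - 2) 1 (by linarith) one_pos).mono_set
    (Ioi_subset_Ioi zero_le_one)).const_mul _) ?_
  refine (ae_restrict_iff' measurableSet_Ioi).2 (Eventually.of_forall fun t ht => ?_)
  have ht1 : 1 < t := ht
  rw [norm_mul, gi_norm _ _ (by linarith), Complex.norm_exp]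
  have : Real.exp u.re * Real.exp (-(u.re * t)) ≤ Real.exp 1 * Real.exp (-(1 * t)) := by
    rw [← Real.exp_add, ← Real.exp_add]
    refine Real.exp_le_exp.2 ?_
    nlinarith
  have h0 : 0 ≤ t ^ (c - 2) := by positivity
  nlinarith

open MeasureTheory Set in
/-- Contour representation of the shifted series. -/
lemma series_repr (a b c r q : ℝ) (ha : 0 < a) (hb : 1 < b) (hc : 2 ≤ c) (hr : 0 < r) (hq : 0 ≤ q) :
    Integrable (fun y : ℝ => Complex.exp (Complex.I * r * y) * (1 + Complex.I * (y : ℂ)) ^ (-(b : ℂ)) *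
      mlf c (q * (1 + Complex.I * (y : ℂ)) ^ (-(a : ℂ)))) ∧
    HasSum (fun n : ℕ => (((q * r ^ a) ^ n / (Real.Gamma (n + c) * Real.Gamma (a * n + b)) : ℝ) : ℂ))
      (((Real.exp r * r ^ (1 - b) / (2 * Real.pi) : ℝ) : ℂ) *
        ∫ y : ℝ, Complex.exp (Complex.I * r * y) * (1 + Complex.I * (y : ℂ)) ^ (-(b : ℂ)) *
          mlf c (q * (1 + Complex.I * (y : ℂ)) ^ (-(a : ℂ)))) := by
  set F : ℕ → ℝ → ℂ := fun n y => ((q ^ n / Real.Gamma (n + c) : ℝ) : ℂ) *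
    (Complex.exp (Complex.I * r * y) * (1 + Complex.I * (y : ℂ)) ^ (-((a * n + b : ℝ) : ℂ))) with hF
  have hne : ∀ y : ℝ, 1 + Complex.I * (y : ℂ) ≠ 0 := fun y => Complex.slitPlane_ne_zero (one_add_slit y)
  have hFalt : ∀ n y, F n y = Complex.exp (Complex.I * r * y) * (1 + Complex.I * (y : ℂ)) ^ (-(b : ℂ)) *
      ((q * (1 + Complex.I * (y : ℂ)) ^ (-(a : ℂ))) ^ n / ((Real.Gamma (n + c) : ℝ) : ℂ)) := by
    intro n y
    have : (-((a * n + b : ℝ) : ℂ)) = -(b : ℂ) + (-(a : ℂ)) * (n : ℕ) := by push_cast; ring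
    simp only [hF, this]
    rw [Complex.cpow_add _ _ (hne y), Complex.cpow_mul_nat, mul_pow]
    push_cast
    ring
  have hnormexp : ∀ y : ℝ, ‖Complex.exp (Complex.I * r * y)‖ = 1 := by
    intro y
    have : Complex.I * r * y = ((r * y : ℝ) : ℂ) * Complex.I := by push_cast; ring
    rw [this, Complex.norm_exp_ofReal_mul_I]
  have hbn : ∀ n : ℕ, 1 < a * n + b := fun n => by
    have : 0 ≤ a * n := by positivity
    linarith
  have hle1 : ∀ (y p : ℝ), 0 ≤ p → (1 + y ^ 2) ^ (-p / 2) ≤ 1 := fun y p hp =>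
    Real.rpow_le_one_of_one_le_of_nonpos (by nlinarith [sq_nonneg y]) (by linarith)
  have hFn : ∀ n y, ‖F n y‖ ≤ q ^ n / n.factorial * (1 + y ^ 2) ^ (-b / 2) := by
    intro n y
    rw [hFalt, norm_mul, norm_mul, hnormexp, one_mul]
    have h1 := norm_one_add_cpow y (-b)
    have h2 := norm_one_add_cpow y (-a)
    push_cast at h1 h2
    rw [h1, mul_comm]
    gcongr
    refine (mlf_term_norm c hc _ n).trans ?_
    gcongr
    rw [norm_mul, h2, Complex.norm_real, Real.norm_of_nonneg hq]
    nlinarith [hle1 y a ha.le]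
  have hFc : ∀ n, Continuous (F n) := by
    intro n
    have := cont_one_add_cpow (-((a * n + b : ℝ) : ℂ))
    simp only [hF]
    fun_prop
  have hb' := one_add_sq_integrable b hb
  have hFi : ∀ n, Integrable (F n) := fun n =>
    (hb'.const_mul (q ^ n / n.factorial)).mono' (hFc n).aestronglyMeasurable
      (Eventually.of_forall (hFn n))
  have hsum : Summable fun n => ∫ y, ‖F n y‖ := by
    refine Summable.of_nonneg_of_le (fun n => integral_nonneg fun y => norm_nonneg _) (fun n => ?_)
      ((Real.summable_pow_div_factorial q).mul_right (∫ y : ℝ, (1 + y ^ 2) ^ (-b / 2)))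
    rw [← integral_const_mul]
    exact integral_mono (hFi n).norm (hb'.const_mul _) (hFn n)
  have hH := hasSum_integral_of_summable_integral_norm hFi hsum
  have htsum : ∀ y, ∑' n, F n y = Complex.exp (Complex.I * r * y) * (1 + Complex.I * (y : ℂ)) ^ (-(b : ℂ)) *
      mlf c (q * (1 + Complex.I * (y : ℂ)) ^ (-(a : ℂ))) := by
    intro y
    simp only [hFalt]
    rw [tsum_mul_left, mlf]
  simp only [htsum] at hH
  constructor
  · have hmeas : AEStronglyMeasurable (fun y : ℝ => ∑' n, F n y) := by
      have : Continuous (fun y : ℝ => ∑' n, F n y) := by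
        refine continuous_tsum hFc (Real.summable_pow_div_factorial q) (fun n y => ?_)
        refine (hFn n y).trans ?_
        exact mul_le_of_le_one_right (by positivity) (hle1 y b (by linarith))
      exact this.aestronglyMeasurable
    simp only [htsum] at hmeas
    refine (hb'.const_mul (Real.exp q)).mono' hmeas (Eventually.of_forall fun y => ?_)
    rw [norm_mul, norm_mul, hnormexp, one_mul]
    have h1 := norm_one_add_cpow y (-b)
    have h2 := norm_one_add_cpow y (-a)
    push_cast at h1 h2
    rw [h1, mul_comm]
    gcongr
    refine (mlf_norm_le c hc _).trans (Real.exp_le_exp.2 ?_)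
    rw [norm_mul, h2, Complex.norm_real, Real.norm_of_nonneg hq]
    nlinarith [hle1 y a ha.le]
  · have hH2 := hH.mul_left ((Real.exp r * r ^ (1 - b) / (2 * Real.pi) : ℝ) : ℂ)
    refine hH2.congr_fun ?_
    intro n
    simp only [hF]
    rw [integral_const_mul, gamma_inversion _ (hbn n) r hr]
    have hp1 : Real.exp r * Real.exp (-r) = 1 := by rw [← Real.exp_add]; simp
    have hp2 : r ^ (1 - b) * r ^ (a * n + b - 1) = (r ^ a) ^ n := by
      rw [← Real.rpow_add hr, ← Real.rpow_mul_natCast hr.le]; congr 1; ring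
    have hreal : (q * r ^ a) ^ n / (Real.Gamma (n + c) * Real.Gamma (a * n + b)) =
        Real.exp r * r ^ (1 - b) / (2 * Real.pi) * (q ^ n / Real.Gamma (n + c) *
          (2 * Real.pi * (r ^ (a * n + b - 1) * Real.exp (-r) / Real.Gamma (a * n + b)))) := by
      rw [mul_pow, ← hp2]
      have hpi := Real.pi_pos.ne'
      have : q ^ n * (r ^ (1 - b) * r ^ (a * n + b - 1)) = (Real.exp r * Real.exp (-r)) *
        (q ^ n * (r ^ (1 - b) * r ^ (a * n + b - 1))) := by rw [hp1, one_mul]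
      rw [this]
      field_simp
    rw [hreal]
    push_cast
    ring


lemma central_data (a : ℝ) : ∃ D : ℝ, 0 < D ∧ ∀ y ∈ Set.Icc (-D) D,
    1 / 2 ≤ ((1 + Complex.I * (y : ℂ)) ^ (-(a : ℂ))).re ∧
    Complex.log ((1 + Complex.I * (y : ℂ)) ^ (-(a : ℂ))) = -(a : ℂ) * Complex.log (1 + Complex.I * (y : ℂ)) := by
  have c1 : ContinuousAt (fun y : ℝ => ((1 + Complex.I * (y : ℂ)) ^ (-(a : ℂ))).re) 0 :=
    (Complex.continuous_re.comp (cont_one_add_cpow _)).continuousAt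
  have c2 : ContinuousAt (fun y : ℝ => |(Complex.log (1 + Complex.I * (y : ℂ)) * (-(a : ℂ))).im|) 0 := by
    have h : ContinuousAt (fun y : ℝ => Complex.log (1 + Complex.I * (y : ℂ))) 0 :=
      ContinuousAt.clog (by fun_prop) (one_add_slit 0)
    have h2 : ContinuousAt (fun y : ℝ => Complex.log (1 + Complex.I * (y : ℂ)) * (-(a : ℂ))) 0 := by fun_prop
    exact ((Complex.continuous_im.continuousAt).comp h2).abs
  have e1 : ∀ᶠ y : ℝ in 𝓝 (0:ℝ), 1 / 2 < ((1 + Complex.I * (y : ℂ)) ^ (-(a : ℂ))).re :=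
    c1.eventually (Ioi_mem_nhds (by norm_num))
  have e2 : ∀ᶠ y : ℝ in 𝓝 (0:ℝ), |(Complex.log (1 + Complex.I * (y : ℂ)) * (-(a : ℂ))).im| < Real.pi :=
    c2.eventually (Iio_mem_nhds (by simpa using Real.pi_pos))
  obtain ⟨ρ, hρ, h⟩ := Metric.eventually_nhds_iff_ball.1 (e1.and e2)
  refine ⟨ρ / 2, by positivity, fun y hy => ?_⟩
  obtain ⟨h1, h2⟩ := h y (by
    rw [mem_ball_zero_iff, Real.norm_eq_abs]; exact (abs_le.2 hy).trans_lt (by linarith))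
  refine ⟨h1.le, ?_⟩
  rw [Complex.cpow_def_of_ne_zero (Complex.slitPlane_ne_zero (one_add_slit y)),
    Complex.log_exp (abs_lt.1 h2).1 (abs_lt.1 h2).2.le, mul_comm]

lemma rpow_exp_le (s β : ℝ) (hβ : 0 < β) : ∃ R : ℝ, 1 ≤ R ∧ ∀ r, R ≤ r → r ^ s * Real.exp (-β * r) ≤ 1 := by
  have h := (tendsto_rpow_mul_exp_neg_mul_atTop_nhds_zero s β hβ).eventually (Iic_mem_nhds zero_lt_one)
  obtain ⟨R, hR⟩ := eventually_atTop.1 h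
  exact ⟨max 1 R, le_max_left _ _, fun r hr => hR r ((le_max_right _ _).trans hr)⟩

open MeasureTheory Set in
lemma integral_asymp_aux (a b c l : ℝ) (ha : 0 < a) (hb : 1 < b) (hc : 2 ≤ c) (hl : l = -b - a * (1 - c)) :
    ∃ C ρ R : ℝ, ρ < 1 ∧ 0 ≤ C ∧ 1 ≤ R ∧ ∀ r : ℝ, R ≤ r →
    ‖(∫ y : ℝ, Complex.exp (Complex.I * r * y) * (1 + Complex.I * (y : ℂ)) ^ (-(b : ℂ)) *
          mlf c (((r / a : ℝ) : ℂ) * (1 + Complex.I * (y : ℂ)) ^ (-(a : ℂ)))) -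
      ((Real.exp (r / a) * (r / a) ^ (1 - c) : ℝ) : ℂ) *
        ((Real.sqrt (2 * Real.pi / (r * (1 + a))) * (1 + (-(l * (l - 1)) / (2 * (1 + a)) +
          3 * ((1 + a) * (a + 2) * (a + 3) / 24 + l * (-((1 + a) * (a + 2) / 6))) / (1 + a) ^ 2 -
          15 * (-((1 + a) * (a + 2) / 6)) ^ 2 / (2 * (1 + a) ^ 3)) / r) : ℝ) : ℂ)‖ ≤
      C * (Real.exp (ρ * (r / a)) + Real.exp (r / a) * (r / a) ^ (1 - c) * (1 / (r ^ 2 * Real.sqrt r))) := by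
  obtain ⟨D, hD, hdata⟩ := central_data a
  obtain ⟨δ, C, hδ, hδD, hL⟩ := laplace_central a l D ha hD
  obtain ⟨K, hK⟩ := mlf_asymp c hc
  set B : ℝ := ∫ y : ℝ, (1 + y ^ 2) ^ (-b / 2) with hB
  have hB0 : 0 ≤ B := integral_nonneg fun y => by positivity
  set ρ : ℝ := (1 + δ ^ 2) ^ (-a / 2) with hρ
  have hρ0 : 0 < ρ := by positivity
  refine ⟨B + |K| * B + |C|, ρ, max 1 (2 * a), ?_, by positivity, le_max_left _ _, fun r hr => ?_⟩
  · exact Real.rpow_lt_one_of_one_lt_of_neg (by nlinarith [sq_pos_of_pos hδ]) (by linarith)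
  have hr1 : 1 ≤ r := (le_max_left _ _).trans hr
  have hr2 : 2 * a ≤ r := (le_max_right _ _).trans hr
  have hr0 : 0 < r := by linarith
  set q : ℝ := r / a with hq
  have hq2 : 2 ≤ q := by rw [hq, le_div_iff₀ ha]; linarith
  have hq0 : 0 < q := by linarith
  specialize hL r hr1
  obtain ⟨hPhiInt, -⟩ := series_repr a b c r q ha hb hc hr0 hq0.le
  set Φ : ℝ → ℂ := fun y => Complex.exp (Complex.I * r * y) * (1 + Complex.I * (y : ℂ)) ^ (-(b : ℂ)) *
          mlf c ((q : ℂ) * (1 + Complex.I * (y : ℂ)) ^ (-(a : ℂ))) with hΦ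
  set J : ℝ → ℂ := fun y => Complex.exp (r * (Complex.I * y +
          ((1 + Complex.I * (y : ℂ)) ^ (-(a : ℂ)) - 1) / a)) * (1 + Complex.I * (y : ℂ)) ^ (l : ℂ) with hJ
  set L : ℂ := ((Real.sqrt (2 * Real.pi / (r * (1 + a))) * (1 + (-(l * (l - 1)) / (2 * (1 + a)) +
          3 * ((1 + a) * (a + 2) * (a + 3) / 24 + l * (-((1 + a) * (a + 2) / 6))) / (1 + a) ^ 2 -
          15 * (-((1 + a) * (a + 2) / 6)) ^ 2 / (2 * (1 + a) ^ 3)) / r) : ℝ) : ℂ) with hLdef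
  set E : ℝ := Real.exp q * q ^ (1 - c) with hE
  have hE0 : 0 ≤ E := by positivity
  have hnormexp : ∀ y : ℝ, ‖Complex.exp (Complex.I * r * y)‖ = 1 := by
    intro y
    have : Complex.I * r * y = ((r * y : ℝ) : ℂ) * Complex.I := by push_cast; ring
    rw [this, Complex.norm_exp_ofReal_mul_I]
  have hnb : ∀ y : ℝ, ‖Complex.exp (Complex.I * r * y) * (1 + Complex.I * (y : ℂ)) ^ (-(b : ℂ))‖ =
      (1 + y ^ 2) ^ (-b / 2) := by
    intro y
    have h1 := norm_one_add_cpow y (-b)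
    push_cast at h1
    rw [norm_mul, hnormexp, one_mul, h1]
  have hbi := one_add_sq_integrable b hb
  -- pointwise identity in the centre
  have hpt : ∀ y ∈ Icc (-δ) δ, Φ y - (E : ℂ) * J y =
      (Complex.exp (Complex.I * r * y) * (1 + Complex.I * (y : ℂ)) ^ (-(b : ℂ))) *
      (mlf c ((q : ℂ) * (1 + Complex.I * (y : ℂ)) ^ (-(a : ℂ))) -
        Complex.exp ((q : ℂ) * (1 + Complex.I * (y : ℂ)) ^ (-(a : ℂ))) *
        ((q : ℂ) * (1 + Complex.I * (y : ℂ)) ^ (-(a : ℂ))) ^ ((1 - c : ℝ) : ℂ)) := by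
    intro y hy
    have hne := Complex.slitPlane_ne_zero (one_add_slit y)
    obtain ⟨-, hlog⟩ := hdata y ⟨by linarith [hy.1], by linarith [hy.2]⟩
    have hvne : (1 + Complex.I * (y : ℂ)) ^ (-(a : ℂ)) ≠ 0 := by
      rw [Complex.cpow_def_of_ne_zero hne]; exact Complex.exp_ne_zero _
    have hqv : (q : ℂ) * (1 + Complex.I * (y : ℂ)) ^ (-(a : ℂ)) ≠ 0 :=
      mul_ne_zero (by exact_mod_cast hq0.ne') hvne
    have key : (E : ℂ) * J y = (Complex.exp (Complex.I * r * y) * (1 + Complex.I * (y : ℂ)) ^ (-(b : ℂ))) *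
        (Complex.exp ((q : ℂ) * (1 + Complex.I * (y : ℂ)) ^ (-(a : ℂ))) *
        ((q : ℂ) * (1 + Complex.I * (y : ℂ)) ^ (-(a : ℂ))) ^ ((1 - c : ℝ) : ℂ)) := by
      have hEl : (E : ℂ) = Complex.exp (q + Real.log q * (1 - c)) := by
        rw [hE, Real.rpow_def_of_pos hq0, ← Real.exp_add]
        push_cast; rfl
      rw [Complex.cpow_def_of_ne_zero hqv, Complex.log_ofReal_mul hq0 hvne, hlog]
      rw [hEl]
      simp only [hJ]
      rw [Complex.cpow_def_of_ne_zero hne (l : ℂ), Complex.cpow_def_of_ne_zero hne (-(b : ℂ))]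
      simp only [← Complex.exp_add]
      congr 1
      have ha' : (a : ℂ) ≠ 0 := by exact_mod_cast ha.ne'
      rw [hl, hq]
      push_cast
      field_simp
      ring
    rw [key]
    simp only [hΦ]
    ring
  have hJc : Continuous J := by
    have h1 := cont_one_add_cpow (-(a : ℂ))
    have h2 := cont_one_add_cpow (l : ℂ)
    simp only [hJ]
    fun_prop
  have hJi : IntegrableOn J (Icc (-δ) δ) := hJc.integrableOn_Icc
  have hsplit : ∫ y, Φ y = (∫ y in Icc (-δ) δ, Φ y) + ∫ y in (Icc (-δ) δ)ᶜ, Φ y :=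
    (integral_add_compl measurableSet_Icc hPhiInt).symm
  have hcen : ‖(∫ y in Icc (-δ) δ, Φ y) - (E : ℂ) * ∫ y in Icc (-δ) δ, J y‖ ≤ |K| * B := by
    rw [← integral_const_mul, ← integral_sub hPhiInt.integrableOn (hJi.const_mul _)]
    calc _ ≤ ∫ y in Icc (-δ) δ, |K| * (1 + y ^ 2) ^ (-b / 2) := by
          refine norm_integral_le_of_norm_le (hbi.const_mul _).integrableOn ?_
          refine (ae_restrict_iff' measurableSet_Icc).2 (Eventually.of_forall fun y hy => ?_)
          rw [hpt y hy, norm_mul, hnb, mul_comm]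
          gcongr
          refine (hK _ ?_).trans (le_abs_self K)
          obtain ⟨h, -⟩ := hdata y ⟨by linarith [hy.1], by linarith [hy.2]⟩
          rw [Complex.re_ofReal_mul]
          nlinarith
      _ ≤ ∫ y, |K| * (1 + y ^ 2) ^ (-b / 2) :=
          setIntegral_le_integral (hbi.const_mul _) (Eventually.of_forall fun y => by positivity)
      _ = |K| * B := by rw [integral_const_mul]
  have hout : ‖∫ y in (Icc (-δ) δ)ᶜ, Φ y‖ ≤ Real.exp (ρ * q) * B := by
    calc _ ≤ ∫ y in (Icc (-δ) δ)ᶜ, Real.exp (ρ * q) * (1 + y ^ 2) ^ (-b / 2) := by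
          refine norm_integral_le_of_norm_le (hbi.const_mul _).integrableOn ?_
          refine (ae_restrict_iff' measurableSet_Icc.compl).2 (Eventually.of_forall fun y hy => ?_)
          simp only [hΦ]
          rw [norm_mul, hnb, mul_comm]
          gcongr
          refine (mlf_norm_le c hc _).trans (Real.exp_le_exp.2 ?_)
          have h2 := norm_one_add_cpow y (-a)
          push_cast at h2
          rw [norm_mul, h2, Complex.norm_real, Real.norm_of_nonneg hq0.le, mul_comm]
          gcongr
          have hyδ : δ ^ 2 ≤ y ^ 2 := by
            rw [sq_le_sq, abs_of_pos hδ]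
            by_contra hlt
            push Not at hlt
            exact hy (abs_le.1 hlt.le)
          exact Real.rpow_le_rpow_of_nonpos (by positivity) (by linarith) (by linarith)
      _ ≤ ∫ y, Real.exp (ρ * q) * (1 + y ^ 2) ^ (-b / 2) :=
          setIntegral_le_integral (hbi.const_mul _) (Eventually.of_forall fun y => by positivity)
      _ = _ := by rw [integral_const_mul]
  have hone : 1 ≤ Real.exp (ρ * q) := Real.one_le_exp (by positivity)
  have hdec : (∫ y, Φ y) - (E : ℂ) * L = ((∫ y in Icc (-δ) δ, Φ y) - (E : ℂ) * ∫ y in Icc (-δ) δ, J y) +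
      (∫ y in (Icc (-δ) δ)ᶜ, Φ y) + (E : ℂ) * ((∫ y in Icc (-δ) δ, J y) - L) := by
    rw [hsplit]; ring
  rw [hdec]
  have h3 : ‖(E : ℂ) * ((∫ y in Icc (-δ) δ, J y) - L)‖ ≤ E * (|C| * (1 / (r ^ 2 * Real.sqrt r))) := by
    rw [norm_mul, Complex.norm_real, Real.norm_of_nonneg hE0]
    gcongr
    refine hL.trans ?_
    rw [mul_one_div]
    gcongr
    exact le_abs_self C
  refine (norm_add₃_le).trans ((add_le_add (add_le_add hcen hout) h3).trans ?_)
  set S := 1 / (r ^ 2 * Real.sqrt r)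
  have hS : 0 ≤ S := by positivity
  set X := Real.exp (ρ * q)
  have t1 : |K| * B ≤ |K| * B * X := le_mul_of_one_le_right (by positivity) hone
  have t2 : 0 ≤ (B + |K| * B) * (E * S) := by positivity
  have t3 : 0 ≤ |C| * X := by positivity
  nlinarith


/-- The coefficient `C₁` in the variable `r`. -/
noncomputable def coefC (a l : ℝ) : ℝ := -(l * (l - 1)) / (2 * (1 + a)) +
          3 * ((1 + a) * (a + 2) * (a + 3) / 24 + l * (-((1 + a) * (a + 2) / 6))) / (1 + a) ^ 2 -
          15 * (-((1 + a) * (a + 2) / 6)) ^ 2 / (2 * (1 + a) ^ 3)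

open MeasureTheory Set in
lemma integral_asymp (a b c l : ℝ) (ha : 0 < a) (hb : 1 < b) (hc : 2 ≤ c) (hl : l = -b - a * (1 - c)) :
    ∃ C R : ℝ, 0 ≤ C ∧ 1 ≤ R ∧ ∀ r : ℝ, R ≤ r →
    ‖((Real.exp (-(r / a)) * (r / a) ^ (c - 1) * Real.sqrt r * Real.sqrt ((1 + a) / (2 * Real.pi)) : ℝ) : ℂ) *
      (∫ y : ℝ, Complex.exp (Complex.I * r * y) * (1 + Complex.I * (y : ℂ)) ^ (-(b : ℂ)) *
          mlf c (((r / a : ℝ) : ℂ) * (1 + Complex.I * (y : ℂ)) ^ (-(a : ℂ)))) -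
      ((1 + coefC a l / r : ℝ) : ℂ)‖ ≤ C / r ^ 2 := by
  obtain ⟨C, ρ, R₁, hρ, hC, hR₁, hA⟩ := integral_asymp_aux a b c l ha hb hc hl
  obtain ⟨R₂, hR₂, hB⟩ := rpow_exp_le (c - 1 + 1 / 2 + 2) ((1 - ρ) / a) (div_pos (by linarith) ha)
  set s : ℝ := Real.sqrt ((1 + a) / (2 * Real.pi)) with hs
  have hs0 : 0 < s := Real.sqrt_pos.2 (by positivity)
  refine ⟨s * C * ((1 / a) ^ (c - 1) + 1), max R₁ R₂, by positivity, hR₁.trans (le_max_left _ _), fun r hr => ?_⟩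
  have hr1 : R₁ ≤ r := (le_max_left _ _).trans hr
  have hr2 : R₂ ≤ r := (le_max_right _ _).trans hr
  have hr0 : 0 < r := by linarith
  specialize hA r hr1
  specialize hB r hr2
  set q : ℝ := r / a with hq
  have hq0 : 0 < q := by positivity
  set I := ∫ y : ℝ, Complex.exp (Complex.I * r * y) * (1 + Complex.I * (y : ℂ)) ^ (-(b : ℂ)) *
          mlf c ((q : ℂ) * (1 + Complex.I * (y : ℂ)) ^ (-(a : ℂ))) with hI
  set W : ℝ := Real.exp (-q) * q ^ (c - 1) * Real.sqrt r * s with hW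
  have hW0 : 0 ≤ W := by positivity
  have hsr : 0 < Real.sqrt r := Real.sqrt_pos.2 hr0
  have hone : Real.exp (-q) * q ^ (c - 1) * (Real.exp q * q ^ (1 - c)) = 1 := by
    have h1 : Real.exp (-q) * Real.exp q = 1 := by rw [← Real.exp_add]; simp
    have h2 : q ^ (c - 1) * q ^ (1 - c) = 1 := by
      rw [← Real.rpow_add hq0]; simp
    calc _ = (Real.exp (-q) * Real.exp q) * (q ^ (c - 1) * q ^ (1 - c)) := by ring
      _ = 1 := by rw [h1, h2, one_mul]
  have hss : Real.sqrt r * s * Real.sqrt (2 * Real.pi / (r * (1 + a))) = 1 := by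
    rw [hs, ← Real.sqrt_mul (by positivity), ← Real.sqrt_mul (by positivity)]
    rw [Real.sqrt_eq_one]
    have := Real.pi_pos.ne'
    field_simp
  have hWL : W * ((Real.exp q * q ^ (1 - c)) * (Real.sqrt (2 * Real.pi / (r * (1 + a))) * (1 + coefC a l / r))) =
      1 + coefC a l / r := by
    calc _ = (Real.exp (-q) * q ^ (c - 1) * (Real.exp q * q ^ (1 - c))) *
        (Real.sqrt r * s * Real.sqrt (2 * Real.pi / (r * (1 + a)))) * (1 + coefC a l / r) := by rw [hW]; ring
      _ = _ := by rw [hone, hss]; ring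
  rw [← hWL]
  have e : (W : ℂ) * I - ((W * ((Real.exp q * q ^ (1 - c)) * (Real.sqrt (2 * Real.pi / (r * (1 + a))) *
      (1 + coefC a l / r))) : ℝ) : ℂ) = (W : ℂ) * (I - ((Real.exp q * q ^ (1 - c) : ℝ) : ℂ) *
      ((Real.sqrt (2 * Real.pi / (r * (1 + a))) * (1 + coefC a l / r) : ℝ) : ℂ)) := by
    push_cast; ring
  rw [e, norm_mul, Complex.norm_real, Real.norm_of_nonneg hW0]
  have hA' : ‖I - ((Real.exp q * q ^ (1 - c) : ℝ) : ℂ) *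
      ((Real.sqrt (2 * Real.pi / (r * (1 + a))) * (1 + coefC a l / r) : ℝ) : ℂ)‖ ≤
      C * (Real.exp (ρ * q) + Real.exp q * q ^ (1 - c) * (1 / (r ^ 2 * Real.sqrt r))) := hA
  refine (mul_le_mul_of_nonneg_left hA' hW0).trans ?_
  have t1 : Real.exp (-q) * q ^ (c - 1) * Real.sqrt r * Real.exp (ρ * q) ≤ (1 / a) ^ (c - 1) / r ^ 2 := by
    have u1 : Real.exp (-q) * Real.exp (ρ * q) = Real.exp (-((1 - ρ) / a) * r) := by
      rw [← Real.exp_add]; congr 1; rw [hq]; field_simp; ring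
    have u2 : q ^ (c - 1) = (1 / a) ^ (c - 1) * r ^ (c - 1) := by
      rw [← Real.mul_rpow (by positivity) hr0.le]; congr 1; rw [hq]; ring
    have u3 : r ^ (c - 1 + 1 / 2 + 2) = r ^ (c - 1) * Real.sqrt r * r ^ 2 := by
      rw [Real.rpow_add hr0, Real.rpow_add hr0, Real.sqrt_eq_rpow]; norm_num
    rw [u3] at hB
    rw [le_div_iff₀ (by positivity)]
    calc _ = (1 / a) ^ (c - 1) * (r ^ (c - 1) * Real.sqrt r * r ^ 2 * (Real.exp (-q) * Real.exp (ρ * q))) := by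
          rw [u2]; ring
      _ ≤ (1 / a) ^ (c - 1) * 1 := by rw [u1]; gcongr
      _ = _ := by ring
  have t2 : W * (Real.exp q * q ^ (1 - c) * (1 / (r ^ 2 * Real.sqrt r))) = s * (1 / r ^ 2) := by
    calc _ = (Real.exp (-q) * q ^ (c - 1) * (Real.exp q * q ^ (1 - c))) *
        (Real.sqrt r * s * (1 / (r ^ 2 * Real.sqrt r))) := by rw [hW]; ring
      _ = _ := by rw [hone]; field_simp
  calc W * (C * (Real.exp (ρ * q) + Real.exp q * q ^ (1 - c) * (1 / (r ^ 2 * Real.sqrt r)))) =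
      C * (s * (Real.exp (-q) * q ^ (c - 1) * Real.sqrt r * Real.exp (ρ * q)) +
        W * (Real.exp q * q ^ (1 - c) * (1 / (r ^ 2 * Real.sqrt r)))) := by rw [hW]; ring
    _ ≤ C * (s * ((1 / a) ^ (c - 1) / r ^ 2) + s * (1 / r ^ 2)) := by rw [t2]; gcongr
    _ = _ := by ring

lemma coef_identity (ν a l c₁ : ℝ) (ha : 0 < a) (hl : l = a / 2 - ν - 3 / 2) (hc₁ : c₁ = -(1 / (24 * a)) *
      (11 + 24 * ν + 12 * ν ^ 2 - a * (25 + 24 * ν) + 11 * a ^ 2)) : c₁ = coefC a l * (1 + a) / a := by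
  have h : (1 + a) ≠ 0 := by positivity
  rw [hc₁, coefC, hl]
  field_simp
  ring

/-- The constant factor collapses. -/
lemma const_collapse (ν a : ℝ) (N : ℕ) (r : ℝ) (ha : 0 < a) (hr : 0 < r) :
    (r / a * r ^ a) ^ N * (r ^ (1 - (a * N + ν + 3 / 2)) / (2 * Real.pi)) * ((1 + a) * (r / a)) ^ (ν + 3 / 2) /
      (((1 + a) / a) ^ (ν + 1) / Real.sqrt (2 * Real.pi)) =
    (r / a) ^ ((N + 3 / 2 : ℝ) - 1) * Real.sqrt r * Real.sqrt ((1 + a) / (2 * Real.pi)) := by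
  have hpi := Real.pi_pos
  have e1 : (1 + a) * (r / a) = (1 + a) / a * r := by ring
  have e2 : r / a = r * a⁻¹ := by ring
  have hk : 0 < (1 + a) / a := by positivity
  have e3 : ((1 + a) / a) ^ (ν + 3 / 2) = ((1 + a) / a) ^ (ν + 1) * Real.sqrt ((1 + a) / a) := by
    rw [Real.sqrt_eq_rpow, ← Real.rpow_add hk]; congr 1; ring
  have e4 : (r / a) ^ ((N + 3 / 2 : ℝ) - 1) = (r / a) ^ N * (Real.sqrt r / Real.sqrt a) := by
    rw [← Real.sqrt_div hr.le, Real.sqrt_eq_rpow, ← Real.rpow_natCast, ← Real.rpow_add (by positivity)]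
    congr 1; ring
  have e5 : (r ^ a) ^ N * r ^ (1 - (a * N + ν + 3 / 2)) * r ^ (ν + 3 / 2) = Real.sqrt r * Real.sqrt r := by
    rw [← Real.rpow_mul_natCast hr.le, ← Real.rpow_add hr, ← Real.rpow_add hr, Real.mul_self_sqrt hr.le]
    rw [show a * N + (1 - (a * N + ν + 3 / 2)) + (ν + 3 / 2) = 1 by ring, Real.rpow_one]
  rw [e1, Real.mul_rpow hk.le hr.le, e3, e4, mul_pow, Real.sqrt_div (by positivity), Real.sqrt_div (by positivity)]
  have hP : ((1 + a) / a) ^ (ν + 1) ≠ 0 := (Real.rpow_pos_of_pos hk _).ne'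
  have h2 : Real.sqrt (2 * Real.pi) ≠ 0 := (Real.sqrt_pos.2 (by positivity)).ne'
  have h3 : Real.sqrt a ≠ 0 := (Real.sqrt_pos.2 ha).ne'
  have h4 : Real.sqrt (2 * Real.pi) * Real.sqrt (2 * Real.pi) = 2 * Real.pi := Real.mul_self_sqrt (by positivity)
  set t := Real.sqrt (2 * Real.pi)
  rw [← h4]
  set P := ((1 + a) / a) ^ (ν + 1)
  calc _ = (r / a) ^ N * ((r ^ a) ^ N * r ^ (1 - (a * N + ν + 3 / 2)) * r ^ (ν + 3 / 2)) *
      (Real.sqrt (1 + a) / Real.sqrt a) * (P / P) * (t / (t * t)) := by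
        field_simp
    _ = _ := by
      rw [e5, div_self hP]
      field_simp

/-- The Struve series splits into a polynomial and the contour integral. -/
lemma struveL_split (ν a x q r : ℝ) (N : ℕ) (ha : 0 < a) (hx : 0 < x) (hr : 0 < r) (hq : 0 ≤ q)
    (hb : 1 < a * N + ν + 3 / 2) (hN : 1 ≤ N) (hw : x ^ 2 / 4 = q * r ^ a) :
    ((x : ℂ) / 2) ^ (-(ν : ℂ) - 1) * struveL ν a (x : ℂ) =
      (((q * r ^ a) ^ N : ℝ) : ℂ) * ((((Real.exp r * r ^ (1 - (a * N + ν + 3 / 2)) / (2 * Real.pi) : ℝ) : ℂ)) *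
        ∫ y : ℝ, Complex.exp (Complex.I * r * y) *
          (1 + Complex.I * (y : ℂ)) ^ (-((a * N + ν + 3 / 2 : ℝ) : ℂ)) *
          mlf (N + 3 / 2) (q * (1 + Complex.I * (y : ℂ)) ^ (-(a : ℂ)))) +
      ((∑ n ∈ Finset.range N, (q * r ^ a) ^ n /
        (Real.Gamma (n + 3 / 2) * Real.Gamma (a * n + ν + 3 / 2)) : ℝ) : ℂ) := by
  have hN' : (1 : ℝ) ≤ N := by exact_mod_cast hN
  obtain ⟨-, hS⟩ := series_repr a (a * N + ν + 3 / 2) (N + 3 / 2) r q ha hb (by linarith) hr hq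
  set f : ℕ → ℂ := fun n => (((q * r ^ a) ^ n /
        (Real.Gamma (n + 3 / 2) * Real.Gamma (a * n + ν + 3 / 2)) : ℝ) : ℂ) with hf
  have hterm : ∀ n : ℕ, ((x : ℂ) / 2) ^ (2 * n) / (Complex.Gamma ((n : ℂ) + 3 / 2) *
        Complex.Gamma ((a : ℂ) * (n : ℂ) + (ν : ℂ) + 3 / 2)) = f n := by
    intro n
    simp only [hf]
    have g1 : (n : ℂ) + 3 / 2 = ((n + 3 / 2 : ℝ) : ℂ) := by push_cast; ring
    have g2 : (a : ℂ) * (n : ℂ) + (ν : ℂ) + 3 / 2 = ((a * n + ν + 3 / 2 : ℝ) : ℂ) := by push_cast; ring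
    rw [g1, g2, Complex.Gamma_ofReal, Complex.Gamma_ofReal, ← hw, pow_mul]
    have g3 : ((x : ℂ) / 2) ^ 2 = ((x ^ 2 / 4 : ℝ) : ℂ) := by push_cast; ring
    rw [g3]
    push_cast
    rfl
  have hS2 := hS.mul_left (((q * r ^ a) ^ N : ℝ) : ℂ)
  have hS3 : HasSum (fun n => f (n + N)) ((((q * r ^ a) ^ N : ℝ) : ℂ) * ((((Real.exp r * r ^ (1 - (a * N + ν + 3 / 2)) / (2 * Real.pi) : ℝ) : ℂ)) *
        ∫ y : ℝ, Complex.exp (Complex.I * r * y) *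
          (1 + Complex.I * (y : ℂ)) ^ (-((a * N + ν + 3 / 2 : ℝ) : ℂ)) *
          mlf (N + 3 / 2) (q * (1 + Complex.I * (y : ℂ)) ^ (-(a : ℂ))))) := by
    refine hS2.congr_fun fun n => ?_
    simp only [hf]
    rw [← Complex.ofReal_mul]
    congr 1
    have g1 : ((n + N : ℕ) : ℝ) + 3 / 2 = n + (N + 3 / 2) := by push_cast; ring
    have g2 : a * ((n + N : ℕ) : ℝ) + ν + 3 / 2 = a * n + (a * N + ν + 3 / 2) := by push_cast; ring
    rw [g1, g2, pow_add]
    ring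
  have hS4 := ((hasSum_nat_add_iff N).1 hS3).tsum_eq
  rw [struveL]
  simp only [hterm]
  rw [hS4, ← mul_assoc]
  have hx2 : (x : ℂ) / 2 ≠ 0 := by
    have : (x : ℂ) ≠ 0 := by exact_mod_cast hx.ne'
    simpa using this
  rw [← Complex.cpow_add _ _ hx2]
  have : (-(ν : ℂ) - 1) + ((ν : ℂ) + 1) = 0 := by ring
  rw [this, Complex.cpow_zero, one_mul]
  congr 1
  simp only [hf]
  push_cast
  rfl

lemma poly_bound (ν a A₀ : ℝ) (N : ℕ) (ha : 0 < a) (hA : 0 < A₀) : ∃ C R : ℝ, 1 ≤ R ∧ ∀ r : ℝ, R ≤ r →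
    ((1 + a) * (r / a)) ^ 2 * (|∑ n ∈ Finset.range N, (r / a * r ^ a) ^ n /
        (Real.Gamma (n + 3 / 2) * Real.Gamma (a * n + ν + 3 / 2))| * ((1 + a) * (r / a)) ^ (ν + 3 / 2) *
        Real.exp (-((1 + a) * (r / a))) / A₀) ≤ C := by
  set P : ℝ := ∑ n ∈ Finset.range N, |1 / (Real.Gamma (n + 3 / 2) * Real.Gamma (a * n + ν + 3 / 2))| with hP
  have hP0 : 0 ≤ P := Finset.sum_nonneg fun n _ => abs_nonneg _
  obtain ⟨R, hR1, hR⟩ := rpow_exp_le ((1 + a) * N + (ν + 3 / 2) + 2) ((1 + a) / a) (by positivity)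
  have hk : 0 < (1 + a) / a := by positivity
  refine ⟨P * a⁻¹ ^ N * (((1 + a) / a) ^ 2 * ((1 + a) / a) ^ (ν + 3 / 2)) / A₀, max R a,
    hR1.trans (le_max_left _ _), fun r hr => ?_⟩
  have hr1 : R ≤ r := (le_max_left _ _).trans hr
  have hr2 : a ≤ r := (le_max_right _ _).trans hr
  have hr0 : 0 < r := by linarith
  specialize hR r hr1
  have hw1 : 1 ≤ r / a * r ^ a := by
    have h1 : 1 ≤ r / a := by rwa [one_le_div ha]
    have h2 : 1 ≤ r ^ a := Real.one_le_rpow (by linarith) ha.le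
    nlinarith
  have hsum : |∑ n ∈ Finset.range N, (r / a * r ^ a) ^ n /
        (Real.Gamma (n + 3 / 2) * Real.Gamma (a * n + ν + 3 / 2))| ≤ P * (r / a * r ^ a) ^ N := by
    refine (Finset.abs_sum_le_sum_abs _ _).trans ?_
    rw [hP, Finset.sum_mul]
    refine Finset.sum_le_sum fun n hn => ?_
    rw [← mul_one_div, abs_mul, mul_comm, abs_of_nonneg (by positivity : 0 ≤ (r / a * r ^ a) ^ n)]
    gcongr
    exact (Finset.mem_range.1 hn).le
  have e1 : (1 + a) * (r / a) = (1 + a) / a * r := by ring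
  have e2 : (r / a * r ^ a) ^ N = a⁻¹ ^ N * r ^ ((1 + a) * N) := by
    rw [Real.rpow_mul_natCast hr0.le, Real.rpow_add hr0, Real.rpow_one, ← mul_pow]; congr 1; ring
  have e3 : r ^ ((1 + a) * N + (ν + 3 / 2) + 2) = r ^ ((1 + a) * N) * r ^ (ν + 3 / 2) * r ^ 2 := by
    rw [Real.rpow_add hr0, Real.rpow_add hr0]; norm_num
  rw [e3] at hR
  have e4 : Real.exp (-((1 + a) * (r / a))) = Real.exp (-((1 + a) / a) * r) := by congr 1; ring
  rw [e4]
  calc _ ≤ ((1 + a) * (r / a)) ^ 2 * (P * (r / a * r ^ a) ^ N * ((1 + a) * (r / a)) ^ (ν + 3 / 2) *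
        Real.exp (-((1 + a) / a) * r) / A₀) := by gcongr
    _ = P * a⁻¹ ^ N * (((1 + a) / a) ^ 2 * ((1 + a) / a) ^ (ν + 3 / 2)) / A₀ *
        (r ^ ((1 + a) * N) * r ^ (ν + 3 / 2) * r ^ 2 * Real.exp (-((1 + a) / a) * r)) := by
        rw [e1, e2, Real.mul_rpow hk.le hr0.le]; ring
    _ ≤ P * a⁻¹ ^ N * (((1 + a) / a) ^ 2 * ((1 + a) / a) ^ (ν + 3 / 2)) / A₀ * 1 := by gcongr
    _ = _ := mul_one _

/-- Two-term exponential expansion of `L_ν(x;a)` for `a > 0` as `x → +∞`: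
`(x/2)^{−ν−1} L_ν(x;a) = A₀ Z^{−ν−3/2} e^Z (1 + c₁/Z + O(Z^{−2}))`, i.e.
`Z² (Q/A₀ − 1 − c₁/Z)` is bounded, where
`Q = (x/2)^{−ν−1} L_ν(x;a) Z^{ν+3/2} e^{−Z}`. -/
theorem struveL_exponential_expansion_two_terms (ν a : ℝ) (ha : 0 < a)
    (A₀ c₁ : ℝ)
    (hA₀ : A₀ = ((1 + a) / a) ^ (ν + 1) / Real.sqrt (2 * Real.pi))
    (hc₁ : c₁ = -(1 / (24 * a)) *
      (11 + 24 * ν + 12 * ν ^ 2 - a * (25 + 24 * ν) + 11 * a ^ 2)) :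
    ∃ C T : ℝ, ∀ x : ℝ, T ≤ x →
      ‖((struveZ a x : ℝ) : ℂ) ^ 2 *
        (((x : ℂ) / 2) ^ (-(ν : ℂ) - 1) * struveL ν a (x : ℂ) *
          ((struveZ a x ^ (ν + 3 / 2) : ℝ) : ℂ) * (Real.exp (-struveZ a x) : ℂ) /
            (A₀ : ℂ) - 1 - (c₁ : ℂ) / ((struveZ a x : ℝ) : ℂ))‖ ≤ C := by
  have hpi := Real.pi_pos
  have hA0 : 0 < A₀ := by rw [hA₀]; positivity
  obtain ⟨N, hN1, hb⟩ : ∃ N : ℕ, 1 ≤ N ∧ 1 < a * N + ν + 3 / 2 := by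
    obtain ⟨n, hn⟩ := exists_nat_gt (|ν| / a)
    rw [div_lt_iff₀ ha] at hn
    refine ⟨n + 1, by omega, ?_⟩
    push_cast
    have := neg_abs_le ν
    nlinarith
  have hN' : (1 : ℝ) ≤ N := by exact_mod_cast hN1
  set b : ℝ := a * N + ν + 3 / 2 with hbdef
  set c : ℝ := N + 3 / 2 with hcdef
  obtain ⟨C, R₁, hC, hR₁, hI⟩ := integral_asymp a b c (a / 2 - ν - 3 / 2) ha hb (by linarith)
    (by rw [hbdef, hcdef]; ring)
  obtain ⟨C', R₂, hR₂, hP⟩ := poly_bound ν a A₀ N ha hA0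
  have hco := coef_identity ν a (a / 2 - ν - 3 / 2) c₁ ha rfl hc₁
  set k : ℝ := coefC a (a / 2 - ν - 3 / 2)
  have hκ : 0 < 1 + a := by positivity
  have htend : Tendsto (fun x : ℝ => a * (a ^ (-a) * x ^ 2 / 4) ^ (1 / (1 + a))) atTop atTop := by
    refine Tendsto.const_mul_atTop ha ((tendsto_rpow_atTop (by positivity)).comp ?_)
    refine Tendsto.atTop_div_const (by norm_num) (Tendsto.const_mul_atTop (by positivity) ?_)
    exact tendsto_pow_atTop two_ne_zero
  obtain ⟨T, hT⟩ := eventually_atTop.1 ((htend.eventually_ge_atTop (max R₁ R₂)).and (eventually_gt_atTop 0))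
  refine ⟨((1 + a) / a) ^ 2 * C + C', T, fun x hx => ?_⟩
  obtain ⟨hr, hx0⟩ := hT x hx
  set q : ℝ := (a ^ (-a) * x ^ 2 / 4) ^ (1 / (1 + a)) with hq
  set r : ℝ := a * q with hrdef
  have hr1 : R₁ ≤ r := (le_max_left _ _).trans hr
  have hr2 : R₂ ≤ r := (le_max_right _ _).trans hr
  have hr0 : 0 < r := by linarith
  have hqr : q = r / a := by rw [hrdef]; field_simp
  have hq0 : 0 < q := by rw [hqr]; positivity
  have hw : x ^ 2 / 4 = r / a * r ^ a := by
    have h1 : q ^ (1 + a) = a ^ (-a) * x ^ 2 / 4 := by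
      rw [hq, ← Real.rpow_mul (by positivity), one_div, inv_mul_cancel₀ hκ.ne', Real.rpow_one]
    rw [← hqr, hrdef, Real.mul_rpow ha.le hq0.le]
    calc x ^ 2 / 4 = a ^ a * (a ^ (-a) * x ^ 2 / 4) := by
          have : a ^ a * a ^ (-a) = 1 := by rw [← Real.rpow_add ha]; simp
          linear_combination (-(x ^ 2 / 4)) * this
      _ = _ := by rw [← h1, Real.rpow_add hq0, Real.rpow_one]; ring
  have hZ : struveZ a x = (1 + a) * (r / a) := by rw [struveZ, ← hqr]
  specialize hI r hr1
  specialize hP r hr2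
  have hcc := const_collapse ν a N r ha hr0
  rw [hZ, struveL_split ν a x (r / a) r N ha hx0 hr0 (by positivity) hb hN1 hw]
  set Z : ℝ := (1 + a) * (r / a) with hZdef
  have hZ0 : 0 < Z := by positivity
  set Int := ∫ y : ℝ, Complex.exp (Complex.I * r * y) * (1 + Complex.I * (y : ℂ)) ^ (-(b : ℂ)) *
          mlf c (((r / a : ℝ) : ℂ) * (1 + Complex.I * (y : ℂ)) ^ (-(a : ℂ))) with hInt
  set Po : ℝ := ∑ n ∈ Finset.range N, (r / a * r ^ a) ^ n /
        (Real.Gamma (n + 3 / 2) * Real.Gamma (a * n + ν + 3 / 2)) with hPo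
  set W : ℝ := Real.exp (-(r / a)) * (r / a) ^ (c - 1) * Real.sqrt r * Real.sqrt ((1 + a) / (2 * Real.pi)) with hW
  have hWe : (r / a * r ^ a) ^ N * (Real.exp r * r ^ (1 - b) / (2 * Real.pi)) * Z ^ (ν + 3 / 2) *
      Real.exp (-Z) / A₀ = W := by
    have h1 : Real.exp r * Real.exp (-Z) = Real.exp (-(r / a)) := by
      rw [← Real.exp_add]; congr 1; rw [hZdef]; field_simp; ring
    rw [← hA₀] at hcc
    calc _ = (Real.exp r * Real.exp (-Z)) * ((r / a * r ^ a) ^ N * (r ^ (1 - b) / (2 * Real.pi)) *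
          Z ^ (ν + 3 / 2) / A₀) := by ring
      _ = W := by rw [hcc, h1, hW]; ring
  have hcz : c₁ / Z = k / r := by
    rw [hco, hZdef]; field_simp
  have key : ((Z : ℝ) : ℂ) ^ 2 * (((((r / a * r ^ a) ^ N : ℝ) : ℂ) * ((((Real.exp r * r ^ (1 - b) / (2 * Real.pi) : ℝ) : ℂ)) * Int) + (Po : ℂ)) *
      ((Z ^ (ν + 3 / 2) : ℝ) : ℂ) * (Real.exp (-Z) : ℂ) / (A₀ : ℂ) - 1 - (c₁ : ℂ) / (Z : ℂ)) =
      ((Z ^ 2 : ℝ) : ℂ) * ((W : ℂ) * Int - ((1 + k / r : ℝ) : ℂ)) +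
      ((Z ^ 2 * (Po * Z ^ (ν + 3 / 2) * Real.exp (-Z) / A₀) : ℝ) : ℂ) := by
    rw [← hWe, ← hcz]
    push_cast
    ring
  rw [key]
  refine (norm_add_le _ _).trans (add_le_add ?_ ?_)
  · rw [norm_mul, Complex.norm_real, Real.norm_of_nonneg (by positivity)]
    calc _ ≤ Z ^ 2 * (C / r ^ 2) := by gcongr
      _ = _ := by rw [hZdef]; field_simp
  · rw [Complex.norm_real, Real.norm_eq_abs, abs_mul, abs_of_nonneg (by positivity : 0 ≤ Z ^ 2), abs_div,
      abs_mul, abs_mul, abs_of_pos hA0, abs_of_pos (Real.exp_pos _), abs_of_pos (Real.rpow_pos_of_pos hZ0 _)]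
    exact hP
end

section
/- Let ν and a be real with a > 0. Set κ = 1 + a, h = a^{−a}, A₀ = (κ/a)^{ν+1}/√(2π), Z(x) = κ (h x²/4)^{1/κ}, and define c₁ = −(1/(24a)){11 + 24ν + 12ν² − a(25+24ν) + 11a²}, c₂ = (1/(1152a²)){265 + 1056ν + 1416ν² + 768ν³ + 144ν⁴ − 2a(791 + 2040ν + 1596ν² + 384ν³) + 3a²(905 + 1360ν + 472ν²) − 2a³(791 + 528ν) + 265a⁴}, and c₃ = −(1/(414720a³)){(48703 + 286200ν + 617940ν² + 636480ν³ + 334800ν⁴ + 86400ν⁵ + 8640ν⁶) − 3a(189797 + 791400ν + 1179240ν² + 797760ν³ + 248400ν⁴ + 28800ν⁵) + 6a²(355459 + 1019700ν + 996570ν² + 398880ν³ + 55800ν⁴) − a³(3254507 + 6118200ν + 3537720ν² + 636480ν³) + 6a⁴(355459 + 395700ν + 102990ν²) − 3a⁵(189797 + 95400ν) + 48703a⁶}. Then as x → +∞ through positive real values, (x/2)^{−ν−1} L_ν(x; a) = A₀ Z^{−ν−3/2} e^{Z} (1 + c₁/Z + c₂/Z² + c₃/Z³ + O(Z^{−4})).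 -/
open Filter Topology

section PartA1
open Filter Topology MeasureTheory

lemma laplace_gamma_s11 (β : ℝ) (hβ : 1 < β) (s : ℂ) (hs : 0 < s.re) :
    ∫ t : ℝ in Set.Ioi 0, ((t ^ (β - 1) : ℝ) : ℂ) * Complex.exp (-(s * t)) =
      s ^ (-(β : ℂ)) * (Real.Gamma β : ℂ) := by
  set U : Set ℂ := {s : ℂ | 0 < s.re} with hU
  have hUo : IsOpen U := isOpen_lt continuous_const Complex.continuous_re
  have hUc : Convex ℝ U := convex_halfSpace_re_gt 0
  have hIntg : ∀ (b r : ℝ), 0 < b → 0 < r →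
      IntegrableOn (fun t : ℝ => t ^ (b - 1) * Real.exp (-(r * t))) (Set.Ioi 0) := by
    intro b r hb hr
    have := integrableOn_rpow_mul_exp_neg_mul_rpow (p := 1) (s := b - 1) (b := r) (by linarith) one_pos hr
    simpa using this
  have hmeas : ∀ (b : ℝ) (z : ℂ), AEStronglyMeasurable
      (fun t : ℝ => ((t ^ (b - 1) : ℝ) : ℂ) * Complex.exp (-(z * t))) (volume.restrict (Set.Ioi 0)) := by
    intro b z
    apply Measurable.aestronglyMeasurable
    fun_prop
  have hnorm : ∀ (b : ℝ) (z : ℂ) (t : ℝ), 0 < t →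
      ‖((t ^ (b - 1) : ℝ) : ℂ) * Complex.exp (-(z * t))‖ = t ^ (b - 1) * Real.exp (-(z.re * t)) := by
    intro b z t ht
    rw [norm_mul, Complex.norm_exp, Complex.norm_real, Real.norm_of_nonneg (by positivity)]
    simp
  have hdiff : DifferentiableOn ℂ (fun s : ℂ => ∫ t : ℝ in Set.Ioi 0,
      ((t ^ (β - 1) : ℝ) : ℂ) * Complex.exp (-(s * t))) U := by
    intro z hz
    have hz' : 0 < z.re := hz
    apply DifferentiableAt.differentiableWithinAt
    have hb := hasDerivAt_integral_of_dominated_loc_of_deriv_le (μ := volume.restrict (Set.Ioi (0:ℝ)))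
      (𝕜 := ℂ) (F := fun (s : ℂ) (t : ℝ) => ((t ^ (β - 1) : ℝ) : ℂ) * Complex.exp (-(s * t)))
      (F' := fun (s : ℂ) (t : ℝ) => ((t ^ (β - 1) : ℝ) : ℂ) * (Complex.exp (-(s * t)) * (-t)))
      (x₀ := z) (s := {w : ℂ | z.re / 2 < w.re})
      (bound := fun t : ℝ => t ^ (β + 1 - 1) * Real.exp (-(z.re / 2 * t)))
      ((isOpen_lt continuous_const Complex.continuous_re).mem_nhds (by simp; linarith))
      (Eventually.of_forall fun w => hmeas β w) ?_ ?_ ?_ ?_ ?_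
    · exact hb.2.differentiableAt
    · refine (hIntg β z.re (by linarith) hz').mono' (hmeas β z) ?_
      filter_upwards [self_mem_ae_restrict measurableSet_Ioi] with t ht
      exact (hnorm β z t ht).le
    · apply Measurable.aestronglyMeasurable
      fun_prop
    · filter_upwards [self_mem_ae_restrict measurableSet_Ioi] with t ht
      intro w hw
      have ht' : 0 < t := ht
      have hw' : z.re / 2 < w.re := hw
      rw [← mul_assoc, norm_mul, hnorm β w t ht, norm_neg, Complex.norm_real, Real.norm_of_nonneg ht'.le]
      have : t ^ (β + 1 - 1) = t ^ (β - 1) * t := by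
        rw [show β + 1 - 1 = (β - 1) + 1 by ring, Real.rpow_add_one ht'.ne']
      rw [this]
      have : Real.exp (-(w.re * t)) ≤ Real.exp (-(z.re / 2 * t)) := by
        apply Real.exp_le_exp.mpr; nlinarith
      calc _ = t ^ (β - 1) * t * Real.exp (-(w.re * t)) := by ring
        _ ≤ _ := by gcongr
    · exact hIntg (β + 1) (z.re / 2) (by linarith) (by linarith)
    · filter_upwards with t w hw
      apply HasDerivAt.const_mul
      have : HasDerivAt (fun w : ℂ => -(w * t)) (-(1 * (t:ℂ))) w := ((hasDerivAt_id w).mul_const _).neg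
      have h2 := this.cexp
      simpa using h2
  have hdiff2 : DifferentiableOn ℂ (fun s : ℂ => s ^ (-(β : ℂ)) * (Real.Gamma β : ℂ)) U := by
    intro z hz
    apply DifferentiableAt.differentiableWithinAt
    apply DifferentiableAt.mul_const
    apply DifferentiableAt.cpow_const differentiableAt_id
    exact Or.inl hz
  have h1 := (hdiff.analyticOnNhd hUo).eqOn_of_preconnected_of_frequently_eq (hdiff2.analyticOnNhd hUo)
    hUc.isPreconnected (z₀ := 1) (by simp [hU]) ?_
  · exact h1 hs
  · have hreal : ∀ r : ℝ, 0 < r → ∫ t : ℝ in Set.Ioi 0, ((t ^ (β - 1) : ℝ) : ℂ) * Complex.exp (-((r:ℂ) * t)) =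
      (r:ℂ) ^ (-(β : ℂ)) * (Real.Gamma β : ℂ) := by
      intro r hr
      have := Real.integral_rpow_mul_exp_neg_mul_Ioi (a := β) (r := r) (by linarith) hr
      have h3 : ∫ t : ℝ in Set.Ioi 0, ((t ^ (β - 1) : ℝ) : ℂ) * Complex.exp (-((r:ℂ) * t)) = 
        ∫ t : ℝ in Set.Ioi 0, ((t ^ (β - 1) * Real.exp (-(r * t)) : ℝ) : ℂ) := by
        congr 1; ext t; push_cast; rfl
      rw [h3, integral_complex_ofReal, this]
      rw [one_div, Real.inv_rpow hr.le, ← Real.rpow_neg hr.le, Complex.ofReal_mul, Complex.ofReal_cpow hr.le]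
      push_cast; rfl
    have hseq : Tendsto (fun n : ℕ => ((1 + 1 / ((n : ℝ) + 1) : ℝ) : ℂ)) atTop (𝓝[≠] 1) := by
      apply tendsto_nhdsWithin_of_tendsto_nhds_of_eventually_within
      · have : Tendsto (fun n : ℕ => (1 + 1 / ((n : ℝ) + 1) : ℝ)) atTop (𝓝 (1 + 0)) :=
          tendsto_const_nhds.add tendsto_one_div_add_atTop_nhds_zero_nat
        have h2 := (Complex.continuous_ofReal.tendsto _).comp this
        simpa [Function.comp_def] using h2
      · filter_upwards with n
        simp only [Set.mem_compl_iff, Set.mem_singleton_iff]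
        intro h
        have h3 : (1 + 1 / ((n : ℝ) + 1) : ℝ) = 1 := by exact_mod_cast h
        have : 0 < 1 / ((n : ℝ) + 1) := by positivity
        linarith
    apply hseq.frequently
    apply Eventually.frequently
    filter_upwards with n
    exact hreal _ (by positivity)

end PartA1

section PartA2
open Filter Topology MeasureTheory
open scoped FourierTransform

lemma line_norm_sq (c w : ℝ) : ‖(c : ℂ) + w * Complex.I‖ ^ 2 = c ^ 2 + w ^ 2 := by
  rw [Complex.sq_norm, Complex.normSq_add_mul_I]

lemma line_two_le (w : ℝ) : 2 ≤ ‖(2 : ℂ) + w * Complex.I‖ := by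
  have := line_norm_sq 2 w
  norm_num at this
  nlinarith [norm_nonneg ((2 : ℂ) + w * Complex.I), sq_nonneg w]

lemma cpow_neg_bound {s : ℂ} (hs : 1 ≤ ‖s‖) {β : ℝ} (hβ : 2 ≤ β) :
    ‖s ^ (-(β : ℂ))‖ ≤ (‖s‖ ^ 2)⁻¹ := by
  have h : (-(β : ℂ)) = ((-β : ℝ) : ℂ) := by push_cast; rfl
  rw [h, Complex.norm_cpow_real]
  calc ‖s‖ ^ (-β) ≤ ‖s‖ ^ (-2 : ℝ) := Real.rpow_le_rpow_of_exponent_le hs (by linarith)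
    _ = _ := by rw [Real.rpow_neg (norm_nonneg _)]; norm_num

lemma line_cpow_cont {c : ℝ} (hc : 0 < c) (p : ℂ) :
    Continuous (fun w : ℝ => ((c : ℂ) + w * Complex.I) ^ p) := by
  apply Continuous.cpow (by fun_prop) continuous_const
  intro w
  left; simp [hc]

lemma line_cpow_integrable (β : ℝ) (hβ : 2 ≤ β) :
    Integrable (fun w : ℝ => ((2 : ℂ) + w * Complex.I) ^ (-(β : ℂ))) := by
  refine integrable_inv_one_add_sq.mono' ?_ ?_
  · have := line_cpow_cont (c := 2) (by norm_num) (-(β : ℂ))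
    norm_num at this
    exact this.aestronglyMeasurable
  · filter_upwards with w
    refine (cpow_neg_bound (by linarith [line_two_le w]) hβ).trans ?_
    have := line_norm_sq 2 w
    norm_num at this
    rw [this]
    gcongr; norm_num

lemma gamma_inversion_s11 (β : ℝ) (hβ : 2 ≤ β) (Z : ℝ) (hZ : 0 < Z) :
    ∫ w : ℝ, Complex.exp (((2 : ℂ) + w * Complex.I) * Z) * ((2 : ℂ) + w * Complex.I) ^ (-(β : ℂ)) =
      ((2 * Real.pi * (Z ^ (β - 1) / Real.Gamma β) : ℝ) : ℂ) := by
  have hG : 0 < Real.Gamma β := Real.Gamma_pos_of_pos (by linarith)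
  set f : ℝ → ℂ := (Set.Ioi (0:ℝ)).indicator
    (fun t : ℝ => ((t ^ (β - 1) * Real.exp (-(2 * t)) : ℝ) : ℂ)) with hf
  have hfi : Integrable f := by
    rw [hf, integrable_indicator_iff measurableSet_Ioi]
    have := integrableOn_rpow_mul_exp_neg_mul_rpow (p := 1) (s := β - 1) (b := 2) (by linarith) one_pos two_pos
    have h0 : Integrable (fun t : ℝ => t ^ (β - 1) * Real.exp (-(2 * t))) (volume.restrict (Set.Ioi 0)) := by
      simpa [IntegrableOn] using this
    exact h0.ofReal
  have hF : 𝓕 f = fun w : ℝ => ((2 : ℂ) + (2 * Real.pi * w : ℝ) * Complex.I) ^ (-(β : ℂ)) * (Real.Gamma β : ℂ) := by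
    ext w
    rw [← laplace_gamma_s11 β (by linarith) _ (by simp), Real.fourier_eq', hf, ← integral_indicator measurableSet_Ioi]
    congr 1
    ext t
    by_cases ht : t ∈ Set.Ioi (0:ℝ)
    · simp only [Set.indicator_of_mem ht, smul_eq_mul]
      push_cast
      rw [mul_left_comm, ← Complex.exp_add]
      congr 2
      simp
      ring
    · simp [Set.indicator_of_notMem ht]
  have hFi : Integrable (𝓕 f) := by
    rw [hF]
    exact ((line_cpow_integrable β hβ).comp_mul_left' (R := 2 * Real.pi) (by positivity)).mul_const _
  have hc : ContinuousAt f Z := by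
    have h1 : ContinuousAt (fun t : ℝ => ((t ^ (β - 1) * Real.exp (-(2 * t)) : ℝ) : ℂ)) Z := by
      apply Complex.continuous_ofReal.continuousAt.comp
      apply ContinuousAt.mul (Real.continuousAt_rpow_const _ _ (Or.inl hZ.ne'))
      fun_prop
    apply h1.congr
    filter_upwards [lt_mem_nhds hZ] with t ht
    simp only [hf]
    rw [Set.indicator_of_mem (Set.mem_Ioi.mpr ht)]
  have key := hfi.fourierInv_fourier_eq hFi hc
  rw [Real.fourierInv_eq', hF, hf, Set.indicator_of_mem (Set.mem_Ioi.mpr hZ)] at key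
  set g : ℝ → ℂ := fun w : ℝ => Complex.exp (((2 : ℂ) + w * Complex.I) * Z) * ((2 : ℂ) + w * Complex.I) ^ (-(β : ℂ)) with hg
  have h2 : ∀ w : ℝ, g (2 * Real.pi * w) = Complex.exp (2 * Z) * (Real.Gamma β : ℂ)⁻¹ *
      (Complex.exp (((2 * Real.pi * inner ℝ w Z : ℝ) : ℂ) * Complex.I) • 
        (((2 : ℂ) + (2 * Real.pi * w : ℝ) * Complex.I) ^ (-(β : ℂ)) * (Real.Gamma β : ℂ))) := by
    intro w
    have : (Real.Gamma β : ℂ) ≠ 0 := by exact_mod_cast hG.ne'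
    simp only [hg, smul_eq_mul]
    have e1 : ((2 * Real.pi * w : ℝ) : ℂ) * Complex.I * Z = ((2 * Real.pi * inner ℝ w Z : ℝ) : ℂ) * Complex.I := by
      simp; ring
    rw [add_mul, Complex.exp_add, e1]
    field_simp
  have h3 := Measure.integral_comp_mul_left g (2 * Real.pi)
  simp_rw [h2] at h3
  rw [integral_const_mul, key] at h3
  rw [abs_of_pos (by positivity)] at h3
  have hpi : (Real.pi : ℂ) ≠ 0 := by exact_mod_cast Real.pi_ne_zero
  have hGc : (Real.Gamma β : ℂ) ≠ 0 := by exact_mod_cast hG.ne'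
  have h4 : ∫ w, g w = (2 * Real.pi : ℂ) * ((2 * Real.pi)⁻¹ • ∫ w, g w) := by
    rw [Complex.real_smul]
    push_cast
    field_simp
  rw [h4, ← h3]
  push_cast
  have : Complex.exp (2 * Z) * Complex.exp (-(2 * Z)) = 1 := by
    rw [← Complex.exp_add]; simp
  field_simp
  linear_combination ((Z ^ (β - 1) : ℝ) : ℂ) * this

end PartA2

section PartA3
open Filter Topology MeasureTheory

lemma cpow_neg_lt_one {s : ℂ} (hs : 1 < ‖s‖) {κ : ℝ} (hκ : 0 < κ) : ‖s ^ (-(κ : ℂ))‖ < 1 := by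
  have h : (-(κ : ℂ)) = ((-κ : ℝ) : ℂ) := by push_cast; rfl
  rw [h, Complex.norm_cpow_real]
  exact Real.rpow_lt_one_of_one_lt_of_neg hs (by linarith)

lemma cpow_neg_le_two {s : ℂ} (hs : 2 ≤ ‖s‖) {κ : ℝ} (hκ : 0 < κ) :
    ‖s ^ (-(κ : ℂ))‖ ≤ (2:ℝ) ^ (-κ) := by
  have h : (-(κ : ℂ)) = ((-κ : ℝ) : ℂ) := by push_cast; rfl
  rw [h, Complex.norm_cpow_real]
  exact Real.rpow_le_rpow_of_nonpos (by norm_num) hs (by linarith)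

lemma norm_exp_line (c w Z : ℝ) : ‖Complex.exp (((c : ℂ) + w * Complex.I) * Z)‖ = Real.exp (c * Z) := by
  rw [Complex.norm_exp]
  congr 1
  simp

lemma ml_hasSum (κ β Z : ℝ) (hκ : 0 < κ) (hβ : 2 ≤ β) (hZ : 0 < Z) :
    HasSum (fun n : ℕ => ((2 * Real.pi * (Z ^ (κ * n + β - 1) / Real.Gamma (κ * n + β)) : ℝ) : ℂ))
      (∫ w : ℝ, Complex.exp (((2 : ℂ) + w * Complex.I) * Z) *
        (((2 : ℂ) + w * Complex.I) ^ (-(β : ℂ)) / (1 - ((2 : ℂ) + w * Complex.I) ^ (-(κ : ℂ))))) := by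
  set F : ℕ → ℝ → ℂ := fun n w => Complex.exp (((2 : ℂ) + w * Complex.I) * Z) *
    ((2 : ℂ) + w * Complex.I) ^ (-((κ * n + β : ℝ) : ℂ)) with hF
  have hb : ∀ n : ℕ, 2 ≤ κ * n + β := fun n => by
    have : 0 ≤ κ * n := by positivity
    linarith
  have hsplit : ∀ (n : ℕ) (w : ℝ), F n w = Complex.exp (((2 : ℂ) + w * Complex.I) * Z) *
      (((2 : ℂ) + w * Complex.I) ^ (-(β : ℂ))) * (((2 : ℂ) + w * Complex.I) ^ (-(κ : ℂ))) ^ n := by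
    intro n w
    have hne : (2 : ℂ) + w * Complex.I ≠ 0 := by
      intro h
      have := line_two_le w
      rw [h] at this; norm_num at this
    simp only [hF]
    rw [← Complex.cpow_nat_mul, mul_assoc, ← Complex.cpow_add _ _ hne]
    congr 2
    push_cast; ring
  have hexp : ∀ w : ℝ, ‖Complex.exp (((2 : ℂ) + w * Complex.I) * Z)‖ = Real.exp (2 * Z) := by
    intro w; simpa using norm_exp_line 2 w Z
  have hFint : ∀ n, Integrable (F n) := by
    intro n
    refine ((line_cpow_integrable _ (hb n)).norm.const_mul (Real.exp (2 * Z))).mono' ?_ ?_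
    · apply Continuous.aestronglyMeasurable
      apply Continuous.mul (by fun_prop)
      have := line_cpow_cont (c := 2) (by norm_num) (-((κ * n + β : ℝ) : ℂ))
      norm_num at this ⊢
      exact this
    · filter_upwards with w
      rw [norm_mul, hexp]
  have h2 : (2:ℝ) ^ (-κ) < 1 := Real.rpow_lt_one_of_one_lt_of_neg (by norm_num) (by linarith)
  have h20 : 0 < (2:ℝ) ^ (-κ) := by positivity
  set J := ∫ w : ℝ, ‖((2 : ℂ) + w * Complex.I) ^ (-(β : ℂ))‖ with hJ
  have hsum : Summable fun n => ∫ w, ‖F n w‖ := by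
    refine Summable.of_nonneg_of_le (fun n => integral_nonneg fun w => norm_nonneg _) (fun n => ?_)
      ((summable_geometric_of_lt_one h20.le h2).mul_left (Real.exp (2 * Z) * J))
    rw [hJ, ← integral_const_mul, ← integral_mul_const]
    apply integral_mono (hFint n).norm (((line_cpow_integrable β hβ).norm.const_mul _).mul_const _)
    intro w
    simp only
    rw [hsplit, norm_mul, norm_mul, norm_pow, hexp]
    gcongr
    exact cpow_neg_le_two (line_two_le w) hκ
  have := hasSum_integral_of_summable_integral_norm hFint hsum
  have e1 : (fun n : ℕ => ((2 * Real.pi * (Z ^ (κ * n + β - 1) / Real.Gamma (κ * n + β)) : ℝ) : ℂ)) =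
      fun n => ∫ w, F n w := by
    ext n
    rw [← gamma_inversion_s11 _ (hb n) Z hZ]
  have e2 : (fun w : ℝ => Complex.exp (((2 : ℂ) + w * Complex.I) * Z) *
        (((2 : ℂ) + w * Complex.I) ^ (-(β : ℂ)) / (1 - ((2 : ℂ) + w * Complex.I) ^ (-(κ : ℂ))))) =
      fun w => ∑' n, F n w := by
    ext w
    simp_rw [hsplit]
    rw [tsum_mul_left, tsum_geometric_of_norm_lt_one
      (cpow_neg_lt_one (by linarith [line_two_le w]) hκ)]
    ring
  rw [e1, e2]
  exact this

end PartA3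

section PartA4
open Filter Topology MeasureTheory

/-- Shifting a vertical contour. -/
lemma shift_line (F : ℂ → ℂ) (a b C : ℝ) (hab : a ≤ b)
    (hF : DifferentiableOn ℂ F {s | a ≤ s.re ∧ s.re ≤ b})
    (hB : ∀ s : ℂ, a ≤ s.re → s.re ≤ b → ‖F s‖ ≤ C * (1 + s.im ^ 2)⁻¹) :
    ∫ w : ℝ, F ((a : ℂ) + w * Complex.I) = ∫ w : ℝ, F ((b : ℂ) + w * Complex.I) := by
  have hcont : ∀ c : ℝ, a ≤ c → c ≤ b → Continuous fun w : ℝ => F ((c : ℂ) + w * Complex.I) := by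
    intro c h1 h2
    apply hF.continuousOn.comp_continuous (by fun_prop)
    intro w; simp [h1, h2]
  have hIntg : ∀ c : ℝ, a ≤ c → c ≤ b → Integrable fun w : ℝ => F ((c : ℂ) + w * Complex.I) := by
    intro c h1 h2
    refine (integrable_inv_one_add_sq.const_mul C).mono' (hcont c h1 h2).aestronglyMeasurable ?_
    filter_upwards with w
    have := hB ((c : ℂ) + w * Complex.I) (by simpa using h1) (by simpa using h2)
    simpa using this
  have ha := intervalIntegral_tendsto_integral (hIntg a le_rfl hab) tendsto_neg_atTop_atBot tendsto_id
  have hb := intervalIntegral_tendsto_integral (hIntg b hab le_rfl) tendsto_neg_atTop_atBot tendsto_id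
  have hdecay : Tendsto (fun T : ℝ => C * (1 + T ^ 2)⁻¹ * |b - a|) atTop (𝓝 0) := by
    have : Tendsto (fun T : ℝ => (1 + T ^ 2)⁻¹) atTop (𝓝 0) := by
      apply tendsto_inv_atTop_zero.comp
      apply tendsto_atTop_add_const_left
      exact tendsto_pow_atTop (by norm_num)
    simpa using (this.const_mul C).mul_const |b - a|
  have hh : ∀ ε : ℝ, ε ^ 2 = 1 → Tendsto (fun T : ℝ => ∫ x : ℝ in a..b, F (x + ((ε * T : ℝ) : ℂ) * Complex.I)) atTop (𝓝 0) := by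
    intro ε hε
    apply squeeze_zero_norm _ hdecay
    intro T
    apply intervalIntegral.norm_integral_le_of_norm_le_const
    intro x hx
    rw [Set.uIoc_of_le hab] at hx
    have := hB (x + ((ε * T : ℝ) : ℂ) * Complex.I) (by simpa using hx.1.le) (by simpa using hx.2)
    have h2 : ((x:ℂ) + ((ε * T : ℝ) : ℂ) * Complex.I).im ^ 2 = T ^ 2 := by
      simp [mul_pow, hε]
    rwa [h2] at this
  have hrect : ∀ T : ℝ, (∫ x : ℝ in a..b, F (x + ((-1 * T : ℝ) : ℂ) * Complex.I)) -
      (∫ x : ℝ in a..b, F (x + ((1 * T : ℝ) : ℂ) * Complex.I)) +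
      Complex.I • (∫ y : ℝ in (-T)..(id T), F ((b : ℂ) + y * Complex.I)) -
      Complex.I • (∫ y : ℝ in (-T)..(id T), F ((a : ℂ) + y * Complex.I)) = 0 := by
    intro T
    have := Complex.integral_boundary_rect_eq_zero_of_differentiableOn F ⟨a, -T⟩ ⟨b, T⟩ (hF.mono ?_)
    · simpa using this
    · intro s hs
      rw [Complex.mem_reProdIm] at hs
      have h1 := hs.1
      simp only [Set.uIcc_of_le hab] at h1
      exact h1
  have hlim := (((hh (-1) (by norm_num)).sub (hh 1 (by norm_num))).add (hb.const_smul Complex.I)).sub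
    (ha.const_smul Complex.I)
  have h0 := tendsto_nhds_unique hlim ((tendsto_const_nhds (x := (0:ℂ))).congr fun T => (hrect T).symm)
  simp only [sub_zero, zero_add, smul_eq_mul] at h0
  have h1 : Complex.I * ((∫ w : ℝ, F ((b : ℂ) + w * Complex.I)) - ∫ w : ℝ, F ((a : ℂ) + w * Complex.I)) = 0 := by
    rw [mul_sub]; exact h0
  rcases mul_eq_zero.mp h1 with h | h
  · exact absurd h Complex.I_ne_zero
  · exact (sub_eq_zero.mp h).symm

end PartA4

section PartA5
open Filter Topology MeasureTheory

lemma exp_sub_one_hasSum (Z : ℝ) :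
    HasSum (fun n : ℕ => Z ^ ((1:ℝ) * n + 2 - 1) / Real.Gamma ((1:ℝ) * n + 2)) (Real.exp Z - 1) := by
  have h : HasSum (fun n : ℕ => Z ^ n / (n.factorial : ℝ)) (Real.exp Z) := by
    have := NormedSpace.expSeries_div_hasSum_exp (𝔸 := ℝ) Z
    rwa [← Real.exp_eq_exp_ℝ] at this
  have h1 := (hasSum_nat_add_iff' 1).mpr h
  simp only [Finset.range_one, Finset.sum_singleton, pow_zero, Nat.factorial_zero, Nat.cast_one, div_one] at h1
  have e : (fun n : ℕ => Z ^ ((1:ℝ) * n + 2 - 1) / Real.Gamma ((1:ℝ) * n + 2)) =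
      fun n : ℕ => Z ^ (n + 1) / ((n + 1).factorial : ℝ) := by
    ext n
    have e1 : (1:ℝ) * n + 2 - 1 = ((n + 1 : ℕ) : ℝ) := by push_cast; ring
    have e2 : (1:ℝ) * n + 2 = ((n + 1 : ℕ) : ℝ) + 1 := by push_cast; ring
    rw [e1, e2, Real.Gamma_nat_eq_factorial, Real.rpow_natCast]
  rw [e]
  exact h1

lemma exists_kernel (κ β : ℝ) (hκ : 0 < κ) (hβ : 2 ≤ β) :
    ∃ (H : ℂ → ℂ) (δ C : ℝ), 0 < δ ∧ δ < 1 ∧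
      DifferentiableOn ℂ H {s | 1 - δ ≤ s.re ∧ s.re ≤ 2} ∧
      (∀ s : ℂ, 1 - δ ≤ s.re → s.re ≤ 2 → ‖H s‖ ≤ C * (1 + s.im ^ 2)⁻¹) ∧
      (∀ s : ℂ, 1 - δ ≤ s.re → s ≠ 1 → H s = κ * (s ^ (-(β : ℂ)) / (1 - s ^ (-(κ : ℂ)))) -
        s ^ (-((2 : ℝ) : ℂ)) / (1 - s ^ (-((1 : ℝ) : ℂ)))) := by
  set V : Set ℂ := {s | 0 < s.re} with hV
  have hVo : IsOpen V := isOpen_lt continuous_const Complex.continuous_re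
  have h1V : V ∈ 𝓝 (1:ℂ) := hVo.mem_nhds (by simp [hV])
  have hpow : ∀ p : ℂ, DifferentiableOn ℂ (fun s : ℂ => s ^ p) V := by
    intro p z hz
    apply DifferentiableAt.differentiableWithinAt
    exact DifferentiableAt.cpow_const differentiableAt_id (Or.inl hz)
  set D : ℂ → ℂ := fun s => 1 - s ^ (-(κ : ℂ)) with hD
  have hDd : DifferentiableOn ℂ D V := (differentiableOn_const _).sub (hpow _)
  set q : ℂ → ℂ := dslope D 1 with hq
  have hqd : DifferentiableOn ℂ q V := (Complex.differentiableOn_dslope h1V).mpr hDd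
  have hq1 : q 1 = κ := by
    rw [hq, dslope_same]
    have : HasDerivAt (fun s : ℂ => s ^ (-(κ : ℂ))) (-(κ : ℂ) * 1 ^ (-(κ : ℂ) - 1) * 1) 1 :=
      (hasDerivAt_id (1:ℂ)).cpow_const (c := -(κ : ℂ)) (by simp)
    have h2 : deriv D 1 = -(-(κ : ℂ) * 1 ^ (-(κ : ℂ) - 1) * 1) := (this.const_sub 1).deriv
    rw [h2]
    simp
  have hqne : ∀ s : ℂ, s ≠ 1 → q s = (s - 1)⁻¹ * D s := by
    intro s hs
    rw [hq, dslope_of_ne _ hs, slope_def_field]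
    simp [hD]; ring
  have hκc : (κ : ℂ) ≠ 0 := by exact_mod_cast hκ.ne'
  have hqc : ContinuousAt q 1 := (hqd.differentiableAt h1V).continuousAt
  have hev : ∀ᶠ s in 𝓝 (1:ℂ), q s ≠ 0 := hqc.eventually_ne (by rw [hq1]; exact hκc)
  obtain ⟨r, hr, hball⟩ := Metric.eventually_nhds_iff.mp hev
  set δ : ℝ := min (1 / 4) (r ^ 2 / 4) with hδ
  have hδ0 : 0 < δ := by positivity
  have hδ1 : δ ≤ 1 / 4 := min_le_left _ _
  have hδ2 : δ ≤ r ^ 2 / 4 := min_le_right _ _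
  set U : Set ℂ := {s | 1 - 2 * δ < s.re} with hU
  have hUo : IsOpen U := isOpen_lt continuous_const Complex.continuous_re
  have hUV : U ⊆ V := fun s hs => by
    have : 1 - 2 * δ < s.re := hs
    change 0 < s.re
    linarith
  have h1U : U ∈ 𝓝 (1:ℂ) := hUo.mem_nhds (by simp [hU, hδ0])
  have hqU : ∀ s ∈ U, q s ≠ 0 := by
    intro s hs
    have hs' : 1 - 2 * δ < s.re := hs
    by_cases hd : dist s 1 < r
    · exact hball hd
    · push Not at hd
      have hne : s ≠ 1 := by
        rintro rfl
        simp at hd; linarith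
      have hnorm : 1 < ‖s‖ := by
        by_contra hle
        push Not at hle
        have e1 : ‖s‖ ^ 2 = s.re ^ 2 + s.im ^ 2 := by
          rw [Complex.sq_norm, Complex.normSq_apply]; ring
        have e2 : ‖s - 1‖ ^ 2 = (s.re - 1) ^ 2 + s.im ^ 2 := by
          rw [Complex.sq_norm, Complex.normSq_apply]; simp; ring
        rw [dist_eq_norm] at hd
        have : ‖s‖ ^ 2 ≤ 1 := by nlinarith [norm_nonneg s]
        have : r ^ 2 ≤ ‖s - 1‖ ^ 2 := by gcongr
        nlinarith
      rw [hqne s hne]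
      apply mul_ne_zero (inv_ne_zero (sub_ne_zero.mpr hne))
      intro h0
      have h1 : s ^ (-(κ : ℂ)) = 1 := (sub_eq_zero.mp h0).symm
      have := cpow_neg_lt_one hnorm hκ
      rw [h1] at this
      simp at this
  set N : ℂ → ℂ := fun s => κ * s ^ (-(β : ℂ)) / q s - s ^ (-((1 : ℝ) : ℂ)) with hN
  have hN1 : N 1 = 0 := by
    simp [hN, hq1, hκc]
  have hNd : DifferentiableOn ℂ N U := by
    apply DifferentiableOn.sub
    · exact (((hpow _).mono hUV).const_mul _).div (hqd.mono hUV) hqU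
    · exact (hpow _).mono hUV
  have hHd : DifferentiableOn ℂ (dslope N 1) U := (Complex.differentiableOn_dslope h1U).mpr hNd
  have hform : ∀ s : ℂ, 1 - δ ≤ s.re → s ≠ 1 → dslope N 1 s = κ * (s ^ (-(β : ℂ)) / (1 - s ^ (-(κ : ℂ)))) -
        s ^ (-((2 : ℝ) : ℂ)) / (1 - s ^ (-((1 : ℝ) : ℂ))) := by
    intro s hs hne
    have hs0 : s ≠ 0 := by
      rintro rfl
      simp at hs; linarith
    have hsU : s ∈ U := by
      change 1 - 2 * δ < s.re
      linarith
    have hqs := hqU s hsU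
    rw [hqne s hne] at hqs
    have hDs : D s ≠ 0 := right_ne_zero_of_mul hqs
    have hs1 : s - 1 ≠ 0 := sub_ne_zero.mpr hne
    rw [dslope_of_ne _ hne, slope_def_field, hN1]
    simp only [hN]
    rw [hqne s hne]
    have p1 : s ^ (-((1 : ℝ) : ℂ)) = s⁻¹ := by
      rw [Complex.cpow_neg]; simp
    have p2 : s ^ (-((2 : ℝ) : ℂ)) = (s ^ 2)⁻¹ := by
      rw [Complex.cpow_neg]
      norm_num
    rw [p1, p2]
    change _ = κ * (s ^ (-(β : ℂ)) / D s) - (s ^ 2)⁻¹ / (1 - s⁻¹)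
    have h3 : 1 - s⁻¹ = (s - 1) / s := by field_simp
    rw [h3]
    field_simp
    ring
  have hsub : {s : ℂ | 1 - δ ≤ s.re ∧ s.re ≤ 2} ⊆ U := by
    intro s hs
    change 1 - 2 * δ < s.re
    linarith [hs.1]
  refine ⟨dslope N 1, δ, ?_⟩

  have hK : IsCompact (Set.Icc (1 - δ) 2 ×ℂ Set.Icc (-2) 2) := isCompact_Icc.reProdIm isCompact_Icc
  obtain ⟨M, hM⟩ := hK.exists_bound_of_continuousOn (hHd.continuousOn.mono (by
    intro s hs
    rw [Complex.mem_reProdIm] at hs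
    exact hsub hs.1))
  have h2 : (2:ℝ) ^ (-κ) < 1 := Real.rpow_lt_one_of_one_lt_of_neg (by norm_num) (by linarith)
  have hlow : ∀ (k : ℝ), 0 < k → ∀ s : ℂ, 2 ≤ ‖s‖ → 1 - (2:ℝ) ^ (-k) ≤ ‖1 - s ^ (-(k : ℂ))‖ := by
    intro k hk s hs
    have h := norm_sub_norm_le (1:ℂ) (s ^ (-(k : ℂ)))
    have := cpow_neg_le_two hs hk
    rw [norm_one] at h
    linarith
  have hpos : 0 < 1 - (2:ℝ) ^ (-κ) := by linarith
  set C1 : ℝ := κ / (1 - (2:ℝ) ^ (-κ)) + 2 with hC1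
  have hC1p : 0 < C1 := by positivity
  refine ⟨max (5 * M) (2 * C1), hδ0, by linarith, hHd.mono hsub, ?_, hform⟩
  intro s hs1 hs2
  have hpi : 0 < 1 + s.im ^ 2 := by positivity
  by_cases him : |s.im| ≤ 2
  · have hb := hM s (by
      rw [Complex.mem_reProdIm]
      exact ⟨⟨hs1, hs2⟩, abs_le.mp him⟩)
    have hM0 : 0 ≤ M := (norm_nonneg _).trans hb
    have : s.im ^ 2 ≤ 4 := by
      have := sq_le_sq' (by linarith [abs_nonneg s.im]) him
      rw [sq_abs] at this; linarith
    rw [← div_eq_mul_inv, le_div_iff₀ hpi]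
    calc ‖dslope N 1 s‖ * (1 + s.im ^ 2) ≤ M * 5 := by gcongr; linarith
      _ ≤ _ := by rw [mul_comm]; exact le_max_left _ _
  · push Not at him
    have hn2 : 2 ≤ ‖s‖ := him.le.trans (Complex.abs_im_le_norm s)
    have hne : s ≠ 1 := by
      rintro rfl; norm_num at hn2
    have him4 : 4 ≤ s.im ^ 2 := by
      rw [← sq_abs]; nlinarith
    have hns : s.im ^ 2 ≤ ‖s‖ ^ 2 := by
      rw [Complex.sq_norm, Complex.normSq_apply]; nlinarith [sq_nonneg s.re]
    rw [hform s hs1 hne]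
    have b1 := cpow_neg_bound (s := s) (by linarith) hβ
    have b2 := cpow_neg_bound (s := s) (by linarith) (le_refl (2:ℝ))
    have l1 := hlow κ hκ s hn2
    have l2 := hlow 1 one_pos s hn2
    have l2' : (1:ℝ) / 2 ≤ ‖1 - s ^ (-((1:ℝ) : ℂ))‖ := by
      refine le_trans ?_ l2
      rw [Real.rpow_neg_one]; norm_num
    have hs2i : (‖s‖ ^ 2)⁻¹ ≤ 2 * (1 + s.im ^ 2)⁻¹ := by
      rw [← div_eq_mul_inv, inv_eq_one_div, div_le_div_iff₀ (by positivity) hpi]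
      linarith
    calc _ ≤ ‖(κ:ℂ) * (s ^ (-(β : ℂ)) / (1 - s ^ (-(κ : ℂ))))‖ + ‖s ^ (-((2 : ℝ) : ℂ)) / (1 - s ^ (-((1 : ℝ) : ℂ)))‖ := norm_sub_le _ _
      _ ≤ κ * ((‖s‖ ^ 2)⁻¹ / (1 - (2:ℝ) ^ (-κ))) + (‖s‖ ^ 2)⁻¹ / (1 / 2) := by
        rw [norm_mul, norm_div, norm_div, Complex.norm_real, Real.norm_of_nonneg hκ.le]
        gcongr
      _ = C1 * (‖s‖ ^ 2)⁻¹ := by rw [hC1]; ring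
      _ ≤ C1 * (2 * (1 + s.im ^ 2)⁻¹) := by gcongr
      _ = (2 * C1) * (1 + s.im ^ 2)⁻¹ := by ring
      _ ≤ _ := by gcongr; exact le_max_right _ _

lemma ml_summable (κ β Z : ℝ) (hκ : 0 < κ) (hβ : 2 ≤ β) (hZ : 0 < Z) :
    Summable (fun n : ℕ => Z ^ (κ * n + β - 1) / Real.Gamma (κ * n + β)) := by
  have h := (ml_hasSum κ β Z hκ hβ hZ).summable
  have h2 : Summable (fun n : ℕ => (2 * Real.pi * (Z ^ (κ * n + β - 1) / Real.Gamma (κ * n + β)) : ℝ)) :=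
    Complex.summable_ofReal.mp h
  exact (summable_mul_left_iff (by positivity)).mp h2

/-- Mittag-Leffler type asymptotics on the positive axis. -/
lemma ml_asymp (κ β : ℝ) (hκ : 0 < κ) (hβ : 2 ≤ β) :
    ∃ C δ : ℝ, 0 < δ ∧ ∀ Z : ℝ, 0 < Z →
      |κ * ∑' n : ℕ, Z ^ (κ * n + β - 1) / Real.Gamma (κ * n + β) - (Real.exp Z - 1)| ≤
        C * Real.exp ((1 - δ) * Z) := by
  obtain ⟨H, δ, C, hδ0, hδ1, hHd, hHb, hHf⟩ := exists_kernel κ β hκ hβ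
  refine ⟨(2 * Real.pi)⁻¹ * (C * ∫ w : ℝ, (1 + w ^ 2)⁻¹), δ, hδ0, ?_⟩
  intro Z hZ
  have s1 := ml_hasSum κ β Z hκ hβ hZ
  have s2 := ml_hasSum 1 2 Z one_pos le_rfl hZ
  set S := ∑' n : ℕ, Z ^ (κ * n + β - 1) / Real.Gamma (κ * n + β) with hS
  have t1 : HasSum (fun n : ℕ => ((2 * Real.pi * (Z ^ (κ * n + β - 1) / Real.Gamma (κ * n + β)) : ℝ) : ℂ))
      ((2 * Real.pi * S : ℝ) : ℂ) :=
    Complex.hasSum_ofReal.mpr ((ml_summable κ β Z hκ hβ hZ).hasSum.mul_left _)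
  have t2 : HasSum (fun n : ℕ => ((2 * Real.pi * (Z ^ ((1:ℝ) * n + 2 - 1) / Real.Gamma ((1:ℝ) * n + 2)) : ℝ) : ℂ))
      ((2 * Real.pi * (Real.exp Z - 1) : ℝ) : ℂ) :=
    Complex.hasSum_ofReal.mpr ((exp_sub_one_hasSum Z).mul_left _)
  have i1 := s1.unique t1
  have i2 := s2.unique t2
  have hkey : ∫ w : ℝ, Complex.exp (((2 : ℝ) + w * Complex.I) * Z) * H ((2 : ℝ) + w * Complex.I) =
      ((2 * Real.pi * (κ * S - (Real.exp Z - 1)) : ℝ) : ℂ) := by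
    have hi : ∀ (k b : ℝ), 0 < k → 2 ≤ b → Integrable (fun w : ℝ => Complex.exp (((2 : ℂ) + w * Complex.I) * Z) *
        (((2 : ℂ) + w * Complex.I) ^ (-(b : ℂ)) / (1 - ((2 : ℂ) + w * Complex.I) ^ (-(k : ℂ))))) := by
      intro k b hk hb
      by_contra hni
      have := integral_undef hni
      have s1 := ml_hasSum k b Z hk hb hZ
      have t1 : HasSum (fun n : ℕ => ((2 * Real.pi * (Z ^ (k * n + b - 1) / Real.Gamma (k * n + b)) : ℝ) : ℂ))
        ((2 * Real.pi * ∑' n : ℕ, Z ^ (k * n + b - 1) / Real.Gamma (k * n + b) : ℝ) : ℂ) :=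
        Complex.hasSum_ofReal.mpr ((ml_summable k b Z hk hb hZ).hasSum.mul_left _)
      have h0 := t1.unique s1
      rw [this] at h0
      have hpos : 0 < ∑' n : ℕ, Z ^ (k * n + b - 1) / Real.Gamma (k * n + b) := by
        apply (ml_summable k b Z hk hb hZ).tsum_pos _ 0
        · have : 0 < Real.Gamma (k * (0:ℕ) + b) := Real.Gamma_pos_of_pos (by simp; linarith)
          positivity
        · intro n
          have : 0 < Real.Gamma (k * n + b) := Real.Gamma_pos_of_pos (by
            have : 0 ≤ k * n := by positivity
            linarith)
          positivity
      have h1 : 2 * Real.pi * ∑' n : ℕ, Z ^ (k * n + b - 1) / Real.Gamma (k * n + b) = 0 := by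
        exact_mod_cast h0
      have : 0 < 2 * Real.pi * ∑' n : ℕ, Z ^ (k * n + b - 1) / Real.Gamma (k * n + b) := by positivity
      linarith
    have e : (fun w : ℝ => Complex.exp (((2 : ℝ) + w * Complex.I) * Z) * H ((2 : ℝ) + w * Complex.I)) =
        fun w : ℝ => κ * (Complex.exp (((2 : ℂ) + w * Complex.I) * Z) *
        (((2 : ℂ) + w * Complex.I) ^ (-(β : ℂ)) / (1 - ((2 : ℂ) + w * Complex.I) ^ (-(κ : ℂ))))) -
        Complex.exp (((2 : ℂ) + w * Complex.I) * Z) *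
        (((2 : ℂ) + w * Complex.I) ^ (-((2:ℝ) : ℂ)) / (1 - ((2 : ℂ) + w * Complex.I) ^ (-((1:ℝ) : ℂ)))) := by
      ext w
      rw [hHf]
      · push_cast; ring
      · simp; linarith
      · intro h
        have := congrArg Complex.re h
        norm_num at this
    rw [e, integral_sub ((hi κ β hκ hβ).const_mul _) (hi 1 2 one_pos le_rfl), integral_const_mul, i1, i2]
    push_cast; ring
  have hshift : ∫ w : ℝ, Complex.exp ((((1 - δ : ℝ) : ℂ) + w * Complex.I) * Z) * H (((1 - δ : ℝ) : ℂ) + w * Complex.I) =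
      ∫ w : ℝ, Complex.exp (((2 : ℝ) + w * Complex.I) * Z) * H ((2 : ℝ) + w * Complex.I) := shift_line (fun s => Complex.exp (s * Z) * H s) (1 - δ) 2 (Real.exp (2 * Z) * C) (by linarith) ?_ ?_
  · rw [hkey] at hshift
    have hnorm : ‖∫ w : ℝ, Complex.exp ((((1 - δ : ℝ) : ℂ) + w * Complex.I) * Z) * H (((1 - δ : ℝ) : ℂ) + w * Complex.I)‖ ≤
        ∫ w : ℝ, (Real.exp ((1 - δ) * Z) * C) * (1 + w ^ 2)⁻¹ := by
      apply norm_integral_le_of_norm_le (integrable_inv_one_add_sq.const_mul _)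
      filter_upwards with w
      rw [norm_mul, norm_exp_line, mul_assoc]
      gcongr
      have := hHb (((1 - δ : ℝ) : ℂ) + w * Complex.I) (by simp) (by simp; linarith)
      simpa using this
    rw [hshift, Complex.norm_real, Real.norm_eq_abs, abs_mul, abs_of_pos (by positivity), integral_const_mul] at hnorm
    have hp : 0 < 2 * Real.pi := by positivity
    rw [← mul_le_mul_iff_right₀ hp]
    refine hnorm.trans (le_of_eq ?_)
    field_simp
  · apply DifferentiableOn.mul _ hHd
    fun_prop
  · intro s h1 h2
    rw [norm_mul, mul_assoc]
    have hC : 0 ≤ C * (1 + s.im ^ 2)⁻¹ := (norm_nonneg _).trans (hHb s h1 h2)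
    have : ‖Complex.exp (s * Z)‖ ≤ Real.exp (2 * Z) := by
      rw [Complex.norm_exp]
      apply Real.exp_le_exp.mpr
      simp
      gcongr
    exact mul_le_mul this (hHb s h1 h2) (norm_nonneg _) (Real.exp_pos _).le

end PartA5

section PartB1
open Filter Topology

noncomputable def stE1 (β : ℝ) : ℝ := β ^ 2 / 2 - β / 2 + 1 / 12
noncomputable def stE2 (β : ℝ) : ℝ := -(β ^ 3 - 3 / 2 * β ^ 2 + β / 2) / 6
noncomputable def stE3 (β : ℝ) : ℝ := (β ^ 4 - 2 * β ^ 3 + β ^ 2 - 1 / 30) / 12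

noncomputable def stS (β x : ℝ) : ℝ :=
  (x + β - 1 / 2) * Real.log x - x + Real.log (2 * Real.pi) / 2
    + (stE1 β * x⁻¹ + stE2 β * x⁻¹ ^ 2 + stE3 β * x⁻¹ ^ 3)

lemma gamma_tendsto (y : ℝ) (hy : 0 < y) :
    Tendsto (fun n : ℕ => Real.log (Real.Gamma (y + n + 1)) -
      ((n + y + 1 / 2) * Real.log n - n + Real.log (2 * Real.pi) / 2)) atTop (𝓝 0) := by
  have h1 := Real.BohrMollerup.tendsto_log_gamma hy
  have h2 : Tendsto (fun n => Real.log (Stirling.stirlingSeq n)) atTop (𝓝 (Real.log (√Real.pi))) :=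
    (Real.continuousAt_log (by positivity)).tendsto.comp Stirling.tendsto_stirlingSeq_sqrt_pi
  have h3 := (h2.sub h1).add_const (Real.log (Real.Gamma y) - Real.log (√Real.pi))
  have e0 : Real.log (√Real.pi) - Real.log (Real.Gamma y) + (Real.log (Real.Gamma y) - Real.log (√Real.pi)) = 0 := by ring
  rw [e0] at h3
  apply h3.congr'
  filter_upwards [eventually_gt_atTop 0] with n hn
  have hn' : (0:ℝ) < n := by exact_mod_cast hn
  have hf : Real.log (Real.Gamma (y + n + 1)) = Real.log (Real.Gamma y) +
      ∑ m ∈ Finset.range (n + 1), Real.log (y + m) := by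
    have := Real.BohrMollerup.f_add_nat_eq (f := Real.log ∘ Real.Gamma) (x := y) (fun {z} hz => by
      simp only [Function.comp]
      rw [Real.Gamma_add_one hz.ne', Real.log_mul hz.ne' (Real.Gamma_pos_of_pos hz).ne', add_comm]) hy (n + 1)
    simp only [Function.comp] at this
    rw [← this]; push_cast; ring_nf
  rw [hf, Stirling.log_stirlingSeq_formula, Real.BohrMollerup.logGammaSeq,
    Real.log_div hn'.ne' (Real.exp_pos 1).ne', Real.log_exp, Real.log_mul (by norm_num) hn'.ne',
    Real.log_sqrt Real.pi_pos.le, Real.log_mul (by norm_num) Real.pi_pos.ne']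
  ring

lemma stD_tendsto (β x : ℝ) (hx : |β| + 2 ≤ x) :
    Tendsto (fun n : ℕ => Real.log (Real.Gamma (x + n + β)) - stS β (x + n)) atTop (𝓝 0) := by
  have hb := neg_abs_le β
  have hx0 : 0 < x := by linarith [abs_nonneg β]
  have h1 := gamma_tendsto (x + β - 1) (by linarith)
  have hl : Tendsto (fun n : ℕ => (n:ℝ) * Real.log (1 + x / n)) atTop (𝓝 x) :=
    (Real.tendsto_mul_log_one_add_div_atTop x).comp tendsto_natCast_atTop_atTop
  have hd : Tendsto (fun n : ℕ => x / (n:ℝ)) atTop (𝓝 0) :=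
    tendsto_const_nhds.div_atTop tendsto_natCast_atTop_atTop
  have hl2 : Tendsto (fun n : ℕ => Real.log (1 + x / n)) atTop (𝓝 0) := by
    have h : Tendsto (fun n : ℕ => 1 + x / (n:ℝ)) atTop (𝓝 (1 + 0)) := tendsto_const_nhds.add hd
    have := (Real.continuousAt_log (x := 1 + 0) (by norm_num)).tendsto.comp h
    simpa [Function.comp_def] using this
  have hi : Tendsto (fun n : ℕ => (x + (n:ℝ))⁻¹) atTop (𝓝 0) :=
    tendsto_inv_atTop_zero.comp (tendsto_atTop_add_const_left _ _ tendsto_natCast_atTop_atTop)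
  have hE : Tendsto (fun n : ℕ => stE1 β * (x + (n:ℝ))⁻¹ + stE2 β * (x + (n:ℝ))⁻¹ ^ 2 + stE3 β * (x + (n:ℝ))⁻¹ ^ 3) atTop (𝓝 0) := by
    have := ((hi.const_mul (stE1 β)).add ((hi.pow 2).const_mul (stE2 β))).add ((hi.pow 3).const_mul (stE3 β))
    simpa using this
  have h2 := ((h1.sub (hl.add (hl2.const_mul (x + β - 1 / 2)))).sub hE).add_const x
  have e0 : 0 - (x + (x + β - 1 / 2) * 0) - 0 + x = 0 := by ring
  rw [e0] at h2
  apply h2.congr'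
  filter_upwards [eventually_gt_atTop 0] with n hn
  have hn' : (0:ℝ) < n := by exact_mod_cast hn
  have e1 : Real.log (x + n) = Real.log n + Real.log (1 + x / n) := by
    rw [← Real.log_mul hn'.ne' (by positivity)]
    congr 1; field_simp; ring
  have e2 : x + β - 1 + n + 1 = x + n + β := by ring
  rw [stS, e1, e2]
  ring

lemma log_taylor4 (t : ℝ) (ht : |t| ≤ 1 / 2) :
    |Real.log (1 + t) - (t - t ^ 2 / 2 + t ^ 3 / 3 - t ^ 4 / 4)| ≤ 2 * |t| ^ 5 := by
  have h := Real.abs_log_sub_add_sum_range_le (x := -t) (by rw [abs_neg]; linarith) 4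
  simp only [Finset.sum_range_succ, Finset.sum_range_zero, abs_neg, sub_neg_eq_add] at h
  norm_num at h
  have h2 : |t| ^ 5 / (1 - |t|) ≤ 2 * |t| ^ 5 := by
    rw [div_le_iff₀ (by linarith)]
    nlinarith [pow_nonneg (abs_nonneg t) 5]
  refine le_trans (le_of_eq ?_) (h.trans h2)
  congr 1; ring

lemma log_taylor5 (t : ℝ) (ht : |t| ≤ 1 / 2) :
    |Real.log (1 + t) - (t - t ^ 2 / 2 + t ^ 3 / 3 - t ^ 4 / 4 + t ^ 5 / 5)| ≤ 2 * |t| ^ 6 := by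
  have h := Real.abs_log_sub_add_sum_range_le (x := -t) (by rw [abs_neg]; linarith) 5
  simp only [Finset.sum_range_succ, Finset.sum_range_zero, abs_neg, sub_neg_eq_add] at h
  norm_num at h
  have h2 : |t| ^ 6 / (1 - |t|) ≤ 2 * |t| ^ 6 := by
    rw [div_le_iff₀ (by linarith)]
    nlinarith [pow_nonneg (abs_nonneg t) 6]
  refine le_trans (le_of_eq ?_) (h.trans h2)
  congr 1; ring

set_option maxHeartbeats 1000000 in
lemma stD_step (β : ℝ) : ∃ C : ℝ, 0 ≤ C ∧ ∀ x : ℝ, 2 * |β| + 2 ≤ x →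
    |(Real.log (Real.Gamma (x + β)) - stS β x) - (Real.log (Real.Gamma (x + 1 + β)) - stS β (x + 1))| ≤ C * x⁻¹ ^ 5 := by
  refine ⟨2 * |β| ^ 5 + 2 + |β + 1 / 2| * 2 + |(β + 1 / 2) / 5| + |stE1 β| + |stE2 β| * 7 + |stE3 β| * 17, by positivity, ?_⟩
  intro x hx
  have hb0 := abs_nonneg β
  have hb := neg_abs_le β
  have hx0 : 0 < x := by linarith
  have hxb : 0 < x + β := by linarith
  set u := x⁻¹ with hu
  have hu0 : 0 < u := by positivity
  have hxu : x = u⁻¹ := by rw [hu, inv_inv]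
  have hu2 : u ≤ 1 / 2 := by
    rw [hu, inv_le_comm₀ hx0 (by norm_num)]; linarith
  have hbu : |β * u| ≤ 1 / 2 := by
    rw [abs_mul, abs_of_pos hu0, hu, ← div_eq_mul_inv, div_le_iff₀ hx0]; linarith
  have l1 := log_taylor4 (β * u) hbu
  have l2 := log_taylor5 u (by rwa [abs_of_pos hu0])
  set L1 := Real.log (1 + β * u) - (β * u - (β * u) ^ 2 / 2 + (β * u) ^ 3 / 3 - (β * u) ^ 4 / 4) with hL1
  set L2 := Real.log (1 + u) - (u - u ^ 2 / 2 + u ^ 3 / 3 - u ^ 4 / 4 + u ^ 5 / 5) with hL2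
  have g1 : Real.log (Real.Gamma (x + 1 + β)) = Real.log (x + β) + Real.log (Real.Gamma (x + β)) := by
    rw [show x + 1 + β = (x + β) + 1 by ring, Real.Gamma_add_one hxb.ne',
      Real.log_mul hxb.ne' (Real.Gamma_pos_of_pos hxb).ne']
  have g2 : Real.log (x + β) = Real.log x + Real.log (1 + β * u) := by
    have hne : 1 + β * u ≠ 0 := by
      have : 1 + β * u = (x + β) / x := by rw [hu]; field_simp
      rw [this]; positivity
    rw [← Real.log_mul hx0.ne' hne]
    congr 1; rw [hu]; field_simp
  have g3 : Real.log (x + 1) = Real.log x + Real.log (1 + u) := by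
    rw [← Real.log_mul hx0.ne' (by positivity)]
    congr 1; rw [hu]; field_simp
  have g4 : (x + 1)⁻¹ = u / (1 + u) := by
    rw [hxu]; field_simp
  have hid : (Real.log (Real.Gamma (x + β)) - stS β x) - (Real.log (Real.Gamma (x + 1 + β)) - stS β (x + 1)) =
      -L1 + u⁻¹ * L2 + (β + 1 / 2) * L2 + (β + 1 / 2) / 5 * u ^ 5 + stE1 β * (u ^ 5 / (1 + u))
        + stE2 β * (-(u ^ 5 * (4 + 3 * u) / (1 + u) ^ 2)) + stE3 β * (u ^ 5 * (6 + 8 * u + 3 * u ^ 2) / (1 + u) ^ 3) := by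
    have r1 : u / (1 + u) - u = u ^ 5 / (1 + u) + (- u ^ 2 + u ^ 3 - u ^ 4) := by
      field_simp; ring
    have r2 : (u / (1 + u)) ^ 2 - u ^ 2 = -(u ^ 5 * (4 + 3 * u) / (1 + u) ^ 2) + (-2 * u ^ 3 + 3 * u ^ 4) := by
      field_simp; ring
    have r3 : (u / (1 + u)) ^ 3 - u ^ 3 = u ^ 5 * (6 + 8 * u + 3 * u ^ 2) / (1 + u) ^ 3 + (-3 * u ^ 4) := by
      field_simp; ring
    have r4 : x * Real.log (1 + u) = u⁻¹ * L2 + (1 - u / 2 + u ^ 2 / 3 - u ^ 3 / 4 + u ^ 4 / 5) := by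
      rw [hL2, hxu]; field_simp; ring
    have e1 : Real.log (1 + β * u) = L1 + (β * u - (β * u) ^ 2 / 2 + (β * u) ^ 3 / 3 - (β * u) ^ 4 / 4) := by
      rw [hL1]; ring
    have e2 : Real.log (1 + u) = L2 + (u - u ^ 2 / 2 + u ^ 3 / 3 - u ^ 4 / 4 + u ^ 5 / 5) := by
      rw [hL2]; ring
    rw [g1, g2, stS, stS, g3, g4, ← hu]
    have : (x + 1 + β - 1 / 2) * (Real.log x + Real.log (1 + u)) = (x + 1 + β - 1 / 2) * Real.log x +
      (x * Real.log (1 + u) + (β + 1 / 2) * Real.log (1 + u)) := by ring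
    rw [this, r4, e1, e2]
    linear_combination stE1 β * r1 + stE2 β * r2 + stE3 β * r3 +
      (by rw [stE1, stE2, stE3]; ring : (-(β * u - (β * u) ^ 2 / 2 + (β * u) ^ 3 / 3 - (β * u) ^ 4 / 4)
        + (1 - u / 2 + u ^ 2 / 3 - u ^ 3 / 4 + u ^ 4 / 5) + (β + 1 / 2) * (u - u ^ 2 / 2 + u ^ 3 / 3 - u ^ 4 / 4 + u ^ 5 / 5)
        - 1 + stE1 β * (- u ^ 2 + u ^ 3 - u ^ 4) + stE2 β * (-2 * u ^ 3 + 3 * u ^ 4) + stE3 β * (-3 * u ^ 4)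
        = (β + 1 / 2) / 5 * u ^ 5))
  rw [hid]
  have hu1 : 1 ≤ 1 + u := by linarith
  have hu5 : 0 < u ^ 5 := by positivity
  have b1 : |-L1| ≤ 2 * |β| ^ 5 * u ^ 5 := by
    rw [abs_neg]
    refine l1.trans (le_of_eq ?_)
    rw [abs_mul, abs_of_pos hu0]; ring
  have b2 : |u⁻¹ * L2| ≤ 2 * u ^ 5 := by
    rw [abs_mul, abs_of_pos (inv_pos.mpr hu0), inv_mul_le_iff₀ hu0]
    refine l2.trans (le_of_eq ?_)
    rw [abs_of_pos hu0]; ring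
  have b3 : |(β + 1 / 2) * L2| ≤ |β + 1 / 2| * 2 * u ^ 5 := by
    rw [abs_mul, mul_assoc]
    gcongr
    refine l2.trans ?_
    rw [abs_of_pos hu0]
    have : u ^ 6 ≤ u ^ 5 := pow_le_pow_of_le_one hu0.le (by linarith) (by norm_num)
    linarith
  have b4 : |(β + 1 / 2) / 5 * u ^ 5| ≤ |(β + 1 / 2) / 5| * u ^ 5 := by
    rw [abs_mul, abs_of_pos hu5]
  have b5 : |stE1 β * (u ^ 5 / (1 + u))| ≤ |stE1 β| * u ^ 5 := by
    rw [abs_mul, abs_of_pos (by positivity : 0 < u ^ 5 / (1 + u))]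
    gcongr
    exact div_le_self hu5.le hu1
  have b6 : |stE2 β * (-(u ^ 5 * (4 + 3 * u) / (1 + u) ^ 2))| ≤ |stE2 β| * 7 * u ^ 5 := by
    rw [abs_mul, abs_neg, abs_of_pos (by positivity : 0 < u ^ 5 * (4 + 3 * u) / (1 + u) ^ 2), mul_assoc]
    gcongr
    refine (div_le_self (by positivity) (one_le_pow₀ hu1)).trans ?_
    rw [mul_comm (7:ℝ)]
    exact mul_le_mul_of_nonneg_left (by linarith) hu5.le
  have b7 : |stE3 β * (u ^ 5 * (6 + 8 * u + 3 * u ^ 2) / (1 + u) ^ 3)| ≤ |stE3 β| * 17 * u ^ 5 := by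
    rw [abs_mul, abs_of_pos (by positivity : 0 < u ^ 5 * (6 + 8 * u + 3 * u ^ 2) / (1 + u) ^ 3), mul_assoc]
    gcongr
    refine (div_le_self (by positivity) (one_le_pow₀ hu1)).trans ?_
    have : 6 + 8 * u + 3 * u ^ 2 ≤ 17 := by nlinarith
    rw [mul_comm (17:ℝ)]
    exact mul_le_mul_of_nonneg_left this hu5.le
  calc _ ≤ |-L1| + |u⁻¹ * L2| + |(β + 1 / 2) * L2| + |(β + 1 / 2) / 5 * u ^ 5| + |stE1 β * (u ^ 5 / (1 + u))|
        + |stE2 β * (-(u ^ 5 * (4 + 3 * u) / (1 + u) ^ 2))| + |stE3 β * (u ^ 5 * (6 + 8 * u + 3 * u ^ 2) / (1 + u) ^ 3)| := by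
        refine (abs_add_le _ _).trans ?_; gcongr
        refine (abs_add_le _ _).trans ?_; gcongr
        refine (abs_add_le _ _).trans ?_; gcongr
        refine (abs_add_le _ _).trans ?_; gcongr
        refine (abs_add_le _ _).trans ?_; gcongr
        exact abs_add_le _ _
    _ ≤ _ := by linarith

lemma stirling_gamma (β : ℝ) : ∃ C : ℝ, 0 ≤ C ∧ ∀ x : ℝ, 2 * |β| + 2 ≤ x →
    |Real.log (Real.Gamma (x + β)) - stS β x| ≤ C * x⁻¹ ^ 4 := by
  obtain ⟨C, hC, hstep⟩ := stD_step β
  refine ⟨4 * C, by positivity, ?_⟩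
  intro x hx
  have hb0 := abs_nonneg β
  set D : ℕ → ℝ := fun n => Real.log (Real.Gamma (x + n + β)) - stS β (x + n) with hD
  set P : ℕ → ℝ := fun n => 4 * C * (x + n)⁻¹ ^ 4 with hP
  have hDl : Tendsto D atTop (𝓝 0) := stD_tendsto β x (by linarith)
  have hPl : Tendsto P atTop (𝓝 0) := by
    have hi : Tendsto (fun n : ℕ => (x + (n:ℝ))⁻¹) atTop (𝓝 0) :=
      tendsto_inv_atTop_zero.comp (tendsto_atTop_add_const_left _ _ tendsto_natCast_atTop_atTop)
    have h4 := (hi.pow 4).const_mul (4 * C)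
    rw [show 4 * C * (0:ℝ) ^ 4 = 0 by ring] at h4
    exact h4
  have hst : ∀ n, |D n - D (n + 1)| ≤ P n - P (n + 1) := by
    intro n
    have hy : 2 * |β| + 2 ≤ x + n := by
      have : (0:ℝ) ≤ n := Nat.cast_nonneg n
      linarith
    have h := hstep (x + n) hy
    simp only [hD, hP]
    push_cast
    rw [← add_assoc]
    refine h.trans ?_
    set y := x + (n:ℝ) with hyd
    have hy1 : 1 ≤ y := by linarith
    have hy0 : 0 < y := by linarith
    have : y⁻¹ ^ 5 ≤ 4 * (y⁻¹ ^ 4 - (y + 1)⁻¹ ^ 4) := by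
      have e : 4 * (y⁻¹ ^ 4 - (y + 1)⁻¹ ^ 4) - y⁻¹ ^ 5 =
        (4 * y * ((y + 1) ^ 4 - y ^ 4) - (y + 1) ^ 4) / (y ^ 5 * (y + 1) ^ 4) := by
        field_simp
      have : 0 ≤ 4 * y * ((y + 1) ^ 4 - y ^ 4) - (y + 1) ^ 4 := by
        have : 4 * y * ((y + 1) ^ 4 - y ^ 4) - (y + 1) ^ 4 = 15 * y ^ 4 + 20 * y ^ 3 + 10 * y ^ 2 - 1 := by ring
        rw [this]
        have : 1 ≤ y ^ 2 := one_le_pow₀ hy1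
        have : 0 ≤ 15 * y ^ 4 + 20 * y ^ 3 := by positivity
        linarith
      have : 0 ≤ 4 * (y⁻¹ ^ 4 - (y + 1)⁻¹ ^ 4) - y⁻¹ ^ 5 := by rw [e]; positivity
      linarith
    calc C * y⁻¹ ^ 5 ≤ C * (4 * (y⁻¹ ^ 4 - (y + 1)⁻¹ ^ 4)) := by gcongr
      _ = _ := by ring
  have m1 : Monotone (fun n => D n - P n) := monotone_nat_of_le_succ fun n => by
    have := (abs_le.mp (hst n)).2
    linarith
  have m2 : Monotone (fun n => -D n - P n) := monotone_nat_of_le_succ fun n => by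
    have := (abs_le.mp (hst n)).1
    linarith
  have k1 := m1.ge_of_tendsto (by simpa using hDl.sub hPl) 0
  have k2 := m2.ge_of_tendsto (by simpa using hDl.neg.sub hPl) 0
  simp only [hD, hP, Nat.cast_zero, add_zero] at k1 k2
  rw [abs_le]
  constructor <;> linarith

end PartB1

section PartC1
open Filter Topology Asymptotics

noncomputable def sqQ (f : ℝ → ℝ) (i : ℕ) (ν a : ℝ) : ℝ :=
  f (ν + 5 / 2) / (1 + a) ^ i - f (3 / 2) - f (ν + 3 / 2) / a ^ i

lemma coef1 (ν a : ℝ) (ha : 0 < a) : -(1 / (24 * a)) *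
      (11 + 24 * ν + 12 * ν ^ 2 - a * (25 + 24 * ν) + 11 * a ^ 2) = (1 + a) * sqQ stE1 1 ν a := by
  have : 1 + a ≠ 0 := by positivity
  simp only [sqQ, stE1]
  field_simp
  ring

lemma coef2 (ν a : ℝ) (ha : 0 < a) : 1 / (1152 * a ^ 2) *
      (265 + 1056 * ν + 1416 * ν ^ 2 + 768 * ν ^ 3 + 144 * ν ^ 4
        - 2 * a * (791 + 2040 * ν + 1596 * ν ^ 2 + 384 * ν ^ 3)
        + 3 * a ^ 2 * (905 + 1360 * ν + 472 * ν ^ 2)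
        - 2 * a ^ 3 * (791 + 528 * ν) + 265 * a ^ 4) =
     (1 + a) ^ 2 * (sqQ stE2 2 ν a + sqQ stE1 1 ν a ^ 2 / 2) + (-(1 / (24 * a)) *
      (11 + 24 * ν + 12 * ν ^ 2 - a * (25 + 24 * ν) + 11 * a ^ 2)) * (ν + 5 / 2) := by
  have : 1 + a ≠ 0 := by positivity
  simp only [sqQ, stE1, stE2]
  field_simp
  ring

lemma coef3 (ν a : ℝ) (ha : 0 < a) : -(1 / (414720 * a ^ 3)) *
      ((48703 + 286200 * ν + 617940 * ν ^ 2 + 636480 * ν ^ 3 + 334800 * ν ^ 4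
          + 86400 * ν ^ 5 + 8640 * ν ^ 6)
        - 3 * a * (189797 + 791400 * ν + 1179240 * ν ^ 2 + 797760 * ν ^ 3
          + 248400 * ν ^ 4 + 28800 * ν ^ 5)
        + 6 * a ^ 2 * (355459 + 1019700 * ν + 996570 * ν ^ 2 + 398880 * ν ^ 3
          + 55800 * ν ^ 4)
        - a ^ 3 * (3254507 + 6118200 * ν + 3537720 * ν ^ 2 + 636480 * ν ^ 3)
        + 6 * a ^ 4 * (355459 + 395700 * ν + 102990 * ν ^ 2)
        - 3 * a ^ 5 * (189797 + 95400 * ν) + 48703 * a ^ 6) =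
     (1 + a) ^ 3 * (sqQ stE3 3 ν a + sqQ stE1 1 ν a * sqQ stE2 2 ν a + sqQ stE1 1 ν a ^ 3 / 6)
      - (-(1 / (24 * a)) *
      (11 + 24 * ν + 12 * ν ^ 2 - a * (25 + 24 * ν) + 11 * a ^ 2)) * (ν + 5 / 2) ^ 2
      + (1 / (1152 * a ^ 2) *
      (265 + 1056 * ν + 1416 * ν ^ 2 + 768 * ν ^ 3 + 144 * ν ^ 4
        - 2 * a * (791 + 2040 * ν + 1596 * ν ^ 2 + 384 * ν ^ 3)
        + 3 * a ^ 2 * (905 + 1360 * ν + 472 * ν ^ 2)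
        - 2 * a ^ 3 * (791 + 528 * ν) + 265 * a ^ 4)) * ((ν + 5 / 2) + (ν + 7 / 2)) := by
  have : 1 + a ≠ 0 := by positivity
  simp only [sqQ, stE1, stE2, stE3]
  field_simp
  ring

/-- logarithmic expansion of the Gamma ratio -/
lemma log_ratio (ν a : ℝ) (ha : 0 < a) : ∃ C S : ℝ, ∀ s : ℝ, S ≤ s →
    |s * (a * Real.log a - (1 + a) * Real.log (1 + a))
      + Real.log (Real.Gamma ((1 + a) * s + (ν + 5 / 2))) - Real.log (Real.Gamma (s + 3 / 2))
      - Real.log (Real.Gamma (a * s + (ν + 3 / 2)))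
      - ((ν + 2) * Real.log (1 + a) - (ν + 1) * Real.log a - Real.log (2 * Real.pi) / 2)
      - (sqQ stE1 1 ν a * s⁻¹ + sqQ stE2 2 ν a * s⁻¹ ^ 2 + sqQ stE3 3 ν a * s⁻¹ ^ 3)| ≤ C * s⁻¹ ^ 4 := by
  obtain ⟨C1, h1, H1⟩ := stirling_gamma (ν + 5 / 2)
  obtain ⟨C2, h2, H2⟩ := stirling_gamma (3 / 2)
  obtain ⟨C3, h3, H3⟩ := stirling_gamma (ν + 3 / 2)
  have hk : 0 < 1 + a := by linarith
  refine ⟨C1 * (1 + a)⁻¹ ^ 4 + C2 + C3 * a⁻¹ ^ 4,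
    1 + (2 * |ν + 5 / 2| + 2) / (1 + a) + (2 * |(3:ℝ) / 2| + 2) + (2 * |ν + 3 / 2| + 2) / a, ?_⟩
  intro s hs
  have p1 : 0 ≤ (2 * |ν + 5 / 2| + 2) / (1 + a) := by positivity
  have p2 : 0 ≤ (2 * |(3:ℝ) / 2| + 2) := by positivity
  have p3 : 0 ≤ (2 * |ν + 3 / 2| + 2) / a := by positivity
  have hs0 : 0 < s := by linarith
  have k1 := H1 ((1 + a) * s) (by rw [← div_le_iff₀' hk]; linarith)
  have k2 := H2 s (by linarith)
  have k3 := H3 (a * s) (by rw [← div_le_iff₀' ha]; linarith)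
  set D1 := Real.log (Real.Gamma ((1 + a) * s + (ν + 5 / 2))) - stS (ν + 5 / 2) ((1 + a) * s) with hD1
  set D2 := Real.log (Real.Gamma (s + 3 / 2)) - stS (3 / 2) s with hD2
  set D3 := Real.log (Real.Gamma (a * s + (ν + 3 / 2))) - stS (ν + 3 / 2) (a * s) with hD3
  have hid : s * (a * Real.log a - (1 + a) * Real.log (1 + a))
      + Real.log (Real.Gamma ((1 + a) * s + (ν + 5 / 2))) - Real.log (Real.Gamma (s + 3 / 2))
      - Real.log (Real.Gamma (a * s + (ν + 3 / 2)))
      - ((ν + 2) * Real.log (1 + a) - (ν + 1) * Real.log a - Real.log (2 * Real.pi) / 2)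
      - (sqQ stE1 1 ν a * s⁻¹ + sqQ stE2 2 ν a * s⁻¹ ^ 2 + sqQ stE3 3 ν a * s⁻¹ ^ 3) = D1 - D2 - D3 := by
    rw [hD1, hD2, hD3]
    simp only [stS, sqQ]
    rw [Real.log_mul hk.ne' hs0.ne', Real.log_mul ha.ne' hs0.ne']
    simp only [mul_inv, div_eq_mul_inv, ← inv_pow]
    ring
  rw [hid]
  have : |D1 - D2 - D3| ≤ |D1| + |D2| + |D3| := by
    refine (abs_sub _ _).trans ?_
    gcongr
    exact abs_sub _ _
  refine this.trans ?_
  have e1 : C1 * ((1 + a) * s)⁻¹ ^ 4 = C1 * (1 + a)⁻¹ ^ 4 * s⁻¹ ^ 4 := by rw [mul_inv]; ring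
  have e3 : C3 * (a * s)⁻¹ ^ 4 = C3 * a⁻¹ ^ 4 * s⁻¹ ^ 4 := by rw [mul_inv]; ring
  rw [e1] at k1
  rw [e3] at k3
  linarith

/-- exponentiating -/
lemma exp_expand (L u : ℕ → ℝ) (hu : Tendsto u atTop (𝓝 0)) (q1 q2 q3 : ℝ)
    (h : (fun n => L n - (q1 * u n + q2 * u n ^ 2 + q3 * u n ^ 3)) =O[atTop] (fun n => u n ^ 4)) :
    (fun n => Real.exp (L n) - (1 + q1 * u n + (q2 + q1 ^ 2 / 2) * u n ^ 2
      + (q3 + q1 * q2 + q1 ^ 3 / 6) * u n ^ 3)) =O[atTop] (fun n => u n ^ 4) := by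
  have hb : u =O[atTop] (fun _ => (1:ℝ)) := hu.isBigO_one ℝ
  have up : ∀ k : ℕ, (fun n => u n ^ (k + 4)) =O[atTop] (fun n => u n ^ 4) := by
    intro k
    have := (hb.pow k).mul (isBigO_refl (fun n => u n ^ 4) atTop)
    simpa [pow_add] using this
  set P : ℕ → ℝ := fun n => q1 * u n + q2 * u n ^ 2 + q3 * u n ^ 3 with hP
  have hPu : P =O[atTop] u := by
    have : P = fun n => (q1 + q2 * u n + q3 * u n ^ 2) * u n := by funext n; simp only [hP]; ring
    rw [this]
    have h1 : Tendsto (fun n => q1 + q2 * u n + q3 * u n ^ 2) atTop (𝓝 (q1 + q2 * 0 + q3 * 0 ^ 2)) :=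
      (tendsto_const_nhds.add (hu.const_mul q2)).add ((hu.pow 2).const_mul q3)
    simpa using (h1.isBigO_one ℝ).mul (isBigO_refl u atTop)
  have h41 : (fun n => u n ^ 4) =O[atTop] u := by
    have := (hb.pow 3).mul (isBigO_refl u atTop)
    simpa [← pow_succ] using this
  have hLu : L =O[atTop] u := by
    refine ((h.trans h41).add hPu).congr_left fun n => ?_
    simp only [hP]; ring
  have hL0 : Tendsto L atTop (𝓝 0) := hLu.trans_tendsto hu
  have hP0 : Tendsto P atTop (𝓝 0) := hPu.trans_tendsto hu
  have hexp : (fun n => Real.exp (L n) - (1 + L n + L n ^ 2 / 2 + L n ^ 3 / 6)) =O[atTop] (fun n => u n ^ 4) := by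
    refine IsBigO.trans ?_ (hLu.pow 4)
    refine IsBigO.of_bound 1 ?_
    have : ∀ᶠ n in atTop, |L n| ≤ 1 := by
      have := hL0.abs
      rw [abs_zero] at this
      exact this.eventually_le_const (by norm_num)
    filter_upwards [this] with n hn
    have := Real.exp_bound hn (n := 4) (by norm_num)
    simp only [Finset.sum_range_succ, Finset.sum_range_zero] at this
    norm_num [Nat.factorial] at this
    rw [Real.norm_eq_abs, Real.norm_eq_abs, abs_pow, one_mul]
    refine this.trans ?_
    nlinarith [pow_nonneg (abs_nonneg (L n)) 4]
  have hLP : (fun n => (1 + (L n + P n) / 2 + (L n ^ 2 + L n * P n + P n ^ 2) / 6) * (L n - P n)) =O[atTop] (fun n => u n ^ 4) := by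
    have h1 : Tendsto (fun n => 1 + (L n + P n) / 2 + (L n ^ 2 + L n * P n + P n ^ 2) / 6) atTop
        (𝓝 (1 + (0 + 0) / 2 + (0 ^ 2 + 0 * 0 + 0 ^ 2) / 6)) :=
      (tendsto_const_nhds.add ((hL0.add hP0).div_const 2)).add
        ((((hL0.pow 2).add (hL0.mul hP0)).add (hP0.pow 2)).div_const 6)
    simpa using (h1.isBigO_one ℝ).mul h
  have hrest := ((((up 0).const_mul_left (q2 ^ 2 / 2 + q1 * q3 + q1 ^ 2 * q2 / 2)).add
    ((up 1).const_mul_left (q2 * q3 + q1 * q2 ^ 2 / 2 + q1 ^ 2 * q3 / 2))).add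
    ((up 2).const_mul_left (q3 ^ 2 / 2 + q2 ^ 3 / 6 + q1 * q2 * q3))).add
    (((up 3).const_mul_left (q1 * q3 ^ 2 / 2 + q2 ^ 2 * q3 / 2)).add
    (((up 4).const_mul_left (q2 * q3 ^ 2 / 2)).add ((up 5).const_mul_left (q3 ^ 3 / 6))))
  refine ((hexp.add hLP).add hrest).congr_left ?_
  intro n
  simp only [hP]
  ring

/-- the inverse factorial side -/
lemma rat_expand (κ b0 b1 b2 A B D c1 c2 c3 : ℝ) (hκ : 0 < κ) (h1 : c1 = κ * A)
    (h2 : c2 = κ ^ 2 * B + c1 * b0) (h3 : c3 = κ ^ 3 * D - c1 * b0 ^ 2 + c2 * (b0 + b1)) :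
    (fun u : ℝ => (1 + A * u + B * u ^ 2 + D * u ^ 3) -
      (1 + c1 * u / (κ + b0 * u) + c2 * u ^ 2 / ((κ + b0 * u) * (κ + b1 * u))
        + c3 * u ^ 3 / ((κ + b0 * u) * (κ + b1 * u) * (κ + b2 * u)))) =O[𝓝 0] (fun u => u ^ 4) := by
  have hA : A = c1 / κ := by rw [h1]; field_simp
  have hB : B = (c2 - c1 * b0) / κ ^ 2 := by rw [h2]; field_simp; ring
  have hD : D = (c3 + c1 * b0 ^ 2 - c2 * (b0 + b1)) / κ ^ 3 := by rw [h3]; field_simp; ring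
  have hc : ∀ b : ℝ, ContinuousAt (fun u : ℝ => κ + b * u) 0 := fun b => by fun_prop
  have hne : ∀ b : ℝ, ∀ᶠ u : ℝ in 𝓝 0, κ + b * u ≠ 0 := fun b =>
    (hc b).eventually_ne (by simpa using hκ.ne')
  set G : ℝ → ℝ := fun u => c1 * (b0 ^ 3 / (κ ^ 3 * (κ + b0 * u)))
    - c2 * ((κ * ((b0 + b1) ^ 2 - b0 * b1) + (b0 + b1) * (b0 * b1) * u) / (κ ^ 3 * ((κ + b0 * u) * (κ + b1 * u))))
    + c3 * ((κ ^ 2 * (b0 + b1 + b2) + κ * (b0 * b1 + b0 * b2 + b1 * b2) * u + b0 * b1 * b2 * u ^ 2) /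
      (κ ^ 3 * ((κ + b0 * u) * (κ + b1 * u) * (κ + b2 * u)))) with hG
  have hGc : ContinuousAt G 0 := by
    simp only [hG]
    have hκ' := hκ.ne'
    refine ContinuousAt.add (ContinuousAt.sub ?_ ?_) ?_
    all_goals
      refine ContinuousAt.mul (by fun_prop) (ContinuousAt.div (by fun_prop) (by fun_prop) ?_)
      simp [hκ']
  have hGO : (fun u => G u * u ^ 4) =O[𝓝 0] (fun u : ℝ => u ^ 4) := by
    simpa using (hGc.tendsto.isBigO_one ℝ).mul (isBigO_refl (fun u : ℝ => u ^ 4) (𝓝 0))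
  refine hGO.congr' ?_ EventuallyEq.rfl
  filter_upwards [hne b0, hne b1, hne b2] with u k0 k1 k2
  have t1 : b0 ^ 3 / (κ ^ 3 * (κ + b0 * u)) * u ^ 4 = u / κ - b0 * u ^ 2 / κ ^ 2 + b0 ^ 2 * u ^ 3 / κ ^ 3
      - u / (κ + b0 * u) := by
    field_simp; ring
  have t2 : (κ * ((b0 + b1) ^ 2 - b0 * b1) + (b0 + b1) * (b0 * b1) * u) / (κ ^ 3 * ((κ + b0 * u) * (κ + b1 * u))) * u ^ 4
      = u ^ 2 / ((κ + b0 * u) * (κ + b1 * u)) - u ^ 2 / κ ^ 2 + (b0 + b1) * u ^ 3 / κ ^ 3 := by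
    field_simp; ring
  have t3 : (κ ^ 2 * (b0 + b1 + b2) + κ * (b0 * b1 + b0 * b2 + b1 * b2) * u + b0 * b1 * b2 * u ^ 2) /
      (κ ^ 3 * ((κ + b0 * u) * (κ + b1 * u) * (κ + b2 * u))) * u ^ 4 = u ^ 3 / κ ^ 3
      - u ^ 3 / ((κ + b0 * u) * (κ + b1 * u) * (κ + b2 * u)) := by
    field_simp; ring
  rw [hA, hB, hD]
  simp only [hG]
  linear_combination c1 * t1 - c2 * t2 + c3 * t3

end PartC1

section PartC2
open Filter Topology Asymptotics

set_option maxHeartbeats 1000000 in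
lemma gamma_ratio (ν a c₁ c₂ c₃ : ℝ) (ha : 0 < a)
    (h1 : c₁ = (1 + a) * sqQ stE1 1 ν a)
    (h2 : c₂ = (1 + a) ^ 2 * (sqQ stE2 2 ν a + sqQ stE1 1 ν a ^ 2 / 2) + c₁ * (ν + 5 / 2))
    (h3 : c₃ = (1 + a) ^ 3 * (sqQ stE3 3 ν a + sqQ stE1 1 ν a * sqQ stE2 2 ν a + sqQ stE1 1 ν a ^ 3 / 6)
      - c₁ * (ν + 5 / 2) ^ 2 + c₂ * ((ν + 5 / 2) + (ν + 7 / 2))) :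
    ∃ (C : ℝ) (n0 : ℕ), 0 ≤ C ∧ ∀ n : ℕ, n0 ≤ n → 2 ≤ (1 + a) * n + (ν + 5 / 2) ∧
      0 < a * n + (ν + 3 / 2) ∧
      |Real.exp (n * (a * Real.log a - (1 + a) * Real.log (1 + a))) /
          (Real.Gamma (n + 3 / 2) * Real.Gamma (a * n + (ν + 3 / 2))) -
        Real.exp ((ν + 2) * Real.log (1 + a) - (ν + 1) * Real.log a - Real.log (2 * Real.pi) / 2) *
        (1 / Real.Gamma ((1 + a) * n + (ν + 5 / 2)) + c₁ / Real.Gamma ((1 + a) * n + (ν + 5 / 2) + 1)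
          + c₂ / Real.Gamma ((1 + a) * n + (ν + 5 / 2) + 2) + c₃ / Real.Gamma ((1 + a) * n + (ν + 5 / 2) + 3))|
        ≤ C / Real.Gamma ((1 + a) * n + (ν + 5 / 2) + 4) := by
  have hk : 0 < 1 + a := by linarith
  obtain ⟨C0, S, hCS⟩ := log_ratio ν a ha
  set lr := a * Real.log a - (1 + a) * Real.log (1 + a) with hlr
  set lK := (ν + 2) * Real.log (1 + a) - (ν + 1) * Real.log a - Real.log (2 * Real.pi) / 2 with hlK
  have hu : Tendsto (fun n : ℕ => (n:ℝ)⁻¹) atTop (𝓝 0) := tendsto_inv_atTop_zero.comp tendsto_natCast_atTop_atTop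
  have hL : (fun n : ℕ => ((n:ℝ) * lr
      + Real.log (Real.Gamma ((1 + a) * n + (ν + 5 / 2))) - Real.log (Real.Gamma (n + 3 / 2))
      - Real.log (Real.Gamma (a * n + (ν + 3 / 2))) - lK)
      - (sqQ stE1 1 ν a * (n:ℝ)⁻¹ + sqQ stE2 2 ν a * (n:ℝ)⁻¹ ^ 2 + sqQ stE3 3 ν a * (n:ℝ)⁻¹ ^ 3)) =O[atTop]
      (fun n : ℕ => (n:ℝ)⁻¹ ^ 4) := by
    refine IsBigO.of_bound C0 ?_
    filter_upwards [tendsto_natCast_atTop_atTop.eventually_ge_atTop S] with n hn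
    have := hCS n hn
    rw [Real.norm_eq_abs, Real.norm_of_nonneg (by positivity)]
    exact this
  have hE := exp_expand _ _ hu _ _ _ hL
  have hR := (rat_expand (1 + a) (ν + 5 / 2) (ν + 7 / 2) (ν + 9 / 2) _ _ _ c₁ c₂ c₃ hk h1 h2 h3).comp_tendsto hu
  obtain ⟨C1, hC1, hb⟩ := (hE.add hR).exists_nonneg
  have hb := hb.bound
  have t1 : Tendsto (fun n : ℕ => (1 + a) * (n:ℝ) + (ν + 5 / 2)) atTop atTop :=
    tendsto_atTop_add_const_right _ _ (tendsto_natCast_atTop_atTop.const_mul_atTop hk)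
  have t2 : Tendsto (fun n : ℕ => a * (n:ℝ) + (ν + 3 / 2)) atTop atTop :=
    tendsto_atTop_add_const_right _ _ (tendsto_natCast_atTop_atTop.const_mul_atTop ha)
  obtain ⟨n0, hn0⟩ := eventually_atTop.mp (hb.and ((t1.eventually_ge_atTop 2).and
    ((t2.eventually_gt_atTop 0).and (eventually_gt_atTop 0))))
  refine ⟨Real.exp lK * C1 * (1 + a + |ν + 5 / 2| + 3) ^ 4, n0, by positivity, ?_⟩
  intro n hn
  obtain ⟨hbn, hX2, hY, hn1⟩ := hn0 n hn
  have hn1' : (1:ℝ) ≤ n := by exact_mod_cast hn1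
  have hnp : (0:ℝ) < n := by linarith
  refine ⟨hX2, hY, ?_⟩
  set X := (1 + a) * (n:ℝ) + (ν + 5 / 2) with hX
  have hXp : 0 < X := by linarith
  have G0 := Real.Gamma_pos_of_pos hXp
  have G1 : Real.Gamma (X + 1) = X * Real.Gamma X := Real.Gamma_add_one hXp.ne'
  have G2 : Real.Gamma (X + 2) = (X + 1) * (X * Real.Gamma X) := by
    rw [show X + 2 = X + 1 + 1 by ring, Real.Gamma_add_one (by positivity), G1]
  have G3 : Real.Gamma (X + 3) = (X + 2) * ((X + 1) * (X * Real.Gamma X)) := by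
    rw [show X + 3 = X + 2 + 1 by ring, Real.Gamma_add_one (by positivity), G2]
  have G4 : Real.Gamma (X + 4) = (X + 3) * ((X + 2) * ((X + 1) * (X * Real.Gamma X))) := by
    rw [show X + 4 = X + 3 + 1 by ring, Real.Gamma_add_one (by positivity), G3]
  have GA : 0 < Real.Gamma ((n:ℝ) + 3 / 2) := Real.Gamma_pos_of_pos (by positivity)
  have GB : 0 < Real.Gamma (a * (n:ℝ) + (ν + 3 / 2)) := Real.Gamma_pos_of_pos hY
  have d0 : (1 + a) + (ν + 5 / 2) * (n:ℝ)⁻¹ = X * (n:ℝ)⁻¹ := by rw [hX]; field_simp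
  have d1 : (1 + a) + (ν + 7 / 2) * (n:ℝ)⁻¹ = (X + 1) * (n:ℝ)⁻¹ := by rw [hX]; field_simp; ring
  have d2 : (1 + a) + (ν + 9 / 2) * (n:ℝ)⁻¹ = (X + 2) * (n:ℝ)⁻¹ := by rw [hX]; field_simp; ring
  have f1 : c₁ * (n:ℝ)⁻¹ / (X * (n:ℝ)⁻¹) = c₁ / X := by field_simp
  have f2 : c₂ * (n:ℝ)⁻¹ ^ 2 / (X * (n:ℝ)⁻¹ * ((X + 1) * (n:ℝ)⁻¹)) = c₂ / (X * (X + 1)) := by field_simp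
  have f3 : c₃ * (n:ℝ)⁻¹ ^ 3 / (X * (n:ℝ)⁻¹ * ((X + 1) * (n:ℝ)⁻¹) * ((X + 2) * (n:ℝ)⁻¹)) = c₃ / (X * (X + 1) * (X + 2)) := by field_simp
  simp only [Function.comp, d0, d1, d2, f1, f2, f3, sub_add_sub_cancel] at hbn
  rw [Real.norm_eq_abs, Real.norm_of_nonneg (by positivity)] at hbn
  have hexp : Real.exp ((n:ℝ) * lr + Real.log (Real.Gamma X) - Real.log (Real.Gamma (n + 3 / 2))
      - Real.log (Real.Gamma (a * n + (ν + 3 / 2))) - lK) = Real.exp (n * lr) * Real.Gamma X /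
        Real.Gamma (n + 3 / 2) / Real.Gamma (a * n + (ν + 3 / 2)) / Real.exp lK := by
    rw [Real.exp_sub, Real.exp_sub, Real.exp_sub, Real.exp_add, Real.exp_log G0, Real.exp_log GA, Real.exp_log GB]
  rw [hexp] at hbn
  have hEK := Real.exp_pos lK
  have hid : Real.exp (n * lr) / (Real.Gamma (n + 3 / 2) * Real.Gamma (a * n + (ν + 3 / 2))) -
        Real.exp lK * (1 / Real.Gamma X + c₁ / Real.Gamma (X + 1)
          + c₂ / Real.Gamma (X + 2) + c₃ / Real.Gamma (X + 3)) =
      (Real.exp lK / Real.Gamma X) * (Real.exp (n * lr) * Real.Gamma X /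
        Real.Gamma (n + 3 / 2) / Real.Gamma (a * n + (ν + 3 / 2)) / Real.exp lK -
        (1 + c₁ / X + c₂ / (X * (X + 1)) + c₃ / (X * (X + 1) * (X + 2)))) := by
    rw [G1, G2, G3]
    have e1 : Real.exp (n * lr) / (Real.Gamma (n + 3 / 2) * Real.Gamma (a * n + (ν + 3 / 2))) =
      (Real.exp lK / Real.Gamma X) * (Real.exp (n * lr) * Real.Gamma X /
        Real.Gamma (n + 3 / 2) / Real.Gamma (a * n + (ν + 3 / 2)) / Real.exp lK) := by field_simp
    rw [mul_sub (Real.exp lK / Real.Gamma X), ← e1]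
    congr 1
    field_simp
  rw [hid, abs_mul, abs_of_pos (by positivity)]
  have hX3 : X + 3 ≤ (1 + a + |ν + 5 / 2| + 3) * n := by
    rw [hX]
    have i1 := le_abs_self (ν + 5 / 2)
    have i2 : |ν + 5 / 2| * 1 ≤ |ν + 5 / 2| * n := mul_le_mul_of_nonneg_left hn1' (abs_nonneg _)
    linarith
  have hP : (X + 3) * ((X + 2) * ((X + 1) * X)) ≤ ((1 + a + |ν + 5 / 2| + 3) * n) ^ 4 := by
    calc (X + 3) * ((X + 2) * ((X + 1) * X)) ≤ (X + 3) * ((X + 3) * ((X + 3) * (X + 3))) := by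
          gcongr <;> linarith
      _ = (X + 3) ^ 4 := by ring
      _ ≤ _ := by gcongr
  calc Real.exp lK / Real.Gamma X * _ ≤ Real.exp lK / Real.Gamma X * (C1 * (n:ℝ)⁻¹ ^ 4) := by gcongr
    _ ≤ _ := by
      rw [G4, le_div_iff₀ (by positivity)]
      calc _ = Real.exp lK * C1 * (n:ℝ)⁻¹ ^ 4 * ((X + 3) * ((X + 2) * ((X + 1) * X))) := by field_simp
        _ ≤ Real.exp lK * C1 * (n:ℝ)⁻¹ ^ 4 * ((1 + a + |ν + 5 / 2| + 3) * n) ^ 4 := by gcongr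
        _ = _ := by field_simp

end PartC2

section PartD1
open Filter Topology Asymptotics

lemma pow_exp_bound (δ Z : ℝ) (hδ : 0 < δ) (hZ : 0 < Z) : Z ^ 4 * Real.exp (-(δ * Z)) ≤ 24 / δ ^ 4 := by
  have h := Real.pow_div_factorial_le_exp (δ * Z) (by positivity) 4
  rw [Real.exp_neg, ← div_eq_mul_inv, div_le_div_iff₀ (Real.exp_pos _) (by positivity)]
  norm_num [Nat.factorial] at h
  rw [div_le_iff₀ (by norm_num), mul_pow] at h
  linarith

lemma rpow_exp_bound (p : ℝ) : ∃ M : ℝ, ∀ Z : ℝ, 1 ≤ Z → Z ^ p * Real.exp (-Z) ≤ M := by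
  refine ⟨(⌈p⌉₊).factorial, fun Z hZ => ?_⟩
  have h := Real.pow_div_factorial_le_exp Z (by linarith) ⌈p⌉₊
  have h1 : Z ^ p ≤ Z ^ ⌈p⌉₊ := by
    rw [← Real.rpow_natCast]
    exact Real.rpow_le_rpow_of_exponent_le hZ (Nat.le_ceil p)
  have hf : (0:ℝ) < (⌈p⌉₊).factorial := by exact_mod_cast Nat.factorial_pos _
  rw [Real.exp_neg, ← div_eq_mul_inv, div_le_iff₀ (Real.exp_pos _)]
  rw [div_le_iff₀ hf] at h
  linarith

lemma ml_asymp4 (κ β : ℝ) (hκ : 0 < κ) (hβ : 2 ≤ β) : ∃ M : ℝ, ∀ Z : ℝ, 1 ≤ Z →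
    Z ^ 4 * |κ * Real.exp (-Z) * ∑' n : ℕ, Z ^ (κ * n + β - 1) / Real.Gamma (κ * n + β) - 1| ≤ M := by
  obtain ⟨C, δ, hδ, h⟩ := ml_asymp κ β hκ hβ
  refine ⟨24 / 1 ^ 4 + |C| * (24 / δ ^ 4), fun Z hZ => ?_⟩
  have hZ0 : 0 < Z := by linarith
  have h := h Z hZ0
  set S := ∑' n : ℕ, Z ^ (κ * n + β - 1) / Real.Gamma (κ * n + β)
  have e : κ * Real.exp (-Z) * S - 1 = Real.exp (-Z) * (κ * S - (Real.exp Z - 1)) - Real.exp (-Z) := by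
    have : Real.exp (-Z) * Real.exp Z = 1 := by rw [← Real.exp_add]; simp
    linear_combination this
  have b1 : |κ * Real.exp (-Z) * S - 1| ≤ Real.exp (-Z) * (|C| * Real.exp ((1 - δ) * Z)) + Real.exp (-Z) := by
    rw [e]
    refine (abs_sub _ _).trans ?_
    rw [abs_mul, abs_of_pos (Real.exp_pos _)]
    gcongr
    refine h.trans ?_
    gcongr
    exact le_abs_self C
  have e2 : Real.exp (-Z) * (|C| * Real.exp ((1 - δ) * Z)) = |C| * Real.exp (-(δ * Z)) := by
    rw [mul_left_comm, ← Real.exp_add]; ring_nf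
  have p1 := pow_exp_bound 1 Z one_pos hZ0
  have p2 := pow_exp_bound δ Z hδ hZ0
  rw [one_mul] at p1
  calc Z ^ 4 * _ ≤ Z ^ 4 * (|C| * Real.exp (-(δ * Z)) + Real.exp (-Z)) := by
        rw [← e2]; gcongr
    _ = Z ^ 4 * Real.exp (-Z) + |C| * (Z ^ 4 * Real.exp (-(δ * Z))) := by ring
    _ ≤ _ := by gcongr

lemma fin_bound (κ p : ℝ) (g : ℕ → ℝ) (n0 : ℕ) : ∃ M : ℝ, ∀ Z : ℝ, 1 ≤ Z →
    |Z ^ 4 * (Z ^ p * Real.exp (-Z) * ∑ n ∈ Finset.range n0, Z ^ (κ * n) * g n)| ≤ M := by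
  choose m hm using rpow_exp_bound
  refine ⟨∑ n ∈ Finset.range n0, m (4 + p + κ * n) * |g n|, fun Z hZ => ?_⟩
  have hZ0 : 0 < Z := by linarith
  have e : Z ^ 4 * (Z ^ p * Real.exp (-Z) * ∑ n ∈ Finset.range n0, Z ^ (κ * n) * g n) =
      ∑ n ∈ Finset.range n0, Z ^ (4 + p + κ * n) * Real.exp (-Z) * g n := by
    rw [Finset.mul_sum, Finset.mul_sum]
    refine Finset.sum_congr rfl fun n _ => ?_
    rw [Real.rpow_add hZ0, Real.rpow_add hZ0]
    have : Z ^ (4:ℝ) = Z ^ 4 := by norm_cast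
    rw [this]; ring
  rw [e]
  refine (Finset.abs_sum_le_sum_abs _ _).trans ?_
  refine Finset.sum_le_sum fun n _ => ?_
  rw [abs_mul, abs_of_pos (by positivity)]
  gcongr
  exact hm _ Z hZ

set_option maxHeartbeats 1000000 in
lemma real_main (ν a c₁ c₂ c₃ K A lr : ℝ) (f : ℕ → ℝ) (ha : 0 < a) (hA : 0 < A) (hK : K = (1 + a) * A)
    (C : ℝ) (n0 : ℕ) (hC : 0 ≤ C)
    (hn0 : 2 ≤ (1 + a) * n0 + (ν + 5 / 2))
    (H : ∀ n : ℕ, n0 ≤ n → |Real.exp (n * lr) * f n -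
        K * (1 / Real.Gamma ((1 + a) * n + (ν + 5 / 2)) + c₁ / Real.Gamma ((1 + a) * n + (ν + 5 / 2) + 1)
          + c₂ / Real.Gamma ((1 + a) * n + (ν + 5 / 2) + 2) + c₃ / Real.Gamma ((1 + a) * n + (ν + 5 / 2) + 3))|
        ≤ C / Real.Gamma ((1 + a) * n + (ν + 5 / 2) + 4)) :
    ∃ M : ℝ, ∀ Z : ℝ, 1 ≤ Z →
      |Z ^ 4 * (((∑' n : ℕ, Z ^ ((1 + a) * n) * (Real.exp (n * lr) * f n)) * Z ^ (ν + 3 / 2) * Real.exp (-Z)) / A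
        - 1 - c₁ / Z - c₂ / Z ^ 2 - c₃ / Z ^ 3)| ≤ M := by
  have hk : 0 < 1 + a := by linarith
  set κ := 1 + a with hκd
  set B := κ * n0 + (ν + 5 / 2) with hB
  obtain ⟨MF, hMF⟩ := fin_bound κ (ν + 3 / 2) (fun n => Real.exp (n * lr) * f n) n0
  obtain ⟨M0, hM0⟩ := ml_asymp4 κ B hk hn0
  obtain ⟨M1, hM1⟩ := ml_asymp4 κ (B + 1) hk (by linarith)
  obtain ⟨M2, hM2⟩ := ml_asymp4 κ (B + 2) hk (by linarith)
  obtain ⟨M3, hM3⟩ := ml_asymp4 κ (B + 3) hk (by linarith)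
  obtain ⟨M4, hM4⟩ := ml_asymp4 κ (B + 4) hk (by linarith)
  refine ⟨MF / A + C * (1 + M4) / κ / A + M0 + |c₁| * M1 + |c₂| * M2 + |c₃| * M3, fun Z hZ => ?_⟩
  have hZ0 : 0 < Z := by linarith
  have hMF := hMF Z hZ
  have hM0 := hM0 Z hZ
  have hM1 := hM1 Z hZ
  have hM2 := hM2 Z hZ
  have hM3 := hM3 Z hZ
  have hM4 := hM4 Z hZ
  have s0 := ml_summable κ B Z hk hn0 hZ0
  have s1 := ml_summable κ (B + 1) Z hk (by linarith) hZ0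
  have s2 := ml_summable κ (B + 2) Z hk (by linarith) hZ0
  have s3 := ml_summable κ (B + 3) Z hk (by linarith) hZ0
  have s4 := ml_summable κ (B + 4) Z hk (by linarith) hZ0
  set T0 : ℕ → ℝ := fun n => Z ^ (κ * n + B - 1) / Real.Gamma (κ * n + B) with hT0
  set T1 : ℕ → ℝ := fun n => Z ^ (κ * n + (B + 1) - 1) / Real.Gamma (κ * n + (B + 1)) with hT1
  set T2 : ℕ → ℝ := fun n => Z ^ (κ * n + (B + 2) - 1) / Real.Gamma (κ * n + (B + 2)) with hT2
  set T3 : ℕ → ℝ := fun n => Z ^ (κ * n + (B + 3) - 1) / Real.Gamma (κ * n + (B + 3)) with hT3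
  set T4 : ℕ → ℝ := fun n => Z ^ (κ * n + (B + 4) - 1) / Real.Gamma (κ * n + (B + 4)) with hT4
  set g : ℕ → ℝ := fun n => Z ^ (κ * n) * (Real.exp (n * lr) * f n) with hg
  have hpt : ∀ n : ℕ, |Z ^ (ν + 3 / 2) * g (n + n0) -
      K * (T0 n + c₁ / Z * T1 n + c₂ / Z ^ 2 * T2 n + c₃ / Z ^ 3 * T3 n)| ≤ C / Z ^ 4 * T4 n := by
    intro n
    have h := H (n + n0) (by omega)
    have eX : κ * ((n + n0 : ℕ) : ℝ) + (ν + 5 / 2) = κ * n + B := by rw [hB]; push_cast; ring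
    rw [eX] at h
    set W := Z ^ (κ * n + B - 1) with hW
    have hWp : 0 < W := Real.rpow_pos_of_pos hZ0 _
    have eW : Z ^ (ν + 3 / 2) * Z ^ (κ * ((n + n0 : ℕ) : ℝ)) = W := by
      rw [← Real.rpow_add hZ0, hW, ← eX]; congr 1; ring
    have w1 : Z ^ (κ * n + (B + 1) - 1) = W * Z := by
      rw [show κ * n + (B + 1) - 1 = (κ * n + B - 1) + 1 by ring, Real.rpow_add hZ0, Real.rpow_one]
    have w2 : Z ^ (κ * n + (B + 2) - 1) = W * Z ^ 2 := by
      rw [show κ * n + (B + 2) - 1 = (κ * n + B - 1) + (2:ℕ) by push_cast; ring, Real.rpow_add_natCast hZ0.ne']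
    have w3 : Z ^ (κ * n + (B + 3) - 1) = W * Z ^ 3 := by
      rw [show κ * n + (B + 3) - 1 = (κ * n + B - 1) + (3:ℕ) by push_cast; ring, Real.rpow_add_natCast hZ0.ne']
    have w4 : Z ^ (κ * n + (B + 4) - 1) = W * Z ^ 4 := by
      rw [show κ * n + (B + 4) - 1 = (κ * n + B - 1) + (4:ℕ) by push_cast; ring, Real.rpow_add_natCast hZ0.ne']
    simp only [hT0, hT1, hT2, hT3, hT4, hg]
    rw [w1, w2, w3, w4, ← hW, ← add_assoc _ B 1, ← add_assoc _ B 2, ← add_assoc _ B 3, ← add_assoc _ B 4]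
    have := mul_le_mul_of_nonneg_left h hWp.le
    rw [← abs_of_pos hWp, ← abs_mul, abs_of_pos hWp] at this
    refine le_trans (le_of_eq ?_) (this.trans (le_of_eq ?_))
    · congr 1
      rw [← mul_assoc (Z ^ (ν + 3 / 2)), eW]
      have z1 : c₁ / Z * (W * Z / Real.Gamma (κ * n + B + 1)) = W * (c₁ / Real.Gamma (κ * n + B + 1)) := by
        field_simp
      have z2 : c₂ / Z ^ 2 * (W * Z ^ 2 / Real.Gamma (κ * n + B + 2)) = W * (c₂ / Real.Gamma (κ * n + B + 2)) := by
        field_simp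
      have z3 : c₃ / Z ^ 3 * (W * Z ^ 3 / Real.Gamma (κ * n + B + 3)) = W * (c₃ / Real.Gamma (κ * n + B + 3)) := by
        field_simp
      rw [z1, z2, z3]
      ring
    · field_simp
  have sM : Summable (fun n => K * (T0 n + c₁ / Z * T1 n + c₂ / Z ^ 2 * T2 n + c₃ / Z ^ 3 * T3 n)) :=
    (((s0.add (s1.mul_left _)).add (s2.mul_left _)).add (s3.mul_left _)).mul_left K
  have sD : Summable (fun n => Z ^ (ν + 3 / 2) * g (n + n0) -
      K * (T0 n + c₁ / Z * T1 n + c₂ / Z ^ 2 * T2 n + c₃ / Z ^ 3 * T3 n)) :=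
    Summable.of_norm_bounded (s4.mul_left (C / Z ^ 4)) hpt
  have sw : Summable (fun n => Z ^ (ν + 3 / 2) * g (n + n0)) := by
    simpa using sD.add sM
  have hZp : 0 < Z ^ (ν + 3 / 2) := Real.rpow_pos_of_pos hZ0 _
  have sg' : Summable (fun n => g (n + n0)) := (summable_mul_left_iff hZp.ne').mp sw
  have sg : Summable g := (summable_nat_add_iff n0).mp sg'
  have hsum : ∑' n, Z ^ (ν + 3 / 2) * g (n + n0) =
      ∑' n, (Z ^ (ν + 3 / 2) * g (n + n0) -
      K * (T0 n + c₁ / Z * T1 n + c₂ / Z ^ 2 * T2 n + c₃ / Z ^ 3 * T3 n)) +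
      K * (∑' n, T0 n + c₁ / Z * ∑' n, T1 n + c₂ / Z ^ 2 * ∑' n, T2 n + c₃ / Z ^ 3 * ∑' n, T3 n) := by
    have : ∑' n, K * (T0 n + c₁ / Z * T1 n + c₂ / Z ^ 2 * T2 n + c₃ / Z ^ 3 * T3 n) =
       K * (∑' n, T0 n + c₁ / Z * ∑' n, T1 n + c₂ / Z ^ 2 * ∑' n, T2 n + c₃ / Z ^ 3 * ∑' n, T3 n) := by
      rw [tsum_mul_left, Summable.tsum_add ((s0.add (s1.mul_left _)).add (s2.mul_left _)) (s3.mul_left _),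
        Summable.tsum_add (s0.add (s1.mul_left _)) (s2.mul_left _),
        Summable.tsum_add s0 (s1.mul_left _), tsum_mul_left, tsum_mul_left, tsum_mul_left]
    rw [← this, ← Summable.tsum_add sD sM]
    simp
  have hD : |∑' n, (Z ^ (ν + 3 / 2) * g (n + n0) -
      K * (T0 n + c₁ / Z * T1 n + c₂ / Z ^ 2 * T2 n + c₃ / Z ^ 3 * T3 n))| ≤ C / Z ^ 4 * ∑' n, T4 n := by
    rw [← tsum_mul_left, ← Real.norm_eq_abs]
    exact tsum_of_norm_bounded (s4.mul_left (C / Z ^ 4)).hasSum hpt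
  set D := ∑' n, (Z ^ (ν + 3 / 2) * g (n + n0) -
      K * (T0 n + c₁ / Z * T1 n + c₂ / Z ^ 2 * T2 n + c₃ / Z ^ 3 * T3 n)) with hDd
  have hsplit := sg.sum_add_tsum_nat_add n0
  rw [tsum_mul_left] at hsum
  set F := ∑ n ∈ Finset.range n0, g n with hF
  set U0 := ∑' n, T0 n
  set U1 := ∑' n, T1 n
  set U2 := ∑' n, T2 n
  set U3 := ∑' n, T3 n
  set U4 := ∑' n, T4 n
  set e := Real.exp (-Z) with he
  have hep : 0 < e := Real.exp_pos _
  have hid : Z ^ 4 * ((∑' n, g n) * Z ^ (ν + 3 / 2) * e / A - 1 - c₁ / Z - c₂ / Z ^ 2 - c₃ / Z ^ 3) =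
      Z ^ 4 * (Z ^ (ν + 3 / 2) * e * F) / A + Z ^ 4 * e * D / A + Z ^ 4 * (κ * e * U0 - 1)
      + c₁ / Z * (Z ^ 4 * (κ * e * U1 - 1)) + c₂ / Z ^ 2 * (Z ^ 4 * (κ * e * U2 - 1))
      + c₃ / Z ^ 3 * (Z ^ 4 * (κ * e * U3 - 1)) := by
    have : (∑' n, g n) * Z ^ (ν + 3 / 2) * e / A = Z ^ (ν + 3 / 2) * e * F / A + e * D / A
        + κ * e * (U0 + c₁ / Z * U1 + c₂ / Z ^ 2 * U2 + c₃ / Z ^ 3 * U3) := by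
      rw [← hsplit, add_mul, mul_comm (∑' i, g (i + n0)), hsum, hK]
      field_simp
      ring
    rw [this]
    ring
  rw [hid]
  have q1 : |Z ^ 4 * (Z ^ (ν + 3 / 2) * e * F) / A| ≤ MF / A := by
    rw [abs_div, abs_of_pos hA]; gcongr
  have q2 : |Z ^ 4 * e * D / A| ≤ C * (1 + M4) / κ / A := by
    rw [abs_div, abs_of_pos hA, abs_mul, abs_of_pos (by positivity)]
    gcongr
    have hE : κ * e * U4 ≤ 1 + M4 := by
      have h1 : |κ * e * U4 - 1| ≤ Z ^ 4 * |κ * e * U4 - 1| :=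
        le_mul_of_one_le_left (abs_nonneg _) (one_le_pow₀ hZ)
      linarith [le_abs_self (κ * e * U4 - 1)]
    calc Z ^ 4 * e * |D| ≤ Z ^ 4 * e * (C / Z ^ 4 * U4) := by gcongr
      _ = C * (κ * e * U4) / κ := by field_simp
      _ ≤ _ := by gcongr
  have q3 : |Z ^ 4 * (κ * e * U0 - 1)| ≤ M0 := by
    rw [abs_mul, abs_of_pos (by positivity)]; exact hM0
  have qq : ∀ (c M : ℝ) (i : ℕ) (V : ℝ), Z ^ 4 * |κ * e * V - 1| ≤ M →
      |c / Z ^ i * (Z ^ 4 * (κ * e * V - 1))| ≤ |c| * M := by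
    intro c M i V h
    rw [abs_mul, abs_mul, abs_of_pos (by positivity : 0 < Z ^ 4), abs_div, abs_of_pos (by positivity : 0 < Z ^ i)]
    gcongr
    exact div_le_self (abs_nonneg _) (one_le_pow₀ hZ)
  have q4 := qq c₁ M1 1 U1 hM1
  rw [pow_one] at q4
  have q5 := qq c₂ M2 2 U2 hM2
  have q6 := qq c₃ M3 3 U3 hM3
  refine (abs_add_le _ _).trans (add_le_add ?_ q6)
  refine (abs_add_le _ _).trans (add_le_add ?_ q5)
  refine (abs_add_le _ _).trans (add_le_add ?_ q4)
  refine (abs_add_le _ _).trans (add_le_add ?_ q3)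
  exact (abs_add_le _ _).trans (add_le_add q1 q2)

end PartD1

lemma struveZ_pos (a x : ℝ) (ha : 0 < a) (hx : 0 < x) : 0 < struveZ a x := by
  unfold struveZ
  have := Real.rpow_pos_of_pos ha (-a)
  positivity

lemma struveZ_log (a x : ℝ) (ha : 0 < a) (hx : 0 < x) :
    Real.log (struveZ a x) = Real.log (1 + a) + 1 / (1 + a) * (-a * Real.log a + Real.log ((x / 2) ^ 2)) := by
  unfold struveZ
  have h1 := Real.rpow_pos_of_pos ha (-a)
  have e : a ^ (-a) * x ^ 2 / 4 = a ^ (-a) * (x / 2) ^ 2 := by ring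
  rw [Real.log_mul (by positivity) (by positivity), Real.log_rpow (by positivity), e,
    Real.log_mul (by positivity) (by positivity), Real.log_rpow ha]

lemma struveZ_pow (a x : ℝ) (ha : 0 < a) (hx : 0 < x) (n : ℕ) :
    struveZ a x ^ ((1 + a) * (n:ℝ)) * Real.exp (n * (a * Real.log a - (1 + a) * Real.log (1 + a)))
      = (x / 2) ^ (2 * n) := by
  have hZ := struveZ_pos a x ha hx
  have hy : 0 < (x / 2) ^ 2 := by positivity
  rw [Real.rpow_def_of_pos hZ, struveZ_log a x ha hx, ← Real.exp_add, pow_mul]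
  generalize (x / 2) ^ 2 = y at hy
  rw [← Real.exp_log (pow_pos hy n), Real.log_pow]
  congr 1
  field_simp
  ring

lemma struveZ_tendsto (a : ℝ) (ha : 0 < a) : Tendsto (struveZ a) atTop atTop := by
  unfold struveZ
  have h1 := Real.rpow_pos_of_pos ha (-a)
  refine Tendsto.const_mul_atTop (by positivity) ?_
  refine (tendsto_rpow_atTop (by positivity)).comp ?_
  refine Tendsto.atTop_div_const (by norm_num) ?_
  exact Tendsto.const_mul_atTop h1 (tendsto_pow_atTop (by norm_num))

lemma A_eq (ν a : ℝ) (ha : 0 < a) :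
    Real.exp ((ν + 2) * Real.log (1 + a) - (ν + 1) * Real.log a - Real.log (2 * Real.pi) / 2)
      = (1 + a) * (((1 + a) / a) ^ (ν + 1) / Real.sqrt (2 * Real.pi)) := by
  have hk : 0 < 1 + a := by linarith
  have hp : 0 < 2 * Real.pi := by positivity
  rw [Real.rpow_def_of_pos (by positivity), Real.log_div hk.ne' ha.ne']
  rw [← Real.exp_log (Real.sqrt_pos.mpr hp), Real.log_sqrt hp.le, ← Real.exp_sub]
  nth_rw 2 [← Real.exp_log hk]
  rw [← Real.exp_add]
  congr 1
  ring

lemma struveL_real (ν a x : ℝ) (hx : 0 < x) :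
    ((x : ℂ) / 2) ^ (-(ν : ℂ) - 1) * struveL ν a (x : ℂ) =
      ((∑' n : ℕ, (x / 2) ^ (2 * n) * (1 / (Real.Gamma (n + 3 / 2) * Real.Gamma (a * n + (ν + 3 / 2)))) : ℝ) : ℂ) := by
  unfold struveL
  have hx2 : (x : ℂ) / 2 ≠ 0 := by
    have : (x:ℂ) ≠ 0 := by exact_mod_cast hx.ne'
    simpa using this
  rw [← mul_assoc, ← Complex.cpow_add _ _ hx2, show -(ν:ℂ) - 1 + (ν + 1) = 0 by ring, Complex.cpow_zero, one_mul,
    Complex.ofReal_tsum]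
  refine tsum_congr fun n => ?_
  push_cast
  rw [← Complex.Gamma_ofReal, ← Complex.Gamma_ofReal]
  push_cast
  rw [mul_one_div, ← add_assoc]

/-- Four-term exponential expansion of `L_ν(x;a)` for `a > 0` as `x → +∞`:
`(x/2)^{−ν−1} L_ν(x;a) = A₀ Z^{−ν−3/2} e^Z (1 + c₁/Z + c₂/Z² + c₃/Z³ + O(Z^{−4}))`. -/
theorem struveL_exponential_expansion_four_terms (ν a : ℝ) (ha : 0 < a)
    (A₀ c₁ c₂ c₃ : ℝ)
    (hA₀ : A₀ = ((1 + a) / a) ^ (ν + 1) / Real.sqrt (2 * Real.pi))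
    (hc₁ : c₁ = -(1 / (24 * a)) *
      (11 + 24 * ν + 12 * ν ^ 2 - a * (25 + 24 * ν) + 11 * a ^ 2))
    (hc₂ : c₂ = 1 / (1152 * a ^ 2) *
      (265 + 1056 * ν + 1416 * ν ^ 2 + 768 * ν ^ 3 + 144 * ν ^ 4
        - 2 * a * (791 + 2040 * ν + 1596 * ν ^ 2 + 384 * ν ^ 3)
        + 3 * a ^ 2 * (905 + 1360 * ν + 472 * ν ^ 2)
        - 2 * a ^ 3 * (791 + 528 * ν) + 265 * a ^ 4))
    (hc₃ : c₃ = -(1 / (414720 * a ^ 3)) *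
      ((48703 + 286200 * ν + 617940 * ν ^ 2 + 636480 * ν ^ 3 + 334800 * ν ^ 4
          + 86400 * ν ^ 5 + 8640 * ν ^ 6)
        - 3 * a * (189797 + 791400 * ν + 1179240 * ν ^ 2 + 797760 * ν ^ 3
          + 248400 * ν ^ 4 + 28800 * ν ^ 5)
        + 6 * a ^ 2 * (355459 + 1019700 * ν + 996570 * ν ^ 2 + 398880 * ν ^ 3
          + 55800 * ν ^ 4)
        - a ^ 3 * (3254507 + 6118200 * ν + 3537720 * ν ^ 2 + 636480 * ν ^ 3)
        + 6 * a ^ 4 * (355459 + 395700 * ν + 102990 * ν ^ 2)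
        - 3 * a ^ 5 * (189797 + 95400 * ν) + 48703 * a ^ 6)) :
    ∃ C T : ℝ, ∀ x : ℝ, T ≤ x →
      ‖((struveZ a x : ℝ) : ℂ) ^ 4 *
        (((x : ℂ) / 2) ^ (-(ν : ℂ) - 1) * struveL ν a (x : ℂ) *
          ((struveZ a x ^ (ν + 3 / 2) : ℝ) : ℂ) * (Real.exp (-struveZ a x) : ℂ) /
            (A₀ : ℂ) - 1 - (c₁ : ℂ) / ((struveZ a x : ℝ) : ℂ)
          - (c₂ : ℂ) / ((struveZ a x : ℝ) : ℂ) ^ 2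
          - (c₃ : ℂ) / ((struveZ a x : ℝ) : ℂ) ^ 3)‖ ≤ C := by
  have hk : 0 < 1 + a := by linarith
  have k1 : c₁ = (1 + a) * sqQ stE1 1 ν a := by rw [hc₁]; exact coef1 ν a ha
  have k2 : c₂ = (1 + a) ^ 2 * (sqQ stE2 2 ν a + sqQ stE1 1 ν a ^ 2 / 2) + c₁ * (ν + 5 / 2) := by
    rw [hc₂, hc₁]; exact coef2 ν a ha
  have k3 : c₃ = (1 + a) ^ 3 * (sqQ stE3 3 ν a + sqQ stE1 1 ν a * sqQ stE2 2 ν a + sqQ stE1 1 ν a ^ 3 / 6)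
      - c₁ * (ν + 5 / 2) ^ 2 + c₂ * ((ν + 5 / 2) + (ν + 7 / 2)) := by
    rw [hc₃, hc₂, hc₁]; exact coef3 ν a ha
  clear hc₁ hc₂ hc₃
  have hAK := A_eq ν a ha
  rw [← hA₀] at hAK
  have hA : 0 < A₀ := by rw [hA₀]; positivity
  obtain ⟨C, n0, hC, H⟩ := gamma_ratio ν a c₁ c₂ c₃ ha k1 k2 k3
  rw [hAK] at H
  obtain ⟨M, hM⟩ := real_main ν a c₁ c₂ c₃ ((1 + a) * A₀) A₀ (a * Real.log a - (1 + a) * Real.log (1 + a))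
    (fun n => 1 / (Real.Gamma (n + 3 / 2) * Real.Gamma (a * n + (ν + 3 / 2)))) ha hA rfl C n0 hC (H n0 le_rfl).1
    (fun n hn => by
      have := (H n hn).2.2
      rw [div_eq_mul_one_div] at this
      exact this)
  obtain ⟨T, hT⟩ := eventually_atTop.mp (((struveZ_tendsto a ha).eventually_ge_atTop 1).and (eventually_gt_atTop 0))
  refine ⟨M, T, fun x hx => ?_⟩
  obtain ⟨hZ1, hx0⟩ := hT x hx
  have h := hM (struveZ a x) hZ1
  have e : ∀ n : ℕ, struveZ a x ^ ((1 + a) * (n:ℝ)) * (Real.exp (n * (a * Real.log a - (1 + a) * Real.log (1 + a))) *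
      (1 / (Real.Gamma (n + 3 / 2) * Real.Gamma (a * n + (ν + 3 / 2))))) =
      (x / 2) ^ (2 * n) * (1 / (Real.Gamma (n + 3 / 2) * Real.Gamma (a * n + (ν + 3 / 2)))) := by
    intro n
    rw [← mul_assoc, struveZ_pow a x ha hx0 n]
  rw [tsum_congr e] at h
  rw [struveL_real ν a x hx0]
  refine le_trans (le_of_eq ?_) h
  rw [← Real.norm_eq_abs, ← Complex.norm_real]
  push_cast
  rfl
end
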